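/- arXiv:2509.00273 — 2 statements merged into one kernel-verified Lean document; each statement's English description precedes it below -/
import Mathlib

section
/- Let d ≥ 3 be odd and suppose some prime ℓ with ℓ ≡ 3 (mod 4) divides d. Let p be a prime with p ≡ 1 (mod 4) and p ∤ d. Then H_d is not maximal over any finite field of characteristic p; that is, for every n ≥ 1 and q = p^n, #{(x,y) ∈ 𝔽_{q²} × 𝔽_{q²} : y² = φ_d(x)} ≠ q² + (d−1)q. -/
open Polynomial

/-- Number of affine points (x,y) ∈ F × F with y² = φ_d(x), where φ_d is the
d-th Chebyshev (Dickson first kind, parameter 1) polynomial over F. -/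
noncomputable def chebAffineCount (F : Type) [Field F] (d : ℕ) : ℕ :=
  Nat.card {xy : F × F // xy.2 ^ 2 = (dickson 1 (1 : F) d).eval xy.1}

/-- The hyperelliptic curve H_d : y² = φ_d(x) is maximal over the field with q² elements:
its affine point count attains q² + (d-1)q (Hasse–Weil bound minus the point at infinity). -/
def chebMaximal (d q : ℕ) : Prop :=
  ∀ (F : Type) [Field F] [Fintype F], Fintype.card F = q ^ 2 →
    chebAffineCount F d = q ^ 2 + (d - 1) * q



/-- The quadratic character with values in a ring. -/
noncomputable def qch (F : Type) [Field F] [Fintype F] (R : Type) [CommRing R] : MulChar F R :=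
  letI := Classical.decEq F
  (quadraticChar F).ringHomComp (Int.castRingHom R)

theorem sum_units_eq {F : Type} [Field F] [Fintype F] [Fintype Fˣ] {R : Type} [CommRing R] (f : F → R) (h0 : f 0 = 0) :
    ∑ z : Fˣ, f z = ∑ z : F, f z := by
  classical
  rw [← Finset.sum_subset (Finset.subset_univ (Finset.univ.image (fun z : Fˣ => (z : F))))]
  · rw [Finset.sum_image]
    intro a _ b _ h
    exact Units.ext h
  · intro x _ hx
    by_cases h : x = 0
    · rw [h, h0]
    · exact absurd (Finset.mem_image.2 ⟨Units.mk0 x h, Finset.mem_univ _, rfl⟩) hx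

theorem qch_ringHomComp (F : Type) [Field F] [Fintype F] {R S : Type} [CommRing R] [CommRing S]
    (f : R →+* S) : (qch F R).ringHomComp f = qch F S := by
  ext a
  simp [qch, MulChar.ringHomComp]

theorem qch_quad (F : Type) [Field F] [Fintype F] {R : Type} [CommRing R] :
    (qch F R).IsQuadratic := by
  classical
  exact (quadraticChar_isQuadratic F).comp _

theorem qch_sq (F : Type) [Field F] [Fintype F] {R : Type} [CommRing R] :
    (qch F R) ^ 2 = 1 := (qch_quad F).sq_eq_one

theorem qch_ne_one (F : Type) [Field F] [Fintype F] (hF : ringChar F ≠ 2)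
    (R : Type) [Field R] [CharZero R] : qch F R ≠ 1 := by
  classical
  exact (MulChar.ringHomComp_ne_one_iff (RingHom.injective_int _)).2 (quadraticChar_ne_one hF)

theorem qch_inv_apply (F : Type) [Field F] [Fintype F] {R : Type} [CommRing R] (a : F) :
    qch F R a⁻¹ = qch F R a := by
  rw [← MulChar.inv_apply', (qch_quad F).inv]

theorem qch_card (F : Type) [Field F] [Fintype F] [DecidableEq F] (hF : ringChar F ≠ 2)
    (R : Type) [CommRing R] (a : F) :
    (((Finset.univ.filter (fun x : F => x ^ 2 = a)).card : ℕ) : R) = 1 + qch F R a := by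
  have := quadraticChar_card_sqrts hF a
  have h2 : ({x : F | x ^ 2 = a}.toFinset) = (Finset.univ.filter (fun x : F => x ^ 2 = a)) := by
    ext; simp
  rw [h2] at this
  have h3 := congrArg (Int.cast : ℤ → R) this
  push_cast at h3
  rw [h3, add_comm]
  congr 1
  simp only [qch, MulChar.ringHomComp]
  simp
  congr!

theorem sum_sq_eq (F : Type) [Field F] [Fintype F] (hF : ringChar F ≠ 2)
    {R : Type} [CommRing R] (f : F → R) :
    ∑ z : F, f (z ^ 2) = ∑ w : F, (1 + qch F R w) * f w := by
  classical
  rw [← Finset.sum_fiberwise_of_maps_to (s := Finset.univ) (t := Finset.univ) (g := fun z : F => z ^ 2)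
    (fun _ _ => Finset.mem_univ _)]
  refine Finset.sum_congr rfl fun w _ => ?_
  rw [← qch_card F hF, ← nsmul_eq_mul, ← Finset.sum_const]
  refine Finset.sum_congr rfl fun z hz => ?_
  rw [(Finset.mem_filter.1 hz).2]

theorem sum_dual (F : Type) [Field F] [Fintype F] [Fintype (MulChar F ℂ)] (u : Fˣ) [Decidable (u = 1)] :
    ∑ Θ : MulChar F ℂ, Θ u = if u = 1 then (Fintype.card (MulChar F ℂ) : ℂ) else 0 := by
  split_ifs with h
  · simp [h]
  · have hne : (u : F) ≠ 1 := fun h' => h (Units.ext h')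
    have : NeZero ((Monoid.exponent Fˣ : ℕ) : ℂ) := ⟨by
      exact_mod_cast Monoid.exponent_ne_zero_of_finite⟩
    obtain ⟨Θ₀, hΘ⟩ := MulChar.exists_apply_ne_one_of_hasEnoughRootsOfUnity F ℂ hne
    have h1 : ∑ Θ : MulChar F ℂ, Θ u = Θ₀ u * ∑ Θ : MulChar F ℂ, Θ u := by
      rw [Finset.mul_sum, ← Equiv.sum_comp (Equiv.mulLeft Θ₀)]
      simp
    have h2 : (1 - Θ₀ u) * ∑ Θ : MulChar F ℂ, Θ u = 0 := by linear_combination h1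
    rcases mul_eq_zero.1 h2 with h3 | h3
    · exact absurd (sub_eq_zero.1 h3).symm hΘ
    · exact h3

theorem sum_pow_eq (F : Type) [Field F] [Fintype F] [Fintype (MulChar F ℂ)]
    [DecidableEq (MulChar F ℂ)] [Fintype Fˣ] (d : ℕ) (g : F → ℂ) :
    ∑ z : Fˣ, g ((z : F) ^ d) = ∑ Θ ∈ Finset.univ.filter (fun Θ : MulChar F ℂ => Θ ^ d = 1),
      ∑ z : F, Θ z * g z := by
  classical
  have : NeZero ((Monoid.exponent Fˣ : ℕ) : ℂ) := ⟨by
      exact_mod_cast Monoid.exponent_ne_zero_of_finite⟩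
  have hcard : (Fintype.card (MulChar F ℂ) : ℂ) = Fintype.card Fˣ := by
    have := MulChar.card_eq_card_units_of_hasEnoughRootsOfUnity F ℂ
    rw [Nat.card_eq_fintype_card, Nat.card_eq_fintype_card] at this
    rw [this]
  have hm : (Fintype.card Fˣ : ℂ) ≠ 0 := by exact_mod_cast Fintype.card_ne_zero
  apply mul_left_cancel₀ hm
  -- expand
  have e1 : (Fintype.card Fˣ : ℂ) * ∑ z : Fˣ, g ((z : F) ^ d)
      = ∑ z : Fˣ, ∑ s : Fˣ, ∑ Θ : MulChar F ℂ, Θ ((s * (z ^ d)⁻¹ : Fˣ) : F) * g s := by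
    rw [Finset.mul_sum]
    refine Finset.sum_congr rfl fun z _ => ?_
    simp_rw [← Finset.sum_mul, sum_dual]
    rw [Finset.sum_eq_single (z ^ d)]
    · simp [hcard]
    · intro s _ hs
      rw [if_neg, zero_mul]
      rwa [mul_inv_eq_one]
    · simp
  have e2 : ∀ Θ : MulChar F ℂ, ∑ z : Fˣ, (Θ (((z ^ d)⁻¹ : Fˣ) : F)) =
      if Θ ^ d = 1 then (Fintype.card Fˣ : ℂ) else 0 := by
    intro Θ
    have : ∀ z : Fˣ, (Θ (((z ^ d)⁻¹ : Fˣ) : F)) = ((Θ ^ d)⁻¹ : MulChar F ℂ) z := by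
      intro z
      rw [MulChar.inv_apply', ← Units.val_inv_eq_inv_val, MulChar.pow_apply_coe, ← map_pow]
      simp
    simp_rw [this]
    rw [sum_units_eq _ (MulChar.map_zero _)]
    split_ifs with h
    · rw [h, inv_one, MulChar.sum_one_eq_card_units]
      congr!
    · exact MulChar.sum_eq_zero_of_ne_one (by simpa using h)
  rw [e1]
  have e3 : ∑ z : Fˣ, ∑ s : Fˣ, ∑ Θ : MulChar F ℂ, Θ ((s * (z ^ d)⁻¹ : Fˣ) : F) * g s
    = ∑ Θ : MulChar F ℂ, ∑ s : Fˣ, Θ s * g s * ∑ z : Fˣ, (Θ (((z ^ d)⁻¹ : Fˣ) : F)) := by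
    simp_rw [Finset.mul_sum]
    rw [Finset.sum_comm, Finset.sum_congr rfl (fun z _ => Finset.sum_comm), Finset.sum_comm]
    refine Finset.sum_congr rfl fun Θ _ => ?_
    refine Finset.sum_congr rfl fun s _ => ?_
    refine Finset.sum_congr rfl fun z _ => ?_
    rw [Units.val_mul, map_mul]; ring
  rw [e3]
  simp_rw [e2]
  rw [Finset.sum_filter, Finset.mul_sum]
  refine Finset.sum_congr rfl fun Θ _ => ?_
  split_ifs with h
  · rw [← Finset.sum_mul, mul_comm, sum_units_eq (fun z => Θ z * g z) (by rw [MulChar.map_zero, zero_mul])]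
  · simp

theorem norm_gaussSum_sq {F : Type} [Field F] [Fintype F] {χ : MulChar F ℂ} (hχ : χ ≠ 1)
    {ψ : AddChar F ℂ} (hψ : ψ.IsPrimitive) : ‖gaussSum χ ψ‖ ^ 2 = Fintype.card F := by
  have h := gaussSum_mul_gaussSum_eq_card hχ hψ
  rw [← star_gaussSum_eq] at h
  have h2 := congrArg norm h
  rw [norm_mul, norm_star, Complex.norm_natCast] at h2
  rw [sq, h2]

theorem norm_gaussSum_eq {F : Type} [Field F] [Fintype F] {q : ℕ} (hq : Fintype.card F = q ^ 2)
    {χ : MulChar F ℂ} (hχ : χ ≠ 1)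
    {ψ : AddChar F ℂ} (hψ : ψ.IsPrimitive) : ‖gaussSum χ ψ‖ = q := by
  have := norm_gaussSum_sq hχ hψ
  rw [hq] at this
  push_cast at this
  exact (pow_left_inj₀ (norm_nonneg _) (Nat.cast_nonneg _) two_ne_zero).1 this

theorem norm_jacobiSum_eq {F : Type} [Field F] [Fintype F] {q : ℕ} (hq : Fintype.card F = q ^ 2)
    {χ φ : MulChar F ℂ} (hχ : χ ≠ 1) (hφ : φ ≠ 1) (h : χ * φ ≠ 1)
    {ψ : AddChar F ℂ} (hψ : ψ.IsPrimitive) : ‖jacobiSum χ φ‖ = q := by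
  have := congrArg norm (jacobiSum_mul_nontrivial h ψ)
  rw [norm_mul, norm_mul, norm_gaussSum_eq hq h hψ, norm_gaussSum_eq hq hχ hψ,
    norm_gaussSum_eq hq hφ hψ] at this
  have hq0 : (q : ℝ) ≠ 0 := by
    have : 0 < q ^ 2 := hq ▸ Fintype.card_pos
    exact_mod_cast (pow_pos_iff two_ne_zero).1 this |>.ne'
  exact mul_left_cancel₀ hq0 this


theorem Aterm_eq {F : Type} [Field F] [Fintype F] (hF : ringChar F ≠ 2)
    {η ψ : MulChar F ℂ} (h : ψ ^ 2 = qch F ℂ * η) :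
    ∑ t : F, η t * qch F ℂ (t + t⁻¹) =
      ψ (-1) * jacobiSum ψ (qch F ℂ) + (ψ * qch F ℂ) (-1) * jacobiSum (ψ * qch F ℂ) (qch F ℂ) := by
  have key : ∀ ψ : MulChar F ℂ, ∑ u : F, ψ u * qch F ℂ (1 + u) = ψ (-1) * jacobiSum ψ (qch F ℂ) := by
    intro ψ
    rw [jacobiSum, Finset.mul_sum, ← Equiv.sum_comp (Equiv.neg F)]
    refine Finset.sum_congr rfl fun u _ => ?_
    rw [Equiv.neg_apply, ← mul_assoc, ← map_mul]
    congr 2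
    · ring
    · rw [sub_eq_add_neg]
  rw [← key, ← key, ← Finset.sum_add_distrib]
  have e : ∀ t : F, η t * qch F ℂ (t + t⁻¹) = ψ (t ^ 2) * qch F ℂ (1 + t ^ 2) := by
    intro t
    by_cases ht : t = 0
    · subst ht; rw [MulChar.map_zero, zero_pow two_ne_zero, MulChar.map_zero, zero_mul, zero_mul]
    have h1 : t + t⁻¹ = t⁻¹ * (1 + t ^ 2) := by field_simp; ring
    rw [h1, map_mul, qch_inv_apply, map_pow, ← MulChar.pow_apply' ψ two_ne_zero, h, MulChar.mul_apply]
    ring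
  simp_rw [e]
  rw [sum_sq_eq F hF (fun u => ψ u * qch F ℂ (1 + u))]
  refine Finset.sum_congr rfl fun u _ => ?_
  rw [MulChar.mul_apply]; ring

theorem mulChar_norm_eq_one {F : Type} [Field F] [Fintype F] {R : Type} [NormedField R]
    (χ : MulChar F R) {a : F} (ha : a ≠ 0) : ‖χ a‖ = 1 := by
  classical
  have h := χ.pow_card_eq_one
  have h2 : χ a ^ (Fintype.card Fˣ) = 1 := by
    have := MulChar.pow_apply_coe χ (Fintype.card Fˣ) (Units.mk0 a ha)
    rw [h, MulChar.one_apply_coe] at this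
    simpa using this.symm
  have h3 := congrArg norm h2
  rw [norm_pow, norm_one] at h3
  exact (pow_eq_one_iff_of_nonneg (norm_nonneg _) Fintype.card_ne_zero).1 h3

theorem mulChar_norm_le_one {F : Type} [Field F] [Fintype F] {R : Type} [NormedField R]
    (χ : MulChar F R) (a : F) : ‖χ a‖ ≤ 1 := by
  by_cases ha : a = 0
  · rw [ha, MulChar.map_zero, norm_zero]; exact zero_le_one
  · exact (mulChar_norm_eq_one χ ha).le

theorem gauss_shift {F : Type} [Field F] [Fintype F] {χ : MulChar F ℂ} (hχ : χ ≠ 1)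
    (e : AddChar F ℂ) (u : F) :
    ∑ s : F, χ s * e (s * u) = χ⁻¹ u * gaussSum χ e := by
  by_cases hu : u = 0
  · subst hu
    simp [MulChar.sum_eq_zero_of_ne_one hχ, MulChar.map_zero]
  · have := gaussSum_mulShift_eq χ e (Units.mk0 u hu)
    simp only [Units.val_mk0] at this
    rw [← this, gaussSum]
    simp [mul_comm]

theorem C_bound {F E : Type} [Field F] [Fintype F] [Field E] [Fintype E] [Algebra F E]
    (hF : ringChar F ≠ 2) {q : ℕ} (hq : Fintype.card F = q ^ 2)
    (hE : Fintype.card E = (q ^ 2) ^ 2) {ρ : MulChar E ℂ} (hρ : ρ ≠ 1) :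
    ‖∑ w : E, ρ w * qch F ℂ (Algebra.trace F E w)‖ ≤ ((q : ℝ) ^ 2 - 1) * q := by
  classical
  set e : AddChar F ℂ := AddChar.FiniteField.primitiveChar_to_Complex F with he
  have hep : e.IsPrimitive := AddChar.FiniteField.primitiveChar_to_Complex_isPrimitive F
  have : FiniteDimensional F E := Module.Finite.of_finite
  set eE : AddChar E ℂ := e.compAddMonoidHom (Algebra.trace F E).toAddMonoidHom with heE
  have heE_apply : ∀ w, eE w = e (Algebra.trace F E w) := fun w => rfl
  have hEp : eE.IsPrimitive := by
    apply AddChar.IsPrimitive.of_ne_one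
    intro h1
    apply hep (a := 1) one_ne_zero
    ext x
    obtain ⟨w, rfl⟩ := Algebra.trace_surjective F E x
    rw [AddChar.mulShift_one, ← heE_apply, h1]
    rfl
  have hχ := qch_ne_one F hF ℂ
  have e1 : gaussSum (qch F ℂ) e * ∑ w : E, ρ w * qch F ℂ (Algebra.trace F E w)
     = ∑ s : F, qch F ℂ s * ∑ w : E, ρ w * eE (w * algebraMap F E s) := by
    simp_rw [Finset.mul_sum]
    rw [Finset.sum_comm]
    refine Finset.sum_congr rfl fun w _ => ?_
    have := gauss_shift hχ e (Algebra.trace F E w)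
    rw [(qch_quad F).inv] at this
    calc _ = ρ w * (qch F ℂ (Algebra.trace F E w) * gaussSum (qch F ℂ) e) := by ring
      _ = _ := by
        rw [← this, Finset.mul_sum]
        refine Finset.sum_congr rfl fun s _ => ?_
        rw [heE_apply, mul_comm w, ← Algebra.smul_def, map_smul, smul_eq_mul]
        ring
  have e2 := congrArg norm e1
  rw [norm_mul, norm_gaussSum_eq hq hχ hep] at e2
  have e3 : ‖∑ s : F, qch F ℂ s * ∑ w : E, ρ w * eE (w * algebraMap F E s)‖ ≤ ((q : ℝ) ^ 2 - 1) * (q^2 : ℕ) := by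
    have hb : ∀ s : F, s ≠ 0 → ‖qch F ℂ s * ∑ w : E, ρ w * eE (w * algebraMap F E s)‖ ≤ (q^2 : ℕ) := by
      intro s hs
      rw [gauss_shift hρ, norm_mul, norm_mul, norm_gaussSum_eq hE hρ hEp]
      have n1 : ‖qch F ℂ s‖ ≤ 1 := by
        rcases qch_quad F (R := ℂ) s with h | h | h <;> simp [h]
      have n2 : ‖ρ⁻¹ (algebraMap F E s)‖ ≤ 1 := by
        exact mulChar_norm_le_one _ _
      calc _ ≤ 1 * (1 * ((q^2 : ℕ) : ℝ)) := by gcongr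
        _ = _ := by ring
    rw [← Finset.add_sum_erase _ _ (Finset.mem_univ (0 : F))]
    rw [MulChar.map_zero, zero_mul, zero_add]
    refine (norm_sum_le_of_le _ (fun s hs => hb s (Finset.ne_of_mem_erase hs))).trans ?_
    rw [Finset.sum_const, Finset.card_erase_of_mem (Finset.mem_univ _), Finset.card_univ, hq, nsmul_eq_mul]
    have : 1 ≤ q ^ 2 := hq ▸ Fintype.card_pos
    push_cast [Nat.cast_sub this]
    rfl
  have hq0 : (0 : ℝ) < q := by
    have : 0 < q ^ 2 := hq ▸ Fintype.card_pos
    exact_mod_cast (pow_pos_iff two_ne_zero).1 this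
  rw [← e2] at e3
  push_cast at e3
  refine le_of_mul_le_mul_left (e3.trans (le_of_eq ?_)) hq0
  ring

/-- composition of a multiplicative character with the norm -/
noncomputable def normChar {F E : Type} [Field F] [Field E] [Fintype E] [Algebra F E] [FiniteDimensional F E]
    (κ : MulChar F ℂ) : MulChar E ℂ where
  toMonoidHom := κ.toMonoidHom.comp (Algebra.norm F)
  map_nonunit' := by
    intro a ha
    have : a = 0 := by simpa using ha
    subst this
    have h0 : Algebra.norm F (0 : E) = 0 := Algebra.norm_zero
    show κ (Algebra.norm F (0 : E)) = 0
    rw [h0, MulChar.map_zero]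

theorem B_bound {F E : Type} [Field F] [Fintype F] [Field E] [Fintype E] [Algebra F E]
    (hF : ringChar F ≠ 2) {q : ℕ} (hq : Fintype.card F = q ^ 2)
    (hE : Fintype.card E = (q ^ 2) ^ 2) {d : ℕ} (hd : Odd d) {Θ : MulChar E ℂ} (hΘ : Θ ^ d = 1)
    {κ : MulChar F ℂ} (hκ : κ ^ 2 = qch F ℂ) :
    ‖∑ z : E, Θ z * qch F ℂ (Algebra.trace F E (z ^ 2) / Algebra.norm F z)‖
      ≤ ((q : ℝ) ^ 2 - 1) * (2 * q) := by
  classical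
  have : FiniteDimensional F E := Module.Finite.of_finite
  have hRE : ringChar E ≠ 2 := by
    have := Algebra.ringChar_eq F E
    rwa [← this]
  obtain ⟨k, hk⟩ := hd
  set ρ : MulChar E ℂ := Θ ^ (k + 1) * normChar κ with hρ
  have happ : ∀ z : E, (normChar κ : MulChar E ℂ) z = κ (Algebra.norm F z) := fun _ => rfl
  have hρ2 : ρ ^ 2 = Θ * normChar κ ^ 2 := by
    rw [hρ, mul_pow, ← pow_mul, show (k + 1) * 2 = d + 1 by omega, pow_succ, hΘ, one_mul]
  have hN : ∀ z : E, (normChar κ ^ 2 : MulChar E ℂ) z = qch F ℂ (Algebra.norm F z) := by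
    intro z
    rw [MulChar.pow_apply' _ two_ne_zero, happ, ← MulChar.pow_apply' _ two_ne_zero, hκ]
  -- surjectivity of the norm
  have hχ := qch_ne_one F hF ℂ
  have hN1 : (normChar κ ^ 2 : MulChar E ℂ) ≠ 1 := by
    obtain ⟨a, ha⟩ := MulChar.ne_one_iff.1 hχ
    obtain ⟨z, hz⟩ := FiniteField.norm_surjective F E (a : F)
    intro h1
    apply ha
    rw [← hz, ← hN, h1]
    apply MulChar.one_apply
    rw [isUnit_iff_ne_zero]
    rintro rfl
    rw [Algebra.norm_zero] at hz
    exact a.ne_zero hz.symm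
  have hN2 : (normChar κ ^ 2 : MulChar E ℂ) ^ 2 = 1 := by
    ext z
    rw [MulChar.pow_apply' _ two_ne_zero, hN, ← MulChar.pow_apply' _ two_ne_zero, qch_sq,
      MulChar.one_apply_coe]
    apply MulChar.one_apply
    exact (z.isUnit).map _
  have hρ2ne : ρ ^ 2 ≠ 1 := by
    intro h1
    rw [hρ2] at h1
    apply hN1
    have h3 : (Θ * (normChar κ ^ 2 : MulChar E ℂ)) ^ d = 1 := by rw [h1, one_pow]
    rw [mul_pow, hΘ, one_mul, hk, pow_succ, pow_mul, hN2, one_pow, one_mul] at h3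
    exact h3
  have hρ1 : ρ ≠ 1 := by rintro h; exact hρ2ne (by rw [h, one_pow])
  have hρ3 : qch E ℂ * ρ ≠ 1 := by
    intro h
    apply hρ2ne
    have : (qch E ℂ * ρ) ^ 2 = 1 := by rw [h, one_pow]
    rwa [mul_pow, qch_sq, one_mul] at this
  have e : ∀ z : E, Θ z * qch F ℂ (Algebra.trace F E (z ^ 2) / Algebra.norm F z)
      = ρ (z ^ 2) * qch F ℂ (Algebra.trace F E (z ^ 2)) := by
    intro z
    rw [map_pow ρ, ← MulChar.pow_apply' ρ two_ne_zero, hρ2, MulChar.mul_apply, hN, div_eq_mul_inv, map_mul,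
      qch_inv_apply]
    ring
  simp_rw [e]
  rw [sum_sq_eq E hRE (fun w => ρ w * qch F ℂ (Algebra.trace F E w))]
  have e2 : ∑ w : E, (1 + qch E ℂ w) * (ρ w * qch F ℂ (Algebra.trace F E w)) =
     ∑ w : E, ρ w * qch F ℂ (Algebra.trace F E w) + ∑ w : E, (qch E ℂ * ρ) w * qch F ℂ (Algebra.trace F E w) := by
    rw [← Finset.sum_add_distrib]
    refine Finset.sum_congr rfl fun w _ => ?_
    rw [MulChar.mul_apply (qch E ℂ)]; ring
  rw [e2]
  refine (norm_add_le _ _).trans ?_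
  have := C_bound hF hq hE hρ1
  have := C_bound hF hq hE hρ3
  linarith


section
variable {F E : Type} [Field F] [Fintype F] [Field E] [Fintype E] [Algebra F E]

/-- the `x`-coordinate attached to `z` -/
noncomputable def xco (F : Type) {E : Type} [Field F] [Field E] [Algebra F E] (z : E) : F :=
  Algebra.trace F E (z ^ 2) / Algebra.norm F z

theorem xco_spec {Q : ℕ} (hF : Fintype.card F = Q) (hE : Fintype.card E = Q ^ 2) {z : E} (hz : z ≠ 0) :
    algebraMap F E (xco F z) = z ^ (Q - 1) + (z ^ (Q - 1))⁻¹ := by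
  have hQ : 1 ≤ Q := hF ▸ Fintype.card_pos
  have hr : Module.finrank F E = 2 := by
    have := Module.card_eq_pow_finrank (K := F) (V := E)
    rw [hF, hE] at this
    have h1 : 1 < Q := hF ▸ Fintype.one_lt_card
    exact (Nat.pow_right_injective h1 this).symm
  rw [xco, map_div₀, FiniteField.algebraMap_trace_eq_sum_pow, FiniteField.algebraMap_norm_eq_prod_pow, hr,
    Nat.card_eq_fintype_card, hF]
  simp only [Finset.sum_range_succ, Finset.sum_range_zero, Finset.prod_range_succ, Finset.prod_range_zero,
    pow_zero, pow_one, zero_add, one_mul]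
  obtain ⟨k, rfl⟩ := Nat.exists_eq_add_of_le' hQ
  simp only [Nat.add_sub_cancel]
  field_simp
  ring

theorem xco_dickson {Q : ℕ} (hF : Fintype.card F = Q) (hE : Fintype.card E = Q ^ 2) {z : E} (hz : z ≠ 0) (d : ℕ) :
    (dickson 1 (1 : F) d).eval (xco F z) = xco F (z ^ d) := by
  apply (algebraMap F E).injective
  have hw : z ^ (Q - 1) ≠ 0 := pow_ne_zero _ hz
  rw [xco_spec hF hE (pow_ne_zero d hz), ← eval₂_at_apply, ← eval_map, map_dickson, map_one, xco_spec hF hE hz,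
    dickson_one_one_eval_add_inv _ _ (mul_inv_cancel₀ hw), inv_pow, ← pow_mul, ← pow_mul, mul_comm]

theorem double_count_le {Q : ℕ} (hF : Fintype.card F = Q) (hE : Fintype.card E = Q ^ 2)
    [DecidableEq F] [Fintype Fˣ] [Fintype Eˣ] (x : F) :
    (Q - 1) * (Finset.univ.filter (fun t : Fˣ => (t : F) + (t : F)⁻¹ = x)).card +
     (Finset.univ.filter (fun z : Eˣ => xco F (z : E) = x)).card ≤ 2 * (Q - 1) := by
  classical
  have hQ1 : 1 < Q := hF ▸ Fintype.one_lt_card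
  set X : E := algebraMap F E x with hX
  set S1 : Finset E := (Finset.univ.filter (fun t : Fˣ => (t : F) + (t : F)⁻¹ = x)).image
    (fun t : Fˣ => algebraMap F E t) with hS1
  set S2 : Finset E := (Finset.univ.filter (fun z : Eˣ => xco F (z : E) = x)).image
    (fun z : Eˣ => (z : E) ^ (Q - 1)) with hS2
  have c1 : (Finset.univ.filter (fun t : Fˣ => (t : F) + (t : F)⁻¹ = x)).card = S1.card := by
    rw [hS1, Finset.card_image_of_injective]
    intro a b h
    exact Units.ext ((algebraMap F E).injective h)
  have c2 : (Finset.univ.filter (fun z : Eˣ => xco F (z : E) = x)).card ≤ (Q - 1) * S2.card := by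
    refine Finset.card_le_mul_card_image _ _ ?_
    intro u _
    refine le_trans (Finset.card_le_card_of_injOn (t := (nthRoots (Q - 1) u).toFinset) (fun z : Eˣ => (z : E)) ?_ ?_) ?_
    · intro z hz
      simp only [Finset.coe_filter, Set.mem_setOf_eq] at hz
      simp only [Finset.mem_coe, Multiset.mem_toFinset]
      rw [mem_nthRoots (by omega)]
      exact hz.2
    · intro a _ b _ h
      exact Units.ext h
    · exact (Multiset.toFinset_card_le _).trans (card_nthRoots _ _)
  have r1 : ∀ w ∈ S1, w ≠ 0 ∧ w + w⁻¹ = X ∧ w ^ (Q - 1) = 1 := by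
    intro w hw
    rw [hS1, Finset.mem_image] at hw
    obtain ⟨t, ht, rfl⟩ := hw
    refine ⟨by simp, ?_, ?_⟩
    · rw [hX, ← (Finset.mem_filter.1 ht).2]; simp
    · rw [← map_pow, ← hF, FiniteField.pow_card_sub_one_eq_one _ t.ne_zero, map_one]
  have r2 : ∀ w ∈ S2, w ≠ 0 ∧ w + w⁻¹ = X ∧ w ^ (Q + 1) = 1 := by
    intro w hw
    rw [hS2, Finset.mem_image] at hw
    obtain ⟨z, hz, rfl⟩ := hw
    refine ⟨by simp, ?_, ?_⟩
    · rw [hX, ← (Finset.mem_filter.1 hz).2, xco_spec hF hE z.ne_zero]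
    · rw [← pow_mul, mul_comm, ← Nat.sq_sub_sq Q 1, one_pow, ← hE,
        FiniteField.pow_card_sub_one_eq_one _ z.ne_zero]
  have r3 : ∀ a b : E, a ≠ 0 → b ≠ 0 → a + a⁻¹ = X → b + b⁻¹ = X → b = a ∨ b = a⁻¹ := by
    intro a b ha hb h1 h2
    rw [← h2] at h1
    have : (b - a) * (b * a - 1) = 0 := by
      field_simp at h1
      linear_combination -h1
    rcases mul_eq_zero.1 this with h | h
    · left; exact sub_eq_zero.1 h
    · right; exact eq_inv_of_mul_eq_one_left (sub_eq_zero.1 h)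
  have hle : S1.card + S2.card ≤ 2 := by
    by_cases hd : Disjoint S1 S2
    · rw [← Finset.card_union_of_disjoint hd]
      rcases (S1 ∪ S2).eq_empty_or_nonempty with h | ⟨a, ha⟩
      · rw [h]; simp
      · have hall : ∀ w ∈ S1 ∪ S2, w ≠ 0 ∧ w + w⁻¹ = X := by
          intro w hw
          rcases Finset.mem_union.1 hw with h | h
          · exact ⟨(r1 w h).1, (r1 w h).2.1⟩
          · exact ⟨(r2 w h).1, (r2 w h).2.1⟩
        have hsub : S1 ∪ S2 ⊆ {a, a⁻¹} := by
          intro b hb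
          have := r3 a b (hall a ha).1 (hall b hb).1 (hall a ha).2 (hall b hb).2
          simpa using this
        exact (Finset.card_le_card hsub).trans Finset.card_le_two
    · rw [Finset.not_disjoint_iff] at hd
      obtain ⟨a, ha1, ha2⟩ := hd
      have h1 := r1 a ha1
      have h2 := r2 a ha2
      have hinv : a⁻¹ = a := by
        have h3 := h2.2.2
        rw [show Q + 1 = (Q - 1) + 2 by omega, pow_add, h1.2.2, one_mul, sq] at h3
        exact inv_eq_of_mul_eq_one_left h3
      have s1 : S1 ⊆ {a} := by
        intro b hb
        have h := r1 b hb
        have := r3 a b h1.1 h.1 h1.2.1 h.2.1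
        rw [hinv] at this
        simpa using this
      have s2 : S2 ⊆ {a} := by
        intro b hb
        have h := r2 b hb
        have := r3 a b h1.1 h.1 h1.2.1 h.2.1
        rw [hinv] at this
        simpa using this
      have := Finset.card_le_card s1
      have := Finset.card_le_card s2
      simp only [Finset.card_singleton] at *
      omega
  rw [c1]
  calc _ ≤ (Q - 1) * S1.card + (Q - 1) * S2.card := by gcongr
    _ = (Q - 1) * (S1.card + S2.card) := by ring
    _ ≤ (Q - 1) * 2 := by gcongr
    _ = _ := by ring

theorem double_count {Q : ℕ} (hF : Fintype.card F = Q) (hE : Fintype.card E = Q ^ 2)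
    [DecidableEq F] [Fintype Fˣ] [Fintype Eˣ] (x : F) :
    (Q - 1) * (Finset.univ.filter (fun t : Fˣ => (t : F) + (t : F)⁻¹ = x)).card +
     (Finset.univ.filter (fun z : Eˣ => xco F (z : E) = x)).card = 2 * (Q - 1) := by
  classical
  have hQ1 : 1 < Q := hF ▸ Fintype.one_lt_card
  have key := (Finset.sum_eq_sum_iff_of_le (s := Finset.univ) (fun x _ => double_count_le hF hE x)).1 ?_
  · exact key x (Finset.mem_univ _)
  · rw [Finset.sum_add_distrib, ← Finset.mul_sum, ← Finset.card_eq_sum_card_fiberwise (fun _ _ => Finset.mem_coe.2 (Finset.mem_univ _)),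
      ← Finset.card_eq_sum_card_fiberwise (fun _ _ => Finset.mem_coe.2 (Finset.mem_univ _)), Finset.sum_const, Finset.card_univ,
      Finset.card_univ, Finset.card_univ, hF]
    have a1 : Fintype.card Fˣ = Q - 1 := by
      rw [← hF, ← Fintype.card_units]; congr!
    have a2 : Fintype.card Eˣ = Q ^ 2 - 1 := by
      rw [← hE, ← Fintype.card_units]; congr!
    rw [a1, a2]
    obtain ⟨k, rfl⟩ := Nat.exists_eq_add_of_le' hQ1.le
    have : (k + 1) ^ 2 - 1 = k ^ 2 + 2 * k := by
      rw [show (k + 1) ^ 2 = k ^ 2 + 2 * k + 1 by ring]; simp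
    rw [this, smul_eq_mul]; simp only [Nat.add_sub_cancel]; ring

theorem double_sum {Q : ℕ} (hF : Fintype.card F = Q) (hE : Fintype.card E = Q ^ 2)
    [Fintype Fˣ] [Fintype Eˣ] (f : F → ℂ) :
    ((Q : ℂ) - 1) * ∑ t : Fˣ, f ((t : F) + (t : F)⁻¹) + ∑ z : Eˣ, f (xco F (z : E))
      = 2 * ((Q : ℂ) - 1) * ∑ x : F, f x := by
  classical
  have hQ1 : 1 < Q := hF ▸ Fintype.one_lt_card
  rw [← Finset.sum_fiberwise_of_maps_to (s := Finset.univ) (t := Finset.univ) (g := fun t : Fˣ => (t : F) + (t : F)⁻¹)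
    (fun _ _ => Finset.mem_univ _), ← Finset.sum_fiberwise_of_maps_to (s := Finset.univ) (t := Finset.univ) (g := fun z : Eˣ => xco F (z : E))
    (fun _ _ => Finset.mem_univ _), Finset.mul_sum, Finset.mul_sum, ← Finset.sum_add_distrib]
  refine Finset.sum_congr rfl fun x _ => ?_
  have h := congrArg (Nat.cast : ℕ → ℂ) (double_count (E := E) hF hE x)
  push_cast [Nat.cast_sub hQ1.le] at h
  rw [← h, Finset.sum_congr rfl (g := fun _ => f x) (fun t ht => by rw [(Finset.mem_filter.1 ht).2]),
    Finset.sum_congr rfl (s₁ := Finset.univ.filter (fun z : Eˣ => xco F (z : E) = x)) (g := fun _ => f x) (fun t ht => by rw [(Finset.mem_filter.1 ht).2]),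
    Finset.sum_const, Finset.sum_const, nsmul_eq_mul, nsmul_eq_mul]
  ring
end


theorem mulChar_cyclic (F : Type) [Field F] [Fintype F] (R : Type) [Field R] [IsAlgClosed R] [CharZero R] :
    IsCyclic (MulChar F R) ∧ Nat.card (MulChar F R) = Fintype.card F - 1 := by
  classical
  have : NeZero ((Monoid.exponent Fˣ : ℕ) : R) := ⟨by
      exact_mod_cast Monoid.exponent_ne_zero_of_finite⟩
  obtain ⟨e⟩ := MulChar.mulEquiv_units F R
  refine ⟨isCyclic_of_surjective e.symm e.symm.surjective, ?_⟩
  rw [Nat.card_congr e.toEquiv, Nat.card_eq_fintype_card, Fintype.card_units]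

theorem exists_gen (F : Type) [Field F] [Fintype F] (R : Type) [Field R] [IsAlgClosed R] [CharZero R] :
    ∃ τ : MulChar F R, orderOf τ = Fintype.card F - 1 := by
  obtain ⟨h, h'⟩ := mulChar_cyclic F R
  obtain ⟨g, hg⟩ := h.exists_generator
  exact ⟨g, by rw [← h']; exact orderOf_eq_card_of_forall_mem_zpowers hg⟩

theorem eq_pow_gen {F : Type} [Field F] [Fintype F] {R : Type} [Field R] [IsAlgClosed R] [CharZero R]
    {τ : MulChar F R} (hτ : orderOf τ = Fintype.card F - 1) (χ : MulChar F R) : 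
    ∃ k < Fintype.card F - 1, χ = τ ^ k := by
  classical
  obtain ⟨h, h'⟩ := mulChar_cyclic F R
  have hN : 0 < Fintype.card F - 1 := by
    have := Fintype.one_lt_card (α := F); omega
  have : Finite (MulChar F R) := Nat.finite_of_card_ne_zero (by omega)
  have hm : χ ∈ Subgroup.zpowers τ := by
    have : Subgroup.zpowers τ = ⊤ := by
      apply Subgroup.eq_top_of_card_eq
      rw [Nat.card_zpowers, hτ, h']
    rw [this]; trivial
  rw [mem_zpowers_iff_mem_range_orderOf, Finset.mem_image] at hm
  obtain ⟨k, hk, rfl⟩ := hm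
  exact ⟨k, by rw [← hτ]; exact Finset.mem_range.1 hk, rfl⟩

theorem qch_eq_pow {F : Type} [Field F] [Fintype F] (hF : ringChar F ≠ 2)
    {R : Type} [Field R] [IsAlgClosed R] [CharZero R]
    {τ : MulChar F R} (hτ : orderOf τ = Fintype.card F - 1) {m : ℕ} (hm : Fintype.card F - 1 = 2 * m) :
    qch F R = τ ^ m := by
  obtain ⟨k, hk, h⟩ := eq_pow_gen hτ (qch F R)
  have h1 := qch_sq F (R := R)
  have h2 := qch_ne_one F hF R
  rw [h, ← pow_mul] at h1
  rw [h] at h2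
  have h3 := orderOf_dvd_of_pow_eq_one h1
  rw [hτ, hm] at h3
  obtain ⟨c, hc⟩ := h3
  have hk0 : k ≠ 0 := by rintro rfl; simp at h2
  rw [h]
  congr 1
  rw [hm] at hk
  have : c < 2 := by
    by_contra hcon
    have : 2 * m * 2 ≤ 2 * m * c := Nat.mul_le_mul_left _ (by omega)
    omega
  interval_cases c <;> omega

theorem card_pow_le (F : Type) [Field F] [Fintype F] [Fintype (MulChar F ℂ)] [DecidableEq (MulChar F ℂ)]
    {k : ℕ} (hk : 0 < k) : (Finset.univ.filter (fun Θ : MulChar F ℂ => Θ ^ k = 1)).card ≤ k := by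
  have := (mulChar_cyclic F ℂ).1
  exact IsCyclic.card_pow_eq_one_le hk

theorem A_one_norm {F : Type} [Field F] [Fintype F] (hF : ringChar F ≠ 2) {q : ℕ} (hq : Fintype.card F = q ^ 2)
    {d : ℕ} (hd : Odd d) {η ψ : MulChar F ℂ} (hη : η ^ d = 1) (h : ψ ^ 2 = qch F ℂ * η) :
    ‖ψ (-1) * jacobiSum ψ (qch F ℂ)‖ = q := by
  have hne := qch_ne_one F hF ℂ
  have hqd : (qch F ℂ) ^ d = qch F ℂ := by
    obtain ⟨k, rfl⟩ := hd
    rw [pow_succ, pow_mul, qch_sq, one_pow, one_mul]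
  have hnot : ¬ (ψ ^ 2 = 1) := by
    intro h1
    rw [h1] at h
    have := congrArg (· ^ d) h
    simp only [one_pow, mul_pow, hη, hqd, mul_one] at this
    exact hne this.symm
  rw [norm_mul, mulChar_norm_eq_one _ (neg_ne_zero.2 one_ne_zero), one_mul]
  refine norm_jacobiSum_eq hq ?_ hne ?_ (AddChar.FiniteField.primitiveChar_to_Complex_isPrimitive F)
  · rintro rfl; simp at hnot
  · intro h1
    apply hnot
    have := congrArg (· ^ 2) h1
    simpa [mul_pow, qch_sq] using this

theorem A_bound {F : Type} [Field F] [Fintype F] (hF : ringChar F ≠ 2) {q : ℕ} (hq : Fintype.card F = q ^ 2)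
    {d : ℕ} (hd : Odd d) {η ψ : MulChar F ℂ} (hη : η ^ d = 1) (h : ψ ^ 2 = qch F ℂ * η) :
    (∑ t : F, η t * qch F ℂ (t + t⁻¹)).re ≤ 2 * q ∧
     ((∑ t : F, η t * qch F ℂ (t + t⁻¹)).re = 2 * q → ψ (-1) * jacobiSum ψ (qch F ℂ) = q) := by
  rw [Aterm_eq hF h, Complex.add_re]
  have h1 := A_one_norm hF hq hd hη h
  have h2 := A_one_norm (ψ := ψ * qch F ℂ) hF hq hd hη (by rw [mul_pow, qch_sq, mul_one, h])
  have h1' := Complex.re_le_norm (ψ (-1) * jacobiSum ψ (qch F ℂ))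
  have h2' := Complex.re_le_norm ((ψ * qch F ℂ) (-1) * jacobiSum (ψ * qch F ℂ) (qch F ℂ))
  refine ⟨by linarith, fun h3 => ?_⟩
  generalize ψ (-1) * jacobiSum ψ (qch F ℂ) = z at *
  have hz : z.re = q := by linarith
  have h4 := Complex.re_eq_norm.1 (hz.trans h1.symm)
  apply Complex.ext
  · simpa using hz
  · simpa using (Complex.nonneg_iff.1 h4).2.symm

theorem B_zero {F E : Type} [Field F] [Fintype F] [Field E] [Fintype E] [Algebra F E]
    {Q : ℕ} (hQ : Fintype.card F = Q) (hE : Fintype.card E = Q ^ 2) {Θ : MulChar E ℂ} 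
    (hΘ : ¬ Θ ^ (Q + 1) = 1) : ∑ z : E, Θ z * qch F ℂ (xco F z) = 0 := by
  have hr : Module.finrank F E = 2 := by
    have := Module.card_eq_pow_finrank (K := F) (V := E)
    rw [hQ, hE] at this
    have h1 : 1 < Q := hQ ▸ Fintype.one_lt_card
    exact (Nat.pow_right_injective h1 this).symm
  have : ∃ c : F, c ≠ 0 ∧ Θ (algebraMap F E c) ≠ 1 := by
    by_contra hcon
    push Not at hcon
    apply hΘ
    ext z
    rw [MulChar.pow_apply_coe, ← map_pow, MulChar.one_apply_coe]
    have : (z : E) ^ (Q + 1) = algebraMap F E (Algebra.norm F (z : E)) := by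
      rw [FiniteField.algebraMap_norm_eq_prod_pow, hr, Nat.card_eq_fintype_card, hQ]
      simp [Finset.prod_range_succ, pow_succ, mul_comm]
    rw [this]
    exact hcon _ (Algebra.norm_ne_zero_iff.2 z.ne_zero)
  obtain ⟨c, hc, hc1⟩ := this
  have hc' : algebraMap F E c ≠ 0 := by simpa using hc
  have key : ∑ z : E, Θ z * qch F ℂ (xco F z) = Θ (algebraMap F E c) * ∑ z : E, Θ z * qch F ℂ (xco F z) := by
    rw [Finset.mul_sum]
    nth_rewrite 1 [← Equiv.sum_comp (Equiv.mulLeft₀ _ hc')]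
    refine Finset.sum_congr rfl fun z _ => ?_
    change Θ (algebraMap F E c * z) * qch F ℂ (xco F (algebraMap F E c * z)) = _
    rw [map_mul, mul_assoc]
    congr 3
    rw [xco, xco, mul_pow, ← map_pow, ← Algebra.smul_def, LinearMap.map_smul, map_mul (Algebra.norm F), Algebra.norm_algebraMap, hr, smul_eq_mul]
    rw [mul_div_mul_left _ _ (pow_ne_zero _ hc)]
  have : (Θ (algebraMap F E c) - 1) * ∑ z : E, Θ z * qch F ℂ (xco F z) = 0 := by
    rw [sub_mul, ← key, one_mul, sub_self]
  exact (mul_eq_zero.1 this).resolve_left (sub_ne_zero.2 hc1)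


theorem master_sum {F E : Type} [Field F] [Fintype F] [Field E] [Fintype E] [Algebra F E]
    [Fintype (MulChar F ℂ)] [DecidableEq (MulChar F ℂ)] [Fintype (MulChar E ℂ)] [DecidableEq (MulChar E ℂ)]
    (hF : ringChar F ≠ 2)
    {Q : ℕ} (hQ : Fintype.card F = Q) (hE : Fintype.card E = Q ^ 2) (d : ℕ) :
    2 * ((Q : ℂ) - 1) * ∑ x : F, qch F ℂ ((dickson 1 (1 : F) d).eval x) =
    ((Q : ℂ) - 1) * ∑ η ∈ (Finset.univ.filter (fun Θ : MulChar F ℂ => Θ ^ d = 1)).erase 1,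
       ∑ t : F, η t * qch F ℂ (t + t⁻¹) +
    ∑ Θ ∈ (Finset.univ.filter (fun Θ : MulChar E ℂ => Θ ^ d = 1 ∧ Θ ^ (Q + 1) = 1)).erase 1,
       ∑ z : E, Θ z * qch F ℂ (xco F z) := by
  classical
  have h0 := double_sum hQ hE (fun x => qch F ℂ x)
  have h1 := double_sum hQ hE (fun x => qch F ℂ ((dickson 1 (1 : F) d).eval x))
  have hs0 : ∑ x : F, qch F ℂ x = 0 := MulChar.sum_eq_zero_of_ne_one (qch_ne_one F hF ℂ)
  rw [hs0, mul_zero] at h0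
  rw [← h1]
  have e1 : ∑ t : Fˣ, qch F ℂ ((dickson 1 (1 : F) d).eval ((t : F) + (t : F)⁻¹)) =
     ∑ Θ ∈ Finset.univ.filter (fun Θ : MulChar F ℂ => Θ ^ d = 1),
      ∑ z : F, Θ z * qch F ℂ (z + z⁻¹) := by
    rw [← sum_pow_eq F d (fun z => qch F ℂ (z + z⁻¹))]
    refine Finset.sum_congr rfl fun t _ => ?_
    rw [dickson_one_one_eval_add_inv _ _ (mul_inv_cancel₀ t.ne_zero), inv_pow]
  have e2 : ∑ z : Eˣ, qch F ℂ ((dickson 1 (1 : F) d).eval (xco F (z : E))) =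
     ∑ Θ ∈ Finset.univ.filter (fun Θ : MulChar E ℂ => Θ ^ d = 1),
      ∑ z : E, Θ z * qch F ℂ (xco F z) := by
    rw [← sum_pow_eq E d (fun z => qch F ℂ (xco F z))]
    refine Finset.sum_congr rfl fun t _ => ?_
    rw [xco_dickson hQ hE t.ne_zero]
  have e3 : ∑ Θ ∈ Finset.univ.filter (fun Θ : MulChar E ℂ => Θ ^ d = 1),
      ∑ z : E, Θ z * qch F ℂ (xco F z) = 
      ∑ Θ ∈ Finset.univ.filter (fun Θ : MulChar E ℂ => Θ ^ d = 1 ∧ Θ ^ (Q + 1) = 1),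
      ∑ z : E, Θ z * qch F ℂ (xco F z) := by
    symm
    apply Finset.sum_subset
    · intro Θ; simp +contextual
    · intro Θ h1 h2
      simp only [Finset.mem_filter, Finset.mem_univ, true_and] at h1 h2
      exact B_zero hQ hE (fun h => h2 ⟨h1, h⟩)
  have f1 : ∑ z : F, (1 : MulChar F ℂ) z * qch F ℂ (z + z⁻¹) = ∑ t : Fˣ, qch F ℂ ((t : F) + (t : F)⁻¹) := by
    rw [← sum_units_eq (fun z => (1 : MulChar F ℂ) z * qch F ℂ (z + z⁻¹)) (by rw [MulChar.map_zero, zero_mul])]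
    simp
  have f2 : ∑ z : E, (1 : MulChar E ℂ) z * qch F ℂ (xco F z) = ∑ t : Eˣ, qch F ℂ (xco F (t : E)) := by
    rw [← sum_units_eq (fun z => (1 : MulChar E ℂ) z * qch F ℂ (xco F z)) (by rw [MulChar.map_zero, zero_mul])]
    simp
  rw [e1, e2, e3, ← Finset.add_sum_erase _ _ (a := 1) (by simp), 
    ← Finset.add_sum_erase (Finset.univ.filter (fun Θ : MulChar E ℂ => Θ ^ d = 1 ∧ Θ ^ (Q + 1) = 1)) _ (a := 1) (by simp), f1, f2]
  linear_combination h0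

theorem arith_ab {d a b : ℕ} (ha : a ∣ d) (hb : b ∣ d) (hab : Nat.Coprime a b) (hd : 0 < d)
    (h : d + 1 ≤ a + b) : (a = d ∧ b = 1) ∨ b = d := by
  have h1 := Nat.le_of_dvd hd (Nat.Coprime.mul_dvd_of_dvd_of_dvd hab ha hb)
  have ha0 := Nat.pos_of_dvd_of_pos ha hd
  have hb0 := Nat.pos_of_dvd_of_pos hb hd
  have ha1 := Nat.le_of_dvd hd ha
  have hb1 := Nat.le_of_dvd hd hb
  obtain ⟨a, rfl⟩ := Nat.exists_eq_add_of_lt ha0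
  obtain ⟨b, rfl⟩ := Nat.exists_eq_add_of_lt hb0
  simp only [zero_add] at *
  have : a * b = 0 := by nlinarith
  rcases Nat.mul_eq_zero.1 this with rfl | rfl
  · right; omega
  · left; omega

theorem analytic {F : Type} [Field F] [Fintype F] {p : ℕ} [Fact p.Prime] [CharP F p] (hF : ringChar F ≠ 2)
    {q : ℕ} (hq : Fintype.card F = q ^ 2) (hq4 : q % 4 = 1)
    {d l : ℕ} (hd : Odd d) (hl : l.Prime) (hl4 : l % 4 = 3) (hld : l ∣ d)
    (hS : ∑ x : F, qch F ℂ ((dickson 1 (1 : F) d).eval x) = ((d : ℂ) - 1) * q) :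
    d ∣ q ^ 2 - 1 ∧ ∀ η ψ : MulChar F ℂ, η ^ d = 1 → η ≠ 1 → ψ ^ 2 = qch F ℂ * η →
      ψ (-1) * jacobiSum ψ (qch F ℂ) = q := by
  classical
  have hd0 : 0 < d := hd.pos
  let E := FiniteField.Extension F p 2
  have : Finite E := Module.finite_of_finite F
  let _ : Fintype E := Fintype.ofFinite E
  have hE : Fintype.card E = (q ^ 2) ^ 2 := by
    rw [← Nat.card_eq_fintype_card, FiniteField.natCard_extension, Nat.card_eq_fintype_card, hq]
  have : Finite (MulChar F ℂ) := inferInstance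
  let _ : Fintype (MulChar F ℂ) := Fintype.ofFinite _
  let _ : Fintype (MulChar E ℂ) := Fintype.ofFinite _
  have hm := master_sum hF hq hE d
  have hq1 : 1 < q ^ 2 := hq ▸ Fintype.one_lt_card
  have hqd : 4 ∣ q ^ 2 - 1 := by
    have : q ^ 2 % 4 = 1 := by rw [Nat.pow_mod, hq4]
    omega
  obtain ⟨κ, hκ⟩ : ∃ κ : MulChar F ℂ, κ ^ 2 = qch F ℂ := by
    obtain ⟨τ, hτ⟩ := exists_gen F ℂ
    obtain ⟨m, hm⟩ := hqd
    refine ⟨τ ^ m, ?_⟩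
    rw [qch_eq_pow hF hτ (m := m * 2) (by rw [hq]; omega), pow_mul]
  have hψ : ∀ η : MulChar F ℂ, η ^ d = 1 → ∃ ψ, ψ ^ 2 = qch F ℂ * η := by
    intro η hη
    obtain ⟨k, rfl⟩ := hd
    refine ⟨κ * η ^ (k + 1), ?_⟩
    rw [mul_pow, hκ, ← pow_mul, show (k + 1) * 2 = (2 * k + 1) + 1 by ring, pow_succ, hη, one_mul]
  set a := Nat.gcd d (q ^ 2 - 1) with ha
  set b := Nat.gcd d (q ^ 2 + 1) with hb
  have ha0 : 0 < a := Nat.gcd_pos_of_pos_left _ hd0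
  have hb0 : 0 < b := Nat.gcd_pos_of_pos_left _ hd0
  set TA := (Finset.univ.filter (fun Θ : MulChar F ℂ => Θ ^ d = 1)) with hTA
  set TB := (Finset.univ.filter (fun Θ : MulChar E ℂ => Θ ^ d = 1 ∧ Θ ^ (q ^ 2 + 1) = 1)) with hTB
  have cA : TA.card ≤ a := by
    refine le_trans (Finset.card_le_card ?_) (card_pow_le F ha0)
    intro η h
    simp only [hTA, Finset.mem_filter, Finset.mem_univ, true_and] at h ⊢
    have : orderOf η ∣ a := Nat.dvd_gcd (orderOf_dvd_of_pow_eq_one h) (by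
      have := MulChar.orderOf_dvd_card_sub_one F η
      rwa [hq] at this)
    exact orderOf_dvd_iff_pow_eq_one.1 this
  have cB : TB.card ≤ b := by
    refine le_trans (Finset.card_le_card ?_) (card_pow_le E hb0)
    intro η h
    simp only [hTB, Finset.mem_filter, Finset.mem_univ, true_and] at h ⊢
    exact orderOf_dvd_iff_pow_eq_one.1 (Nat.dvd_gcd (orderOf_dvd_of_pow_eq_one h.1) (orderOf_dvd_of_pow_eq_one h.2))
  have m1 : (1 : MulChar F ℂ) ∈ TA := by simp [hTA]
  have m2 : (1 : MulChar E ℂ) ∈ TB := by simp [hTB]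
  have cA' := Finset.card_erase_add_one m1
  have cB' := Finset.card_erase_add_one m2
  set X : MulChar F ℂ → ℝ := fun η => (∑ t : F, η t * qch F ℂ (t + t⁻¹)).re with hX
  set Y : MulChar E ℂ → ℝ := fun Θ => (∑ z : E, Θ z * qch F ℂ (xco F z)).re with hY
  have hm' : 2 * ((q : ℝ) ^ 2 - 1) * (((d : ℝ) - 1) * q) = ((q : ℝ) ^ 2 - 1) * ∑ η ∈ TA.erase 1, X η
      + ∑ Θ ∈ TB.erase 1, Y Θ := by
    rw [hS] at hm
    have := congrArg Complex.re hm
    rw [Complex.add_re, Complex.re_sum] at this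
    have r1 : ((q ^ 2 : ℕ) : ℂ) - 1 = (((q : ℝ) ^ 2 - 1 : ℝ) : ℂ) := by push_cast; rfl
    have r2 : 2 * (((q ^ 2 : ℕ) : ℂ) - 1) * (((d : ℂ) - 1) * q) = 
      ((2 * ((q : ℝ) ^ 2 - 1) * (((d : ℝ) - 1) * q) : ℝ) : ℂ) := by push_cast; rfl
    rw [r2, r1, Complex.re_ofReal_mul, Complex.ofReal_re, Complex.re_sum] at this
    exact this
  have hqR : (0 : ℝ) < (q : ℝ) ^ 2 - 1 := by
    have : (1 : ℝ) < ((q ^ 2 : ℕ) : ℝ) := by exact_mod_cast hq1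
    push_cast at this; linarith
  have hq0 : 0 < q := by omega
  have hq0' : (0 : ℝ) < q := by exact_mod_cast hq0
  have bX : ∀ η ∈ TA.erase 1, X η ≤ 2 * q := by
    intro η h
    simp only [hTA, Finset.mem_erase, Finset.mem_filter, Finset.mem_univ, true_and] at h
    obtain ⟨ψ, h2⟩ := hψ η h.2
    exact (A_bound hF hq hd h.2 h2).1
  have bY : ∀ Θ ∈ TB.erase 1, Y Θ ≤ ((q : ℝ) ^ 2 - 1) * (2 * q) := by
    intro Θ h
    simp only [hTB, Finset.mem_erase, Finset.mem_filter, Finset.mem_univ, true_and] at h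
    exact (Complex.re_le_norm _).trans (B_bound hF hq hE hd h.2.1 hκ)
  have sX : ∑ η ∈ TA.erase 1, X η ≤ ((TA.erase 1).card : ℝ) * (2 * q) := by
    have := Finset.sum_le_card_nsmul _ _ _ bX
    rwa [nsmul_eq_mul] at this
  have sY : ∑ Θ ∈ TB.erase 1, Y Θ ≤ ((TB.erase 1).card : ℝ) * (((q : ℝ) ^ 2 - 1) * (2 * q)) := by
    have := Finset.sum_le_card_nsmul _ _ _ bY
    rwa [nsmul_eq_mul] at this
  have hcount : d + 1 ≤ a + b := by
    have h1 : ((q : ℝ) ^ 2 - 1) * (2 * q) * ((d : ℝ) - 1) ≤ 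
       ((q : ℝ) ^ 2 - 1) * (2 * q) * (((TA.erase 1).card : ℝ) + ((TB.erase 1).card : ℝ)) := by
      have := mul_le_mul_of_nonneg_left sX hqR.le
      nlinarith
    have h2 := le_of_mul_le_mul_left h1 (by positivity)
    have h3 : (d : ℝ) ≤ (((TA.erase 1).card + (TB.erase 1).card + 1 : ℕ) : ℝ) := by push_cast; linarith
    have h4 : d ≤ (TA.erase 1).card + (TB.erase 1).card + 1 := by exact_mod_cast h3
    omega
  have hab : Nat.Coprime a b := by
    have h1 : Nat.gcd a b ∣ 2 := by
      have e1 : Nat.gcd a b ∣ q ^ 2 - 1 := (Nat.gcd_dvd_left a b).trans (Nat.gcd_dvd_right _ _)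
      have e2 : Nat.gcd a b ∣ q ^ 2 + 1 := (Nat.gcd_dvd_right a b).trans (Nat.gcd_dvd_right _ _)
      have := Nat.dvd_sub e2 e1
      rwa [show q ^ 2 + 1 - (q ^ 2 - 1) = 2 by omega] at this
    rcases (Nat.dvd_prime Nat.prime_two).1 h1 with h | h
    · exact h
    · exfalso
      have : 2 ∣ d := h ▸ (Nat.gcd_dvd_left a b).trans (Nat.gcd_dvd_left _ _)
      obtain ⟨k, hk⟩ := hd
      omega
  rcases arith_ab (Nat.gcd_dvd_left _ _) (Nat.gcd_dvd_left _ _) hab hd0 hcount with ⟨hA, hB⟩ | hB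
  · refine ⟨hA ▸ Nat.gcd_dvd_right _ _, fun η ψ h1 h2 h3 => ?_⟩
    have hTB0 : TB.erase 1 = ∅ := Finset.card_eq_zero.1 (by omega)
    rw [hTB0, Finset.sum_empty, add_zero] at hm'
    have hsum : ∑ η ∈ TA.erase 1, X η = 2 * q * ((d : ℝ) - 1) := by
      have : ((q : ℝ) ^ 2 - 1) * ∑ η ∈ TA.erase 1, X η = ((q : ℝ) ^ 2 - 1) * (2 * q * ((d : ℝ) - 1)) := by
        rw [← hm']; ring
      exact mul_left_cancel₀ hqR.ne' this
    have hle : ((TA.erase 1).card : ℝ) ≤ (d : ℝ) - 1 := by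
      have : (((TA.erase 1).card + 1 : ℕ) : ℝ) ≤ d := by exact_mod_cast (by omega : (TA.erase 1).card + 1 ≤ d)
      push_cast at this; linarith
    have heq : ∑ η ∈ TA.erase 1, X η = ∑ η ∈ TA.erase 1, (2 * q : ℝ) := by
      apply le_antisymm (Finset.sum_le_sum bX)
      rw [Finset.sum_const, nsmul_eq_mul, hsum, mul_comm]
      exact mul_le_mul_of_nonneg_left hle (by positivity)
    have := (Finset.sum_eq_sum_iff_of_le bX).1 heq η (by simp [hTA, h1, h2])
    exact (A_bound hF hq hd h1 h3).2 this
  · exfalso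
    have h1 : l ∣ q ^ 2 + 1 := hld.trans (hB ▸ Nat.gcd_dvd_right _ _)
    have : Fact l.Prime := ⟨hl⟩
    have h2 : ((q : ZMod l)) ^ 2 = -1 := by
      have := (ZMod.natCast_eq_zero_iff (q ^ 2 + 1) l).2 h1
      push_cast at this
      exact eq_neg_of_add_eq_zero_left this
    exact ZMod.mod_four_ne_three_of_sq_eq_neg_one h2 hl4


theorem exists_red (L : Type) [NormedField L] [IsUltrametricDist L] :
    ∃ (O : Subring L) (k : Type) (_ : Field k) (_ : IsAlgClosed k) (r : O →+* k),
    (∀ x : L, x ∈ O ↔ ‖x‖ ≤ 1) ∧ (∀ x : O, r x = 0 ↔ ‖(x : L)‖ < 1) := by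
  let v := NormedField.valuation (K := L)
  let A := v.valuationSubring
  have hm : ∀ x : L, x ∈ A ↔ ‖x‖ ≤ 1 := by
    intro x
    rw [Valuation.mem_valuationSubring_iff, NormedField.valuation_apply]
    exact Iff.rfl
  refine ⟨A.toSubring, AlgebraicClosure (IsLocalRing.ResidueField A), inferInstance, inferInstance,
    (algebraMap (IsLocalRing.ResidueField A) _).comp (IsLocalRing.residue A), hm, ?_⟩
  intro x
  have hx : ‖(x : L)‖ ≤ 1 := (hm _).1 x.2
  have hu : IsUnit (show A from x) ↔ ‖(x : L)‖ = 1 := by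
    constructor
    · intro h
      obtain ⟨y, hy⟩ := h.exists_right_inv
      have h1 : ‖(x : L)‖ * ‖(y : L)‖ = 1 := by
        rw [← norm_mul]
        have := congrArg (fun z : A => (z : L)) hy
        simp only at this
        change ‖(((show A from x) * y : A) : L)‖ = 1
        rw [this]; simp
      have hy' : ‖(y : L)‖ ≤ 1 := (hm _).1 y.2
      nlinarith [norm_nonneg (x : L), norm_nonneg (y : L)]
    · intro h
      have h0 : (x : L) ≠ 0 := by
        intro h0; rw [h0, norm_zero] at h; exact zero_ne_one h
      refine IsUnit.of_mul_eq_one ⟨(x : L)⁻¹, (hm _).2 (by rw [norm_inv, h, inv_one])⟩ ?_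
      apply Subtype.ext
      exact mul_inv_cancel₀ h0
  rw [RingHom.comp_apply, map_eq_zero]
  refine (IsLocalRing.residue_eq_zero_iff (R := A) x).trans ?_
  rw [IsLocalRing.mem_maximalIdeal, mem_nonunits_iff]
  constructor
  · intro h
    exact lt_of_le_of_ne hx (fun h' => h (hu.2 h'))
  · intro h h'
    exact h.ne (hu.1 h')

theorem red_charP {L : Type} [NormedField L] [IsUltrametricDist L] {O : Subring L} {k : Type} [Field k]
    {r : O →+* k} (hr : ∀ x : O, r x = 0 ↔ ‖(x : L)‖ < 1)
    {p : ℕ} [hp : Fact p.Prime] (hpn : ‖(p : L)‖ < 1) 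
    : CharP k p := by
  have h : (p : k) = 0 := by
    have := (hr (p : O)).2 (by simpa using hpn)
    simpa using this
  exact (CharP.charP_iff_prime_eq_zero hp.out).2 h

theorem red_uniq {L : Type} [NormedField L] [IsUltrametricDist L] {O : Subring L} {k : Type} [Field k]
    {r : O →+* k} (hr : ∀ x : O, r x = 0 ↔ ‖(x : L)‖ < 1)
    {p : ℕ} [hp : Fact p.Prime] (hpn : ‖(p : L)‖ < 1) 
    {f : ℕ} (hf : 0 < f) {x y : O} (hx : x ^ (p ^ f - 1) = 1) (hy : y ^ (p ^ f - 1) = 1)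
    (hxy : r x = r y) : x = y := by
  have := red_charP hr hpn
  have hpf : 1 < p ^ f := Nat.one_lt_pow hf.ne' hp.out.one_lt
  set N := p ^ f - 1 with hN
  have key : ∀ z : O, z ^ N = 1 → r z = 1 → z = 1 := by
    intro z hz hz1
    by_contra hne
    have h1 : (z - 1) * ∑ i ∈ Finset.range N, z ^ i = 0 := by
      rw [mul_geom_sum, hz, sub_self]
    have h2 := (mul_eq_zero.1 h1).resolve_left (sub_ne_zero.2 hne)
    have h3 := congrArg r h2
    rw [map_sum] at h3
    simp only [map_pow, hz1, one_pow, Finset.sum_const, Finset.card_range, nsmul_eq_mul, mul_one, map_zero] at h3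
    have h4 : ((N + 1 : ℕ) : k) = 0 := by
      rw [show N + 1 = p ^ f by omega]
      push_cast
      rw [CharP.cast_eq_zero k p, zero_pow hf.ne']
    push_cast at h4
    rw [h3, zero_add] at h4
    exact one_ne_zero h4
  have hN1 : N = (N - 1) + 1 := by omega
  have h1 := key (x * y ^ (N - 1)) (by rw [mul_pow, hx, one_mul, ← pow_mul, mul_comm, pow_mul, hy, one_pow]) (by
    rw [map_mul, hxy, ← map_mul, ← pow_succ', ← hN1, hy, map_one])
  calc x = x * y ^ N := by rw [hy, mul_one]
    _ = (x * y ^ (N - 1)) * y := by rw [mul_assoc, ← pow_succ, ← hN1]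
    _ = y := by rw [h1, one_mul]


theorem teich {L : Type} [NormedField L] [IsUltrametricDist L] {O : Subring L} {k : Type} [Field k]
    {r : O →+* k} (hO : ∀ x : L, x ∈ O ↔ ‖x‖ ≤ 1) (hr : ∀ x : O, r x = 0 ↔ ‖(x : L)‖ < 1)
    {p : ℕ} [hp : Fact p.Prime] (hpn : ‖(p : L)‖ < 1) 
    [IsAlgClosed L] [CharZero L] {F : Type} [Field F] [Fintype F] {f : ℕ} (hf : 0 < f)
    (hF : Fintype.card F = p ^ f) (σ : F →+* k) :
    ∃ τ : MulChar F L, orderOf τ = Fintype.card F - 1 ∧ ∀ t : F, ∃ h : τ t ∈ O, r ⟨τ t, h⟩ = σ t⁻¹ := by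
  have hpf : 1 < p ^ f := Nat.one_lt_pow hf.ne' hp.out.one_lt
  set N := p ^ f - 1 with hN
  have hN0 : 0 < N := by omega
  have : NeZero N := ⟨hN0.ne'⟩
  have : NeZero (N : L) := ⟨by exact_mod_cast hN0.ne'⟩
  obtain ⟨ω, hω⟩ := HasEnoughRootsOfUnity.exists_primitiveRoot L N
  have hωO : ω ∈ O := by
    rw [hO]
    exact (isOfFinOrder_iff_pow_eq_one.2 ⟨N, hN0, hω.pow_eq_one⟩).norm_eq_one.le
  set w : O := ⟨ω, hωO⟩ with hw
  have hwp : IsPrimitiveRoot w N := IsPrimitiveRoot.of_map_of_injective (f := O.subtype) hω Subtype.val_injective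
  have hrw : IsPrimitiveRoot (r w) N := by
    refine ⟨by rw [← map_pow, hwp.pow_eq_one, map_one], fun i hi => ?_⟩
    apply hwp.dvd_of_pow_eq_one
    apply red_uniq hr hpn hf
    · rw [← pow_mul, mul_comm, pow_mul, hwp.pow_eq_one, one_pow]
    · rw [one_pow]
    · rw [map_pow, hi, map_one]
  have hex : ∀ t : Fˣ, ∃ x : O, x ^ N = 1 ∧ r x = σ t := by
    intro t
    have : σ (t : F) ^ N = 1 := by
      rw [← map_pow, hN, ← hF, FiniteField.pow_card_sub_one_eq_one _ t.ne_zero, map_one]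
    obtain ⟨i, hi, h⟩ := hrw.eq_pow_of_pow_eq_one this
    exact ⟨w ^ i, by rw [← pow_mul, mul_comm, pow_mul, hwp.pow_eq_one, one_pow], by rw [map_pow, h]⟩
  choose T hT1 hT2 using hex
  have hTm : ∀ s t, T (s * t) = T s * T t := by
    intro s t
    apply red_uniq hr hpn hf (hT1 _)
    · rw [mul_pow, hT1, hT1, mul_one]
    · rw [map_mul, hT2, hT2, hT2]; simp
  let T' : Fˣ →* L :=
    { toFun := fun t => T t
      map_one' := by
        have : T 1 = 1 := red_uniq hr hpn hf (hT1 _) (one_pow _) (by rw [hT2]; simp)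
        rw [this]; simp
      map_mul' := fun s t => by rw [hTm]; simp }
  let τ0 : MulChar F L := MulChar.ofUnitHom T'.toHomUnits
  have hτ0 : ∀ t : Fˣ, τ0 t = T t := fun t => by
    simp only [τ0, MulChar.ofUnitHom_coe]
    rfl
  refine ⟨τ0⁻¹, ?_, ?_⟩
  · rw [orderOf_inv, hF]
    apply Nat.dvd_antisymm
    · have := MulChar.orderOf_dvd_card_sub_one F τ0
      rwa [hF] at this
    · obtain ⟨g, hg⟩ := IsCyclic.exists_generator (α := Fˣ)
      have h1 : (τ0 ^ orderOf τ0) g = 1 := by rw [pow_orderOf_eq_one]; simp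
      rw [MulChar.pow_apply_coe, hτ0] at h1
      have h2 : (T g) ^ orderOf τ0 = 1 := Subtype.ext (by simpa using h1)
      have h3 := congrArg r h2
      rw [map_pow, hT2, map_one, ← map_pow, ← map_one σ] at h3
      have h4 : g ^ orderOf τ0 = 1 := Units.ext (by simpa using σ.injective h3)
      have h5 := orderOf_dvd_of_pow_eq_one h4
      classical
      rwa [orderOf_eq_card_of_forall_mem_zpowers hg, Nat.card_eq_fintype_card, Fintype.card_units, hF] at h5
  · intro t
    rw [MulChar.inv_apply']
    by_cases ht : t = 0
    · subst ht
      have e : τ0 0⁻¹ = 0 := by rw [inv_zero, MulChar.map_zero]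
      have e' : τ0 0⁻¹ ∈ O := by rw [e]; exact O.zero_mem
      refine ⟨e', ?_⟩
      have : (⟨τ0 0⁻¹, e'⟩ : O) = 0 := Subtype.ext e
      rw [this, map_zero, inv_zero, map_zero]
    · have e : τ0 t⁻¹ = T (Units.mk0 t ht)⁻¹ := by rw [← hτ0]; simp
      refine ⟨by rw [e]; exact (T _).2, ?_⟩
      have : (⟨τ0 t⁻¹, by rw [e]; exact (T _).2⟩ : O) = T (Units.mk0 t ht)⁻¹ := Subtype.ext e
      rw [this, hT2]
      simp


theorem trace_inv_sum {p f : ℕ} [hp : Fact p.Prime] (hf : 0 < f) {F : Type} [Field F] [Fintype F] [Algebra (ZMod p) F]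
    (hF : Fintype.card F = p ^ f) :
    ∑ t : F, t⁻¹ * algebraMap (ZMod p) F (Algebra.trace (ZMod p) F t) = -1 := by
  classical
  have hr : Module.finrank (ZMod p) F = f := by
    have := Module.card_eq_pow_finrank (K := ZMod p) (V := F)
    rw [hF, ZMod.card] at this
    exact (Nat.pow_right_injective hp.out.two_le this).symm
  have : CharP F p := charP_of_injective_algebraMap (algebraMap (ZMod p) F).injective p
  have h1 : ∀ t : F, t⁻¹ * algebraMap (ZMod p) F (Algebra.trace (ZMod p) F t)
      = ∑ i ∈ Finset.range f, t⁻¹ * t ^ p ^ i := by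
    intro t
    rw [FiniteField.algebraMap_trace_eq_sum_pow, hr, Nat.card_zmod, Finset.mul_sum]
  rw [Finset.sum_congr rfl (fun t _ => h1 t), Finset.sum_comm, ← Finset.sum_erase_add _ _ (Finset.mem_range.2 hf)]
  rw [Finset.sum_eq_zero, zero_add]
  · rw [← Finset.add_sum_erase _ _ (Finset.mem_univ (0 : F))]
    rw [Finset.sum_congr rfl (g := fun _ => (1 : F))]
    · rw [Finset.sum_const, Finset.card_erase_of_mem (Finset.mem_univ _), Finset.card_univ, hF, nsmul_eq_mul,
        Nat.cast_sub (Nat.one_le_pow _ _ hp.out.pos)]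
      push_cast
      rw [CharP.cast_eq_zero F p, zero_pow hf.ne']
      simp
    · intro x hx
      rw [pow_zero, pow_one, inv_mul_cancel₀ (Finset.ne_of_mem_erase hx)]
  · intro i hi
    have hi0 : i ≠ 0 := Finset.ne_of_mem_erase hi
    have hif : i < f := Finset.mem_range.1 (Finset.mem_of_mem_erase hi)
    have hpi : 1 < p ^ i := Nat.one_lt_pow hi0 hp.out.one_lt
    have hlt : p ^ i < p ^ f := Nat.pow_lt_pow_right hp.out.one_lt hif
    rw [← FiniteField.sum_pow_lt_card_sub_one F (p ^ i - 1) (by omega)]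
    refine Finset.sum_congr rfl fun t _ => ?_
    by_cases ht : t = 0
    · subst ht
      rw [inv_zero, zero_mul, zero_pow (by omega)]
    · rw [← Nat.sub_add_cancel hpi.le, pow_succ]
      field_simp
      simp

theorem gauss_one {L : Type} [NormedField L] {O : Subring L} {k : Type} [Field k]
  {r : O →+* k} (hO : ∀ x : L, x ∈ O ↔ ‖x‖ ≤ 1) (hr : ∀ x : O, r x = 0 ↔ ‖(x : L)‖ < 1)
  {p f : ℕ} [hp : Fact p.Prime] (hf : 0 < f) {F : Type} [Field F] [Fintype F] [Algebra (ZMod p) F]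
    (hF : Fintype.card F = p ^ f) (σ : F →+* k) {τ : MulChar F L} (hτ1 : τ ≠ 1)
    (hτ : ∀ t : F, ∃ h : τ t ∈ O, r ⟨τ t, h⟩ = σ t⁻¹) {ζ : L} (hζO : ζ ∈ O) (hζ : ‖ζ - 1‖ < 1)
    {e : AddChar F L} (he : ∀ t, e t = ζ ^ (Algebra.trace (ZMod p) F t).val) :
    ‖gaussSum τ e‖ = ‖ζ - 1‖ := by
  choose hm hres using hτ
  set T : F → O := fun t => ⟨τ t, hm t⟩ with hT
  set π : O := ⟨ζ, hζO⟩ - 1 with hπ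
  set m : F → ℕ := fun t => (Algebra.trace (ZMod p) F t).val with hmm
  have hex : ∀ t, ∃ c : O, (1 + π) ^ m t = 1 + m t * π + c * π ^ 2 := by
    intro t
    obtain ⟨c, hc⟩ := powAddExpansion (1 : O) π (m t)
    exact ⟨c, by rw [hc]; simp⟩
  choose c hc using hex
  set u : O := ∑ t, T t * m t + π * ∑ t, T t * c t with hu
  have hT0 : ∑ t, T t = 0 := by
    apply Subtype.ext
    push_cast
    exact MulChar.sum_eq_zero_of_ne_one hτ1
  have hG : ∑ t, T t * (1 + π) ^ m t = π * u := by
    have : ∀ t, T t * (1 + π) ^ m t = T t + π * (T t * m t) + π ^ 2 * (T t * c t) := by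
      intro t; rw [hc]; ring
    rw [Finset.sum_congr rfl (fun t _ => this t), Finset.sum_add_distrib, Finset.sum_add_distrib, hT0, 
      ← Finset.mul_sum, ← Finset.mul_sum, hu]
    ring
  have hG' : gaussSum τ e = (ζ - 1) * (u : L) := by
    have := congrArg (Subtype.val) hG
    rw [gaussSum]
    push_cast at this
    rw [hπ] at this
    push_cast at this
    rw [← this]
    refine Finset.sum_congr rfl fun t _ => ?_
    rw [he]
    simp [hT, hmm]
  have hrπ : r π = 0 := (hr _).2 (by simpa [hπ] using hζ)
  have hru : r u = -1 := by
    rw [hu, map_add, map_mul, hrπ, zero_mul, add_zero, map_sum, ← map_one σ, ← map_neg, ← trace_inv_sum hf hF, map_sum]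
    refine Finset.sum_congr rfl fun t _ => ?_
    rw [map_mul, hres, map_mul, map_natCast]
    congr 1
    have : algebraMap (ZMod p) F (Algebra.trace (ZMod p) F t) = ((m t : ℕ) : F) := by
      conv_lhs => rw [← ZMod.natCast_zmod_val (Algebra.trace (ZMod p) F t)]
      rw [map_natCast]
    rw [this, map_natCast]
  have hun : ‖(u : L)‖ = 1 := by
    apply le_antisymm ((hO _).1 u.2)
    by_contra hlt
    have := (hr u).2 (not_le.1 hlt)
    rw [hru] at this
    exact one_ne_zero (neg_eq_zero.1 this)
  rw [hG', norm_mul, hun, mul_one]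

theorem norm_pi {L : Type} [NormedField L] [IsUltrametricDist L] {p : ℕ} [hp : Fact p.Prime] 
    (hpn : ‖(p : L)‖ = (p : ℝ)⁻¹) {ζ : L} (hζ : IsPrimitiveRoot ζ p) : 
    (p : ℝ)⁻¹ ≤ ‖ζ - 1‖ ^ (p - 1) := by
  have h1 := IsPrimitiveRoot.prod_one_sub_pow_eq_order (n := p - 1) (by rwa [Nat.sub_add_cancel hp.out.one_le])
  have h2 := congrArg norm h1
  have h3 : ((p - 1 : ℕ) : L) + 1 = (p : L) := by
    exact_mod_cast congrArg (Nat.cast : ℕ → L) (Nat.sub_add_cancel hp.out.one_le)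
  rw [h3, hpn, norm_prod] at h2
  rw [← h2]
  have hζn : ‖ζ‖ = 1 := (isOfFinOrder_iff_pow_eq_one.2 ⟨p, hp.out.pos, hζ.pow_eq_one⟩).norm_eq_one
  have : ∀ i ∈ Finset.range (p - 1), ‖1 - ζ ^ (i + 1)‖ ≤ ‖ζ - 1‖ := by
    intro i _
    rw [norm_sub_rev, ← mul_geom_sum, norm_mul]
    refine mul_le_of_le_one_right (norm_nonneg _) ?_
    apply IsUltrametricDist.norm_sum_le_of_forall_le_of_nonneg zero_le_one
    intro j _
    rw [norm_pow, hζn, one_pow]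
  have := Finset.prod_le_prod (fun i _ => norm_nonneg _) this
  rwa [Finset.prod_const, Finset.card_range] at this

theorem norm_pi_lt {L : Type} [NormedField L] [IsUltrametricDist L] {O : Subring L} {k : Type} [Field k]
  {r : O →+* k} (hO : ∀ x : L, x ∈ O ↔ ‖x‖ ≤ 1) (hr : ∀ x : O, r x = 0 ↔ ‖(x : L)‖ < 1)
    {p : ℕ} [hp : Fact p.Prime] 
    (hpn : ‖(p : L)‖ < 1) {ζ : L} (hζ : ζ ^ p = 1) : ζ ∈ O ∧ ‖ζ - 1‖ < 1 := by
  have hζn : ‖ζ‖ = 1 := (isOfFinOrder_iff_pow_eq_one.2 ⟨p, hp.out.pos, hζ⟩).norm_eq_one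
  have hζO : ζ ∈ O := (hO _).2 hζn.le
  refine ⟨hζO, ?_⟩
  have := red_charP hr hpn
  have h := (hr (⟨ζ, hζO⟩ - 1)).1 (by
    have : (r (⟨ζ, hζO⟩ - 1)) ^ p = 0 := by
      rw [map_sub, map_one, sub_pow_char, one_pow, ← map_pow]
      have : (⟨ζ, hζO⟩ : O) ^ p = 1 := Subtype.ext (by simpa using hζ)
      rw [this, map_one, sub_self]
    exact eq_zero_of_pow_eq_zero this)
  simpa using h


theorem gnorm_refl {L : Type} [NormedField L] {F : Type} [Field F] [Fintype F] {e : AddChar F L} (he : e.IsPrimitive)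
    {χ : MulChar F L} (hχ : χ ≠ 1) : ‖gaussSum χ e‖ * ‖gaussSum χ⁻¹ e‖ = ‖((Fintype.card F : ℕ) : L)‖ := by
  rw [← gaussSum_mul_gaussSum_eq_card hχ he, norm_mul, ← mul_gaussSum_inv_eq_gaussSum χ⁻¹ e, norm_mul,
    mulChar_norm_eq_one _ (neg_ne_zero.2 one_ne_zero), one_mul]

theorem gnorm_ne {L : Type} [NormedField L] [CharZero L] {F : Type} [Field F] [Fintype F] {e : AddChar F L} (he : e.IsPrimitive)
    {χ : MulChar F L} (hχ : χ ≠ 1) : 0 < ‖gaussSum χ e‖ := by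
  have h := gnorm_refl he hχ
  refine lt_of_le_of_ne (norm_nonneg _) fun h0 => ?_
  rw [← h0, zero_mul] at h
  exact Fintype.card_ne_zero (α := F) (by exact_mod_cast norm_eq_zero.1 h.symm)

theorem gnorm_jac {L : Type} [NormedField L] {F : Type} [Field F] [Fintype F] (e : AddChar F L)
    {χ φ : MulChar F L} (h : χ * φ ≠ 1) :
    ‖gaussSum (χ * φ) e‖ * ‖jacobiSum χ φ‖ = ‖gaussSum χ e‖ * ‖gaussSum φ e‖ := by
  rw [← norm_mul, jacobiSum_mul_nontrivial h e, norm_mul]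

theorem gnorm_mul {L : Type} [NormedField L] [IsUltrametricDist L] {F : Type} [Field F] [Fintype F] (e : AddChar F L)
    {χ φ : MulChar F L} (h : χ * φ ≠ 1) :
    ‖gaussSum χ e‖ * ‖gaussSum φ e‖ ≤ ‖gaussSum (χ * φ) e‖ := by
  rw [← gnorm_jac e h]
  refine mul_le_of_le_one_right (norm_nonneg _) ?_
  apply IsUltrametricDist.norm_sum_le_of_forall_le_of_nonneg zero_le_one
  intro x _
  rw [norm_mul]
  exact mul_le_one₀ (mulChar_norm_le_one _ _) (norm_nonneg _) (mulChar_norm_le_one _ _)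

theorem gauss_frob {L : Type} [NormedField L] {p : ℕ} [hp : Fact p.Prime] {F : Type} [Field F] [Fintype F] 
    [Algebra (ZMod p) F] {ζ : L}
    {e : AddChar F L} (he : ∀ t, e t = ζ ^ (Algebra.trace (ZMod p) F t).val) (χ : MulChar F L) :
    gaussSum (χ ^ p) e = gaussSum χ e := by
  have : CharP F p := charP_of_injective_algebraMap (algebraMap (ZMod p) F).injective p
  have : FiniteDimensional (ZMod p) F := Module.Finite.of_finite
  have h1 : ∀ t : F, e (t ^ p) = e t := by
    intro t
    rw [he, he]
    have := Algebra.trace_eq_of_algEquiv (FiniteField.frobeniusAlgEquivOfAlgebraic (ZMod p) F) t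
    simp only [FiniteField.coe_frobeniusAlgEquivOfAlgebraic, ZMod.card] at this
    rw [this]
  rw [gaussSum, gaussSum]
  conv_rhs => rw [← Equiv.sum_comp (FiniteField.frobeniusAlgEquivOfAlgebraic (ZMod p) F).toEquiv]
  refine Finset.sum_congr rfl fun t _ => ?_
  have : (FiniteField.frobeniusAlgEquivOfAlgebraic (ZMod p) F).toEquiv t = t ^ p := by
    have := congrFun (FiniteField.coe_frobeniusAlgEquivOfAlgebraic (ZMod p) F) t
    rw [ZMod.card] at this
    exact this
  rw [this, h1, map_pow, MulChar.pow_apply' _ hp.out.ne_zero]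

def Rsum (p f a : ℕ) : ℕ := ∑ i ∈ Finset.range f, (p ^ i * a) % (p ^ f - 1)

theorem Rsum_mul (p f a : ℕ) (hp : 0 < p) : Rsum p f (p * a) = Rsum p f a := by
  have h := Finset.sum_range_succ (fun i => (p ^ i * a) % (p ^ f - 1)) f
  have h' := Finset.sum_range_succ' (fun i => (p ^ i * a) % (p ^ f - 1)) f
  rw [h] at h'
  have h2 : (p ^ f * a) % (p ^ f - 1) = (p ^ 0 * a) % (p ^ f - 1) := by
    have h1 : p ^ f = (p ^ f - 1) + 1 := by
      have := Nat.one_le_pow f p hp; omega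
    conv_lhs => rw [h1]
    rw [Nat.add_sub_cancel, add_mul, Nat.add_mod, Nat.mul_mod_right, zero_add, Nat.mod_mod, pow_zero]
  rw [h2] at h'
  have h3 : ∀ i, p ^ (i + 1) * a = p ^ i * (p * a) := fun i => by ring
  simp only [h3] at h'
  unfold Rsum
  omega

theorem Rsum_succ {p f a : ℕ} (hp : 2 ≤ p) (ha : ¬ p ∣ a + 1) (haN : a + 1 < p ^ f - 1) : 
    (p - 1) * Rsum p f (a + 1) = (p - 1) * Rsum p f a + (p ^ f - 1) := by
  have key : ∀ i ∈ Finset.range f, (p ^ i * (a + 1)) % (p ^ f - 1) = (p ^ i * a) % (p ^ f - 1) + p ^ i := by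
    intro i hi
    have hif := Finset.mem_range.1 hi
    set N := p ^ f - 1 with hN
    have hQ : p ^ f = N + 1 := by omega
    have hx : (p ^ i * a) % N < N := Nat.mod_lt _ (by omega)
    set x := (p ^ i * a) % N with hxdef
    have e1 : p ^ i * (a + 1) ≡ x + p ^ i [MOD N] := by
      rw [mul_add, mul_one]
      exact Nat.ModEq.add_right _ (Nat.mod_modEq _ _).symm
    have hlt : x + p ^ i < N := by
      by_contra hge
      push Not at hge
      apply ha
      set w := x + p ^ i - N with hw
      have hwi : w < p ^ i := by omega
      have e2 : p ^ i * (a + 1) ≡ w [MOD N] := by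
        refine e1.trans ?_
        have : x + p ^ i = w + N := by omega
        rw [this]
        exact Nat.add_modEq_right
      have e3 := e2.mul_left (p ^ (f - i))
      rw [← mul_assoc, ← pow_add, Nat.sub_add_cancel hif.le, hQ] at e3
      have e4 : (N + 1) * (a + 1) ≡ a + 1 [MOD N] := by
        rw [add_mul, one_mul]
        exact (Nat.modEq_zero_iff_dvd.2 (dvd_mul_right _ _)).add_right _ |>.trans (by rw [zero_add])
      have e5 := e4.symm.trans e3
      have hfi : p ∣ p ^ (f - i) := dvd_pow_self p (by omega)
      have hlt2 : p ^ (f - i) * w < N := by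
        have h1 : p ^ (f - i) * (w + 1) ≤ p ^ (f - i) * p ^ i := Nat.mul_le_mul_left _ hwi
        rw [← pow_add, Nat.sub_add_cancel hif.le, hQ, mul_add, mul_one] at h1
        have h2 : 2 ≤ p ^ (f - i) := hp.trans (Nat.le_of_dvd (by positivity) hfi)
        omega
      rw [Nat.ModEq.eq_of_lt_of_lt e5 haN hlt2]
      exact hfi.mul_right _
    have := Nat.ModEq.eq_of_lt_of_lt ((Nat.mod_modEq _ _).trans e1) (Nat.mod_lt _ (by omega)) hlt
    exact this
  unfold Rsum
  rw [Finset.sum_congr rfl key, Finset.sum_add_distrib, mul_add, mul_comm (p - 1) (∑ i ∈ Finset.range f, p ^ i)]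
  congr 1
  have := Nat.geomSum_eq hp f
  rw [this]
  exact Nat.div_mul_cancel (by simpa using Nat.sub_dvd_pow_sub_pow p 1 f)

theorem stick {L : Type} [NormedField L] [IsUltrametricDist L] [IsAlgClosed L] [CharZero L]
  {p f : ℕ} [hp : Fact p.Prime] (hp3 : 3 ≤ p) (hf : 0 < f) (hpn : ‖(p : L)‖ = (p : ℝ)⁻¹)
  {F : Type} [Field F] [Fintype F] [CharP F p] (hF : Fintype.card F = p ^ f) :
  ∃ (e : AddChar F L) (τ : MulChar F L), e.IsPrimitive ∧ orderOf τ = p ^ f - 1 ∧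
    ∀ a, 0 < a → a < p ^ f - 1 → 
      ((p ^ f - 1 : ℕ) : ℝ) * (- Real.logb p ‖gaussSum (τ ^ a) e‖) ≤ Rsum p f a := by
  let _ : Algebra (ZMod p) F := ZMod.algebra F p
  have : FiniteDimensional (ZMod p) F := Module.Finite.of_finite
  have hp1 : (1 : ℝ) < p := by exact_mod_cast hp.out.one_lt
  have hpn' : ‖(p : L)‖ < 1 := by rw [hpn]; exact inv_lt_one_of_one_lt₀ hp1
  obtain ⟨O, k, _, _, r, hO, hr⟩ := exists_red L
  have := red_charP hr hpn'
  let _ : Algebra (ZMod p) k := ZMod.algebra k p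
  have : Algebra.IsAlgebraic (ZMod p) F := Algebra.IsAlgebraic.of_finite _ _
  let σ : F →ₐ[ZMod p] k := IsAlgClosed.lift
  obtain ⟨τ, hτN, hτ⟩ := teich hO hr hpn' hf hF (σ : F →+* k)
  rw [hF] at hτN
  have : NeZero (p : L) := ⟨by exact_mod_cast hp.out.ne_zero⟩
  obtain ⟨ζ, hζ⟩ := HasEnoughRootsOfUnity.exists_primitiveRoot L p
  obtain ⟨hζO, hζ1⟩ := norm_pi_lt hO hr hpn' hζ.pow_eq_one
  let e : AddChar F L := (AddChar.zmodChar p hζ.pow_eq_one).compAddMonoidHom (Algebra.trace (ZMod p) F).toAddMonoidHom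
  have he : ∀ t, e t = ζ ^ (Algebra.trace (ZMod p) F t).val := by
    intro t
    simp only [e, AddChar.compAddMonoidHom_apply, AddChar.zmodChar_apply]
    rfl
  have hep : e.IsPrimitive := by
    apply AddChar.IsPrimitive.of_ne_one
    intro h1
    obtain ⟨t, ht⟩ := Algebra.trace_surjective (ZMod p) F 1
    have := he t
    rw [h1, ht, ZMod.val_one, pow_one, AddChar.one_apply] at this
    exact hζ.ne_one hp.out.one_lt this.symm
  have hpf : p ≤ p ^ f := Nat.le_self_pow hf.ne' p
  have hne : ∀ a, 0 < a → a < p ^ f - 1 → τ ^ a ≠ 1 := by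
    intro a h0 h1 h
    have := Nat.le_of_dvd h0 (orderOf_dvd_of_pow_eq_one h)
    omega
  have hone : ((p : ℝ) - 1) * (- Real.logb p ‖gaussSum τ e‖) ≤ 1 := by
    rw [gauss_one hO hr hf hF (σ : F →+* k) (by simpa using hne 1 one_pos (by omega)) hτ hζO hζ1 he]
    have h1 := norm_pi hpn hζ
    have h2 := Real.logb_le_logb_of_le hp1 (by positivity) h1
    rw [Real.logb_inv, Real.logb_self_eq_one hp1, Real.logb_pow, Nat.cast_sub hp.out.one_le, Nat.cast_one] at h2
    linarith
  refine ⟨e, τ, hep, hτN, ?_⟩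
  have hNp : ((p ^ f - 1 : ℕ) : ℝ) > 0 := by
    have : 0 < p ^ f - 1 := by omega
    exact_mod_cast this
  intro a
  induction a using Nat.strong_induction_on with
  | _ a ih =>
    intro h0 h1
    by_cases hpa : p ∣ a
    · obtain ⟨b, rfl⟩ := hpa
      have hb : 0 < b := Nat.pos_of_mul_pos_left h0
      have hlt : b < p * b := by nlinarith
      have := ih b hlt hb (by omega)
      rw [mul_comm p b, pow_mul, gauss_frob he, mul_comm b p, Rsum_mul _ _ _ hp.out.pos]
      exact this
    · obtain ⟨b, rfl⟩ : ∃ b, a = b + 1 := ⟨a - 1, by omega⟩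
      have hR := Rsum_succ hp.out.two_le hpa h1
      have hR' : ((p : ℝ) - 1) * Rsum p f (b + 1) = ((p : ℝ) - 1) * Rsum p f b + ((p ^ f - 1 : ℕ) : ℝ) := by
        have := congrArg (Nat.cast : ℕ → ℝ) hR
        rw [Nat.cast_mul, Nat.cast_add, Nat.cast_mul, Nat.cast_sub hp.out.one_le, Nat.cast_one] at this
        exact this
      have hp0 : (0 : ℝ) < (p : ℝ) - 1 := by linarith
      have hone' := mul_le_mul_of_nonneg_left hone hNp.le
      by_cases hb : b = 0
      · subst hb
        have : Rsum p f 0 = 0 := by simp [Rsum]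
        rw [this] at hR'
        rw [zero_add, pow_one]
        refine le_of_mul_le_mul_left ?_ hp0
        rw [zero_add] at hR'
        rw [hR']
        push_cast at *
        linarith
      · have hi := ih b (by omega) (by omega) (by omega)
        have hm := gnorm_mul e (χ := τ ^ b) (φ := τ) (by rw [← pow_succ]; exact hne _ h0 h1)
        rw [← pow_succ] at hm
        have g1 := gnorm_ne hep (hne b (by omega) (by omega))
        have g2 : 0 < ‖gaussSum τ e‖ := gnorm_ne hep (by simpa using hne 1 one_pos (by omega))
        have hl := Real.logb_le_logb_of_le hp1 (mul_pos g1 g2) hm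
        rw [Real.logb_mul g1.ne' g2.ne'] at hl
        refine le_of_mul_le_mul_left ?_ hp0
        rw [hR']
        have hi' := mul_le_mul_of_nonneg_left hi hp0.le
        have hl' := mul_le_mul_of_nonneg_left hl (mul_pos hp0 hNp).le
        nlinarith


theorem transfer {F : Type} [Field F] [Fintype F] {L : Type} [Field L] [IsAlgClosed L] [CharZero L]
    {d q : ℕ} (h : ∀ η ψ : MulChar F ℂ, η ^ d = 1 → η ≠ 1 → ψ ^ 2 = qch F ℂ * η →
      ψ (-1) * jacobiSum ψ (qch F ℂ) = q) :
    ∀ η ψ : MulChar F L, η ^ d = 1 → η ≠ 1 → ψ ^ 2 = qch F L * η →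
      ψ (-1) * jacobiSum ψ (qch F L) = q := by
  intro η ψ h1 h2 h3
  have halg : Algebra.IsAlgebraic ℚ (AlgebraicClosure ℚ) := by
    have h0 := AlgebraicClosure.isAlgebraic ℚ
    have hs : (DivisionRing.toRatAlgebra : Algebra ℚ (AlgebraicClosure ℚ)) = AlgebraicClosure.instAlgebra ℚ :=
      Subsingleton.elim _ _
    rw [← hs] at h0
    exact h0
  let iC : (AlgebraicClosure ℚ) →+* ℂ := (IsAlgClosed.lift (R := ℚ) (S := (AlgebraicClosure ℚ)) (M := ℂ)).toRingHom
  let iL : (AlgebraicClosure ℚ) →+* L := (IsAlgClosed.lift (R := ℚ) (S := (AlgebraicClosure ℚ)) (M := L)).toRingHom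
  obtain ⟨τ, hτ⟩ := exists_gen F (AlgebraicClosure ℚ)
  have hinj : Function.Injective (fun χ : MulChar F (AlgebraicClosure ℚ) => χ.ringHomComp iL) := MulChar.injective_ringHomComp iL.injective
  have hinjC : Function.Injective (fun χ : MulChar F (AlgebraicClosure ℚ) => χ.ringHomComp iC) := MulChar.injective_ringHomComp iC.injective
  have hord : orderOf (τ.ringHomComp iL) = Fintype.card F - 1 := by
    rw [← hτ]
    apply orderOf_eq_orderOf_iff.2
    intro n
    rw [MulChar.ringHomComp_pow]
    constructor
    · intro h; apply hinj; simpa [MulChar.ringHomComp_one] using h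
    · intro h; rw [h, MulChar.ringHomComp_one]
  have hsurj : ∀ χ : MulChar F L, ∃ χK : MulChar F (AlgebraicClosure ℚ), χ = χK.ringHomComp iL := by
    intro χ
    obtain ⟨k, -, hk⟩ := eq_pow_gen hord χ
    exact ⟨τ ^ k, by rw [hk, MulChar.ringHomComp_pow]⟩
  obtain ⟨η, rfl⟩ := hsurj η
  obtain ⟨ψ, rfl⟩ := hsurj ψ
  have k1 : η ^ d = 1 := hinj (by simpa [MulChar.ringHomComp_pow, MulChar.ringHomComp_one] using h1)
  have k2 : η ≠ 1 := by rintro rfl; exact h2 (MulChar.ringHomComp_one _)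
  have k3 : ψ ^ 2 = qch F (AlgebraicClosure ℚ) * η := hinj (by
    simp only [← MulChar.ringHomComp_pow, MulChar.ringHomComp_mul, qch_ringHomComp]
    exact h3)
  have := h (η.ringHomComp iC) (ψ.ringHomComp iC) (by rw [MulChar.ringHomComp_pow, k1, MulChar.ringHomComp_one])
    (fun h => k2 (hinjC (by simpa [MulChar.ringHomComp_one] using h)))
    (by rw [MulChar.ringHomComp_pow, k3, MulChar.ringHomComp_mul, qch_ringHomComp])
  rw [← qch_ringHomComp F iC, jacobiSum_ringHomComp, MulChar.ringHomComp_apply, ← map_mul, ← map_natCast iC] at this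
  have := iC.injective this
  rw [← qch_ringHomComp F iL, jacobiSum_ringHomComp, MulChar.ringHomComp_apply, ← map_mul, this, map_natCast]

def C1 (l : ℕ) : Finset ℕ := (Finset.range (4 * l)).filter (fun c => c % 4 = 1 ∧ ¬ l ∣ c)

theorem mem_C1 {l c : ℕ} : c ∈ C1 l ↔ c < 4 * l ∧ c % 4 = 1 ∧ ¬ l ∣ c := by
  simp [C1]

theorem C1_eq {l : ℕ} (hl4 : l % 4 = 3) : 
    (Finset.range l).image (fun k => 4 * k + 1) = insert (3 * l) (C1 l) ∧ 3 * l ∉ C1 l := by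
  constructor
  · ext c
    simp only [Finset.mem_image, Finset.mem_range, Finset.mem_insert, mem_C1]
    constructor
    · rintro ⟨k, hk, rfl⟩
      by_cases h : l ∣ 4 * k + 1
      · left
        obtain ⟨m, hm⟩ := h
        have hm4 : m < 4 := by
          by_contra hge
          have : l * 4 ≤ l * m := Nat.mul_le_mul_left _ (by omega)
          omega
        interval_cases m <;> omega
      · right
        exact ⟨by omega, by omega, h⟩
    · rintro (h | ⟨h1, h2, h3⟩)
      · exact ⟨(c - 1) / 4, by omega, by omega⟩
      · exact ⟨(c - 1) / 4, by omega, by omega⟩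
  · rw [mem_C1]
    rintro ⟨_, _, h⟩
    exact h (dvd_mul_left _ _)

theorem C1_card {l : ℕ} (hl4 : l % 4 = 3) : (C1 l).card + 1 = l := by
  obtain ⟨h1, h2⟩ := C1_eq hl4
  have := congrArg Finset.card h1
  rw [Finset.card_insert_of_notMem h2, Finset.card_image_of_injective _ (fun a b h => by simpa using h), Finset.card_range] at this
  omega

theorem C1_sum {l : ℕ} (hl4 : l % 4 = 3) : ∑ c ∈ C1 l, c + 4 * l = 2 * l * l := by
  obtain ⟨h1, h2⟩ := C1_eq hl4
  have := congrArg (fun s => ∑ c ∈ s, c) h1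
  change ∑ c ∈ _, c = ∑ c ∈ _, c at this
  rw [Finset.sum_insert h2, Finset.sum_image (fun a _ b _ h => by simpa using h)] at this
  have h3 : ∀ m : ℕ, ∑ k ∈ Finset.range m, (4 * k + 1) + m = 2 * m * m := by
    intro m
    induction m with
    | zero => simp
    | succ m ih => rw [Finset.sum_range_succ]; nlinarith
  have := h3 l
  omega

theorem C1_perm {l m : ℕ} (hl : l.Prime) (hl4 : l % 4 = 3) (hm4 : m % 4 = 1) (hml : ¬ l ∣ m) :
    ∑ c ∈ C1 l, (m * c) % (4 * l) = ∑ c ∈ C1 l, c := by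
  have hl0 := hl.pos
  have hcop : Nat.Coprime (4 * l) m := by
    apply Nat.Coprime.mul_left
    · rw [show (4 : ℕ) = 2 ^ 2 by norm_num]
      apply Nat.Coprime.pow_left
      exact Nat.coprime_two_left.2 (Nat.odd_iff.2 (by omega))
    · exact (Nat.Prime.coprime_iff_not_dvd hl).2 hml
  have hmaps : ∀ c ∈ C1 l, (m * c) % (4 * l) ∈ C1 l := by
    intro c hc
    rw [mem_C1] at hc ⊢
    refine ⟨Nat.mod_lt _ (by omega), ?_, ?_⟩
    · rw [Nat.mod_mul_right_mod, Nat.mul_mod, hm4, hc.2.1]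
    · intro h
      rw [Nat.dvd_mod_iff (dvd_mul_left _ _)] at h
      exact (hl.dvd_mul.1 h).elim hml hc.2.2
  have hinj : Set.InjOn (fun c => (m * c) % (4 * l)) (C1 l) := by
    intro a ha b hb hab
    have ha' := mem_C1.1 (Finset.mem_coe.1 ha)
    have hb' := mem_C1.1 (Finset.mem_coe.1 hb)
    exact Nat.ModEq.eq_of_lt_of_lt (Nat.ModEq.cancel_left_of_coprime hcop hab) ha'.1 hb'.1
  have himg : (C1 l).image (fun c => (m * c) % (4 * l)) = C1 l := by
    apply Finset.eq_of_subset_of_card_le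
    · intro x hx
      obtain ⟨c, hc, rfl⟩ := Finset.mem_image.1 hx
      exact hmaps c hc
    · rw [Finset.card_image_of_injOn hinj]
  conv_rhs => rw [← himg]
  rw [Finset.sum_image hinj]

def refl1 (l c : ℕ) : ℕ := if c < 2 * l then 2 * l - c else 6 * l - c

theorem refl1_mem {l c : ℕ} (hl4 : l % 4 = 3) (hc : c ∈ C1 l) : refl1 l c ∈ C1 l := by
  rw [mem_C1] at *
  unfold refl1
  split_ifs with h
  · refine ⟨by omega, by omega, fun h2 => hc.2.2 ?_⟩
    exact (Nat.dvd_sub_iff_right h.le (dvd_mul_left _ _)).1 h2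
  · refine ⟨by omega, by omega, fun h2 => hc.2.2 ?_⟩
    exact (Nat.dvd_sub_iff_right (by omega) (dvd_mul_left _ _)).1 h2

theorem refl1_refl1 {l c : ℕ} (hl4 : l % 4 = 3) (hc : c ∈ C1 l) : refl1 l (refl1 l c) = c := by
  rw [mem_C1] at hc
  unfold refl1
  split_ifs <;> omega


theorem padicpart {L : Type} [NormedField L] [IsUltrametricDist L] [IsAlgClosed L] [CharZero L]
    {p n q l M d : ℕ} [hp : Fact p.Prime] (hp4 : p % 4 = 1) (hn : 0 < n) (hq : q = p ^ n)
    (hpn : ‖(p : L)‖ = (p : ℝ)⁻¹)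
    {F : Type} [Field F] [Fintype F] [CharP F p] (hcF : Fintype.card F = p ^ (2 * n))
    (hF : ringChar F ≠ 2)
    (hl : l.Prime) (hl4 : l % 4 = 3) (hld : l ∣ d) (hM : p ^ (2 * n) - 1 = 4 * l * M)
    (h : ∀ η ψ : MulChar F L, η ^ d = 1 → η ≠ 1 → ψ ^ 2 = qch F L * η →
      ψ (-1) * jacobiSum ψ (qch F L) = q) : False := by
  have hp2 := hp.out.two_le
  obtain ⟨e, τ, he, hτ, hst⟩ := stick (L := L) (p := p) (f := 2 * n) (by omega) (by omega) hpn hcF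
  have hl0 := hl.pos
  have hNpos : 0 < p ^ (2 * n) - 1 := by
    have : 1 < p ^ (2 * n) := Nat.one_lt_pow (by omega) (by omega)
    omega
  have hM0 : 0 < M := by
    rcases Nat.eq_zero_or_pos M with h0 | h0
    · rw [h0] at hM; omega
    · exact h0
  have hτ1 : ∀ a, τ ^ (M * a) = 1 ↔ 4 * l ∣ a := by
    intro a
    rw [← orderOf_dvd_iff_pow_eq_one, hτ, hM, mul_comm M a]
    exact Nat.mul_dvd_mul_iff_right hM0
  have hqch : qch F L = τ ^ (M * (2 * l)) := 
    qch_eq_pow hF (by rw [hτ, hcF]) (by rw [hcF, hM]; ring)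
  have hp1 : (1 : ℝ) < p := by exact_mod_cast hp.out.one_lt
  have hp0 : (0 : ℝ) < p := by linarith
  have hqn : ‖(q : L)‖ = ((p : ℝ)⁻¹) ^ n := by rw [hq, Nat.cast_pow, norm_pow, hpn]
  have hQn : ‖((Fintype.card F : ℕ) : L)‖ = ((p : ℝ)⁻¹) ^ (2 * n) := by
    rw [hcF, Nat.cast_pow, norm_pow, hpn]
  have hqpos : 0 < ‖(q : L)‖ := by rw [hqn]; positivity
  have hGq : ‖gaussSum (qch F L) e‖ = ‖(q : L)‖ := by
    have h1 := gnorm_refl he (qch_ne_one F hF L)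
    have h2 : (qch F L)⁻¹ = qch F L := by
      rw [inv_eq_iff_mul_eq_one, ← pow_two, qch_sq]
    rw [h2, hQn, mul_comm 2 n, pow_mul, ← hqn, ← pow_two] at h1
    exact (pow_left_inj₀ (norm_nonneg _) hqpos.le two_ne_zero).1 h1
  set v : ℕ → ℝ := fun c => - Real.logb p ‖gaussSum (τ ^ (M * c)) e‖ with hv
  have hne : ∀ c ∈ C1 l, τ ^ (M * c) ≠ 1 := by
    intro c hc
    rw [mem_C1] at hc
    rw [Ne, hτ1]
    intro h; exact hc.2.2 ((dvd_mul_left l 4).trans h)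
  have hpair : ∀ c ∈ C1 l, v c + v (refl1 l c) = 2 * n := by
    intro c hc
    have hrne := hne _ (refl1_mem hl4 hc)
    have hcne := hne c hc
    have hc' := mem_C1.1 hc
    have hprod : τ ^ (M * c) * qch F L = τ ^ (M * (c + 2 * l)) := by
      rw [hqch, ← pow_add, mul_add]
    have hpne : τ ^ (M * c) * qch F L ≠ 1 := by
      rw [hprod, Ne, hτ1]
      intro h
      have h2 : (2 : ℕ) ∣ c + 2 * l := (Dvd.intro _ (by ring : 2 * (2 * l) = 4 * l)).trans h
      omega
    have hJ := h (τ ^ (M * (2 * (c + l)))) (τ ^ (M * c)) (by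
        obtain ⟨k, rfl⟩ := hld
        rw [pow_mul, ← pow_mul _ _ l, mul_assoc, (hτ1 _).2, one_pow]
        obtain ⟨j, hj⟩ : 2 ∣ c + l := by omega
        exact ⟨j, by rw [hj]; ring⟩)
      (by
        rw [Ne, hτ1]
        intro h
        apply hc'.2.2
        have h3 : l ∣ 2 * (c + l) := (dvd_mul_left l 4).trans h
        rcases hl.dvd_mul.1 h3 with h4 | h4
        · have := Nat.le_of_dvd (by norm_num) h4
          omega
        · exact (Nat.dvd_add_left (dvd_refl l)).1 h4)
      (by
        have h5 : τ ^ (M * (4 * l)) = 1 := (hτ1 _).2 (dvd_refl _)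
        rw [hqch, ← pow_add, ← pow_mul, show M * (2 * l) + M * (2 * (c + l)) = M * (4 * l) + M * c * 2 by ring,
          pow_add _ (M * (4 * l)), h5, one_mul])
    have hJn : ‖jacobiSum (τ ^ (M * c)) (qch F L)‖ = ‖(q : L)‖ := by
      rw [← hJ, norm_mul, mulChar_norm_eq_one _ (neg_ne_zero.2 one_ne_zero), one_mul]
    have hg := gnorm_jac e hpne
    rw [hJn, hGq] at hg
    have hg2 := mul_right_cancel₀ hqpos.ne' hg
    have hinv : (τ ^ (M * c) * qch F L)⁻¹ = τ ^ (M * refl1 l c) := by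
      rw [inv_eq_iff_mul_eq_one, hprod, ← pow_add, ← mul_add, hτ1]
      unfold refl1
      split_ifs with hlt
      · exact ⟨1, by omega⟩
      · exact ⟨2, by omega⟩
    have hr := gnorm_refl he hpne
    rw [hg2, hinv, hQn] at hr
    have hlog := congrArg (Real.logb p) hr
    rw [Real.logb_mul (gnorm_ne he hcne).ne' (gnorm_ne he hrne).ne', Real.logb_pow, Real.logb_inv,
      Real.logb_self_eq_one hp1] at hlog
    simp only [hv]
    push_cast at hlog
    linarith
  have hsum : 2 * ∑ c ∈ C1 l, v c = ((C1 l).card : ℝ) * (2 * n) := by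
    have h1 : ∑ c ∈ C1 l, v (refl1 l c) = ∑ c ∈ C1 l, v c := by
      apply Finset.sum_nbij' (refl1 l) (refl1 l)
      · intro c hc; exact refl1_mem hl4 hc
      · intro c hc; exact refl1_mem hl4 hc
      · intro c hc; exact refl1_refl1 hl4 hc
      · intro c hc; exact refl1_refl1 hl4 hc
      · intro c hc; rfl
    have h2 := Finset.sum_congr rfl hpair
    rw [Finset.sum_add_distrib, h1, Finset.sum_const, nsmul_eq_mul] at h2
    linarith
  have hup : ((4 * l * M : ℕ) : ℝ) * ∑ c ∈ C1 l, v c ≤ ((∑ c ∈ C1 l, Rsum p (2 * n) (M * c) : ℕ) : ℝ) := by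
    rw [Finset.mul_sum, Nat.cast_sum]
    apply Finset.sum_le_sum
    intro c hc
    have hc' := mem_C1.1 hc
    rw [← hM]
    apply hst
    · exact Nat.mul_pos hM0 (by omega)
    · rw [hM, mul_comm M c]
      exact Nat.mul_lt_mul_of_pos_right hc'.1 hM0
  have hR : ∑ c ∈ C1 l, Rsum p (2 * n) (M * c) = 2 * n * (M * ∑ c ∈ C1 l, c) := by
    unfold Rsum
    rw [Finset.sum_comm]
    have : ∀ i ∈ Finset.range (2 * n), ∑ c ∈ C1 l, p ^ i * (M * c) % (p ^ (2 * n) - 1) = M * ∑ c ∈ C1 l, c := by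
      intro i _
      rw [← C1_perm (m := p ^ i) hl hl4 (by simp [Nat.pow_mod, hp4]) ?_, Finset.mul_sum]
      · apply Finset.sum_congr rfl
        intro c _
        rw [hM, show p ^ i * (M * c) = M * (p ^ i * c) by ring, mul_comm (4 * l) M, Nat.mul_mod_mul_left]
      · intro h
        have := (Nat.prime_dvd_prime_iff_eq hl hp.out).1 (hl.dvd_of_dvd_pow h)
        omega
    rw [Finset.sum_congr rfl this, Finset.sum_const, Finset.card_range, smul_eq_mul]
  rw [hR] at hup
  have e1 : ((C1 l).card : ℝ) + 1 = l := by exact_mod_cast C1_card hl4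
  have e2 : ((∑ c ∈ C1 l, c : ℕ) : ℝ) + 4 * l = 2 * l * l := by exact_mod_cast C1_sum hl4
  have e3 : ((∑ c ∈ C1 l, c : ℕ) : ℝ) = 2 * l * l - 4 * l := by linarith
  rw [Nat.cast_mul (2 * n), Nat.cast_mul M, e3] at hup
  have e4 : ∑ c ∈ C1 l, v c = (l - 1) * n := by
    have : ((C1 l).card : ℝ) = l - 1 := by linarith
    rw [this] at hsum; linarith
  rw [e4] at hup
  push_cast at hup
  have hlM : (0 : ℝ) < l * M * n := by
    have : 0 < l * M * n := by positivity
    exact_mod_cast this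
  nlinarith

theorem count_to_sum {F : Type} [Field F] [Fintype F] (hF : ringChar F ≠ 2) {d q : ℕ} (hd : 1 ≤ d)
    (hq : Fintype.card F = q ^ 2)
    (hc : Nat.card {xy : F × F // xy.2 ^ 2 = (dickson 1 (1 : F) d).eval xy.1} = q ^ 2 + (d - 1) * q) :
    ∑ x : F, qch F ℂ ((dickson 1 (1 : F) d).eval x) = ((d : ℂ) - 1) * q := by
  classical
  have h1 : Nat.card {xy : F × F // xy.2 ^ 2 = (dickson 1 (1 : F) d).eval xy.1} =
      ∑ x : F, (Finset.univ.filter (fun y : F => y ^ 2 = (dickson 1 (1 : F) d).eval x)).card := by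
    rw [Nat.card_eq_fintype_card, Fintype.card_subtype, Finset.card_filter, Fintype.sum_prod_type]
    apply Finset.sum_congr rfl
    intro x _
    rw [Finset.card_filter]
  rw [h1] at hc
  have h2 := congrArg (Nat.cast : ℕ → ℂ) hc
  rw [Nat.cast_sum] at h2
  simp only [qch_card F hF ℂ] at h2
  rw [Finset.sum_add_distrib, Finset.sum_const, Finset.card_univ, hq, nsmul_eq_mul, Nat.cast_add, mul_one,
    Nat.cast_mul, Nat.cast_sub hd, Nat.cast_one] at h2
  exact add_left_cancel h2

theorem statement15 (d l p : ℕ) (hd : Odd d) (hd3 : 3 ≤ d)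
    (hl : l.Prime) (hl4 : l % 4 = 3) (hld : l ∣ d)
    (hp : p.Prime) (hp4 : p % 4 = 1) (hpd : ¬ p ∣ d)
    (n : ℕ) (hn : 1 ≤ n) :
    ¬ chebMaximal d (p ^ n) := by
  intro hmax
  have : Fact p.Prime := ⟨hp⟩
  let : Fintype (GaloisField p (2 * n)) := Fintype.ofFinite _
  have hcard : Fintype.card (GaloisField p (2 * n)) = p ^ (2 * n) := by
    rw [← Nat.card_eq_fintype_card]; exact GaloisField.card p (2 * n) (by omega)
  have hcard2 : Fintype.card (GaloisField p (2 * n)) = (p ^ n) ^ 2 := by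
    rw [hcard, mul_comm, pow_mul]
  have hF : ringChar (GaloisField p (2 * n)) ≠ 2 := by
    rw [ringChar.eq (GaloisField p (2 * n)) p]; omega
  have hq4 : p ^ n % 4 = 1 := by simp [Nat.pow_mod, hp4]
  have hc := hmax (GaloisField p (2 * n)) hcard2
  unfold chebAffineCount at hc
  have hS := count_to_sum hF (by omega) hcard2 hc
  obtain ⟨h1, h2⟩ := analytic (p := p) hF hcard2 hq4 hd hl hl4 hld hS
  have h3 := transfer (L := PadicAlgCl p) h2
  have hl1 : l ∣ p ^ (2 * n) - 1 := by
    rw [mul_comm, pow_mul]; exact hld.trans h1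
  have h41 : 4 ∣ p ^ (2 * n) - 1 := by
    have : p ^ (2 * n) % 4 = 1 := by simp [Nat.pow_mod, hp4]
    omega
  have hcop : Nat.Coprime 4 l := by
    rw [show (4 : ℕ) = 2 ^ 2 by norm_num]
    exact Nat.Coprime.pow_left _ (Nat.coprime_two_left.2 (Nat.odd_iff.2 (by omega)))
  obtain ⟨M, hM⟩ := hcop.mul_dvd_of_dvd_of_dvd h41 hl1
  have hpn : ‖(p : PadicAlgCl p)‖ = (p : ℝ)⁻¹ := by
    have := PadicAlgCl.norm_extends p (p : ℚ_[p])
    rw [Padic.norm_p] at this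
    rw [← this]
    congr 1
  exact padicpart hp4 hn rfl hpn hcard hF hl hl4 hld hM h3
end

section
/- Let p be a prime with gcd(p, 30) = 1 and let k ≥ 1. Then the curve H_15 is maximal over 𝔽_{p^{2k}} if and only if k is odd and p ≡ 59 (mod 60) or p ≡ 31 (mod 60). In particular, H_15 is maximal over some finite field of characteristic p precisely when p ≡ −1 or 31 (mod 60). -/
open Polynomial

namespace Cheb

/-- digit coefficient -/
def A (p N a n : ℕ) : ℕ := Nat.choose ((p ^ n - 1) / 2) (a * p ^ n / N)

lemma lucas_step (p N a n : ℕ) (hp : p.Prime) (h2 : p % 2 = 1) (hN : 0 < N) :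
    A p N a (n + 1) ≡ Nat.choose ((p - 1) / 2) (p * (a * p ^ n % N) / N) * A p N a n [MOD p] := by
  have : Fact p.Prime := ⟨hp⟩
  have hpos := hp.pos
  have key := Choose.choose_modEq_choose_mod_mul_choose_div_nat (p := p)
    (n := (p ^ (n + 1) - 1) / 2) (k := a * p ^ (n + 1) / N)
  obtain ⟨h, hh⟩ : ∃ h, p = 2 * h + 1 := ⟨p / 2, by omega⟩
  obtain ⟨m, hm⟩ : ∃ m, p ^ n = 2 * m + 1 := by
    have : Odd (p ^ n) := (Nat.odd_iff.2 h2).pow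
    exact this
  have e1 : (p ^ (n + 1) - 1) / 2 = h + p * m := by
    have : p ^ (n + 1) = 2 * (h + p * m) + 1 := by
      rw [pow_succ, hm]
      conv_rhs => rw [hh]
      conv_lhs => rw [hh]
      ring
    omega
  have e2 : (p ^ n - 1) / 2 = m := by omega
  have e3 : (p - 1) / 2 = h := by omega
  have hr : a * p ^ n % N < N := Nat.mod_lt _ hN
  have e4 : a * p ^ (n + 1) / N = p * (a * p ^ n % N) / N + p * (a * p ^ n / N) := by
    have h1 := Nat.div_add_mod (a * p ^ n) N
    have : a * p ^ (n + 1) = p * (a * p ^ n % N) + N * (p * (a * p ^ n / N)) := by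
      rw [pow_succ, ← mul_assoc]
      conv_lhs => rw [← h1]
      ring
    rw [this, Nat.add_mul_div_left _ _ hN]
  have hlt : p * (a * p ^ n % N) / N < p := by
    rw [Nat.div_lt_iff_lt_mul hN]
    exact Nat.mul_lt_mul_of_pos_left hr hpos
  unfold A
  rw [e1, e4, Nat.add_mul_mod_self_left, Nat.add_mul_mod_self_left, Nat.mod_eq_of_lt hlt,
    Nat.mod_eq_of_lt (by omega : h < p), Nat.add_mul_div_left _ _ hpos,
    Nat.add_mul_div_left _ _ hpos, Nat.div_eq_of_lt hlt, Nat.div_eq_of_lt (by omega : h < p)] at key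
  simp only [zero_add] at key
  rw [e1, e4, e2, e3]
  exact key

lemma not_dvd_small (p a b : ℕ) (hp : p.Prime) (h : a < p) (hb : b ≤ a) : ¬ p ∣ Nat.choose a b := by
  intro hd
  have h1 : p ∣ a.factorial := by
    rw [← Nat.choose_mul_factorial_mul_factorial hb]
    exact Dvd.dvd.mul_right (Dvd.dvd.mul_right hd _) _
  rw [hp.dvd_factorial] at h1
  omega

lemma nonvanish (p N a n : ℕ) (hp : p.Prime) (h2 : p % 2 = 1) (hN : a < N)
    (h : ∀ m, 2 * (a * p ^ m % N) < N) : ¬ p ∣ A p N a n := by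
  induction n with
  | zero => simp [A, Nat.div_eq_of_lt hN, hp.one_lt.ne']
  | succ n ih =>
    rw [(lucas_step p N a n hp h2 (by omega)).dvd_iff dvd_rfl, hp.dvd_mul, not_or]
    refine ⟨not_dvd_small _ _ _ hp (by have := hp.pos; omega) ?_, ih⟩
    have := h n
    have hpos := hp.pos
    rw [← Nat.lt_succ_iff, Nat.div_lt_iff_lt_mul (by omega)]
    obtain ⟨h, hh⟩ : ∃ h, p = 2 * h + 1 := ⟨p / 2, by omega⟩
    have e3 : (p - 1) / 2 = h := by omega
    rw [e3]
    generalize a * p ^ n % N = r at *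
    subst hh
    simp only [Nat.succ_eq_add_one]
    nlinarith

lemma vanish (p N a n m : ℕ) (hp : p.Prime) (h2 : p % 2 = 1) (hN : 0 < N) (hm : m < n)
    (h : N * (p + 1) ≤ 2 * p * (a * p ^ m % N)) : p ∣ A p N a n := by
  induction n with
  | zero => omega
  | succ n ih =>
    rw [(lucas_step p N a n hp h2 hN).dvd_iff dvd_rfl]
    by_cases hmn : m < n
    · exact Dvd.dvd.mul_left (ih hmn) _
    · have : m = n := by omega
      subst this
      rw [Nat.choose_eq_zero_of_lt]
      · simp
      · have hpos := hp.pos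
        rw [Nat.lt_iff_add_one_le, Nat.le_div_iff_mul_le hN]
        obtain ⟨h, hh⟩ : ∃ h, p = 2 * h + 1 := ⟨p / 2, by omega⟩
        have e3 : (p - 1) / 2 = h := by omega
        rw [e3]
        generalize a * p ^ m % N = r at *
        subst hh
        nlinarith

/-- orbit statement -/
lemma orbit (p N a : ℕ) (s : ℕ → Prop) (h0 : s (a % N))
    (h : ∀ r, s r → s (r * (p % N) % N)) : ∀ m, s (a * p ^ m % N) := by
  intro m
  induction m with
  | zero => simpa using h0
  | succ m ih =>
    have := h _ ih
    rwa [← Nat.mul_mod, mul_assoc, ← pow_succ] at this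

/-- the classes treated when `Q % 60 = 1` -/
lemma exists_bad (p n : ℕ) (hp : p.Prime) (hcop : Nat.gcd p 30 = 1)
    (h1 : p % 60 ≠ 31) (h2 : p % 60 ≠ 59) :
    ∃ a, a < 30 ∧ a % 2 = 1 ∧ a ≠ 15 ∧ ¬ p ∣ A p 60 a n := by
  have c2 : p % 2 = 1 := by
    by_contra h
    have : 2 ∣ Nat.gcd p 30 := Nat.dvd_gcd (by omega) (by norm_num)
    omega
  have c3 : p % 3 ≠ 0 := by
    intro h
    have : 3 ∣ Nat.gcd p 30 := Nat.dvd_gcd (by omega) (by norm_num)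
    omega
  have c5 : p % 5 ≠ 0 := by
    intro h
    have : 5 ∣ Nat.gcd p 30 := Nat.dvd_gcd (by omega) (by norm_num)
    omega
  by_cases c4 : p % 4 = 1
  · refine ⟨5, by norm_num, by norm_num, by norm_num, nonvanish _ _ _ _ hp c2 (by norm_num) ?_⟩
    intro m
    have := orbit p 60 5 (fun r => r = 5 ∨ r = 25) (by norm_num) (by
      rintro r (rfl | rfl) <;> omega) m
    omega
  · by_cases c20 : p % 20 = 3 ∨ p % 20 = 7
    · refine ⟨3, by norm_num, by norm_num, by norm_num, nonvanish _ _ _ _ hp c2 (by norm_num) ?_⟩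
      intro m
      have := orbit p 60 3 (fun r => r = 3 ∨ r = 9 ∨ r = 21 ∨ r = 27) (by norm_num) (by
        rintro r (rfl | rfl | rfl | rfl) <;> omega) m
      omega
    · refine ⟨1, by norm_num, by norm_num, by norm_num, nonvanish _ _ _ _ hp c2 (by norm_num) ?_⟩
      intro m
      have c60 : p % 60 = 11 ∨ p % 60 = 19 := by
        have a1 : p % 60 % 4 = 3 := by omega
        have a2 : p % 60 % 3 ≠ 0 := by omega
        have a3 : p % 60 % 5 ≠ 0 := by omega
        have a4 : ¬ (p % 60 % 20 = 3 ∨ p % 60 % 20 = 7) := by omega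
        have a5 : p % 60 < 60 := by omega
        generalize p % 60 = r at *
        interval_cases r <;> omega
      have := orbit p 60 1 (fun r => r = 1 ∨ (r = 11 ∧ p % 60 = 11) ∨ (r = 19 ∧ p % 60 = 19))
        (by norm_num) (by
        rintro r (rfl | ⟨rfl, h⟩ | ⟨rfl, h⟩) <;> omega) m
      omega

/-- the swap -/
lemma A_swap (p k : ℕ) (hp : p.Prime) (h : p % 20 = 3 ∨ p % 20 = 7) :
    A p 20 1 (2 * k) ≡ A p 20 3 (2 * k) [MOD p] := by
  have c2 : p % 2 = 1 := by omega
  have s1 : Nat.choose ((p - 1) / 2) (p * 1 / 20) = Nat.choose ((p - 1) / 2) (p * 9 / 20) := by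
    apply Nat.choose_symm_of_eq_add; omega
  have s3 : Nat.choose ((p - 1) / 2) (p * 3 / 20) = Nat.choose ((p - 1) / 2) (p * 7 / 20) := by
    apply Nat.choose_symm_of_eq_add; omega
  have hsq : p ^ 2 % 20 = 9 := by
    rw [pow_two, Nat.mul_mod]; rcases h with h | h <;> rw [h]
  have h2k : p ^ (2 * k) % 20 = 1 ∨ p ^ (2 * k) % 20 = 9 := by
    have := orbit (p ^ 2) 20 1 (fun r => r = 1 ∨ r = 9) (by norm_num)
      (by rw [hsq]; rintro r (rfl | rfl) <;> omega) k
    rwa [one_mul, ← pow_mul] at this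
  induction k with
  | zero => simp [A, Nat.ModEq]
  | succ k ih =>
    have h2k' : p ^ (2 * k) % 20 = 1 ∨ p ^ (2 * k) % 20 = 9 := by
      have := orbit (p ^ 2) 20 1 (fun r => r = 1 ∨ r = 9) (by norm_num)
        (by rw [hsq]; rintro r (rfl | rfl) <;> omega) k
      rwa [one_mul, ← pow_mul] at this
    have ih := ih h2k'
    have f (a : ℕ) : A p 20 a (2 * (k + 1)) ≡
      Nat.choose ((p - 1) / 2) (p * (a * p ^ (2 * k + 1) % 20) / 20) *
      (Nat.choose ((p - 1) / 2) (p * (a * p ^ (2 * k) % 20) / 20) * A p 20 a (2 * k)) [MOD p] := by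
      refine (lucas_step p 20 a (2 * k + 1) hp c2 (by norm_num)).trans ?_
      exact Nat.ModEq.mul_left _ (lucas_step p 20 a (2 * k) hp c2 (by norm_num))
    refine (f 1).trans (Nat.ModEq.trans ?_ (f 3).symm)
    have hs : p ^ (2 * k + 1) % 20 = (p ^ (2 * k) % 20) * (p % 20) % 20 := by
      rw [pow_succ, Nat.mul_mod]
    rw [← mul_assoc, ← mul_assoc]
    refine Nat.ModEq.mul ?_ ih
    have g1 : 1 * p ^ (2 * k + 1) % 20 = (p ^ (2 * k) % 20) * (p % 20) % 20 := by rw [one_mul, hs]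
    have g2 : 3 * p ^ (2 * k + 1) % 20 = 3 * ((p ^ (2 * k) % 20) * (p % 20)) % 20 := by
      rw [← Nat.mul_mod_mod, hs, Nat.mul_mod_mod]
    have g3 : 1 * p ^ (2 * k) % 20 = (p ^ (2 * k) % 20) := by rw [one_mul]
    have g4 : 3 * p ^ (2 * k) % 20 = 3 * (p ^ (2 * k) % 20) % 20 := by
      rw [Nat.mul_mod_mod]
    rw [g1, g2, g3, g4]
    rcases h2k' with e | e <;> rcases h with h | h <;> rw [e, h] <;> norm_num only <;>
      simp only [s1, s3, mul_comm] <;> rfl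

/-- the classes treated when `Q % 20 = 9` -/
lemma comb_ne (p k : ℕ) (hp : p.Prime) (hcop : Nat.gcd p 30 = 1) (hk : 1 ≤ k)
    (h5 : p % 5 = 2 ∨ p % 5 = 3) :
    ¬ (p : ℤ) ∣ (A p 20 1 (2 * k) : ℤ) + A p 20 3 (2 * k) - A p 12 1 (2 * k) := by
  have c2 : p % 2 = 1 := by
    by_contra h
    have : 2 ∣ Nat.gcd p 30 := Nat.dvd_gcd (by omega) (by norm_num)
    omega
  have c3 : p % 3 ≠ 0 := by
    intro h
    have : 3 ∣ Nat.gcd p 30 := Nat.dvd_gcd (by omega) (by norm_num)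
    omega
  have hpp : Prime (p : ℤ) := Nat.prime_iff_prime_int.1 hp
  by_cases c4 : p % 4 = 1
  · have v1 : p ∣ A p 20 1 (2 * k) := by
      refine vanish p 20 1 (2 * k) 1 hp c2 (by norm_num) (by omega) ?_
      have : 11 ≤ 1 * p ^ 1 % 20 := by rw [pow_one]; omega
      have : 13 ≤ p := by omega
      nlinarith
    have v3 : p ∣ A p 20 3 (2 * k) := by
      refine vanish p 20 3 (2 * k) 1 hp c2 (by norm_num) (by omega) ?_
      have : 11 ≤ 3 * p ^ 1 % 20 := by rw [pow_one]; omega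
      have : 13 ≤ p := by omega
      nlinarith
    have v5 : ¬ p ∣ A p 12 1 (2 * k) := by
      refine nonvanish _ _ _ _ hp c2 (by norm_num) ?_
      intro m
      have := orbit p 12 1 (fun r => r = 1 ∨ r = 5) (by norm_num) (by
        rintro r (rfl | rfl) <;> omega) m
      omega
    intro h
    apply v5
    zify at v1 v3 ⊢
    have := dvd_sub (dvd_add v1 v3) h
    simpa using this
  · have v5 : p ∣ A p 12 1 (2 * k) := by
      refine vanish p 12 1 (2 * k) 1 hp c2 (by norm_num) (by omega) ?_
      have : 7 ≤ 1 * p ^ 1 % 12 := by rw [pow_one]; omega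
      have : 7 ≤ p := by omega
      nlinarith
    have v1 : ¬ p ∣ A p 20 1 (2 * k) := by
      refine nonvanish _ _ _ _ hp c2 (by norm_num) ?_
      intro m
      have := orbit p 20 1 (fun r => r = 1 ∨ r = 3 ∨ r = 7 ∨ r = 9) (by norm_num) (by
        rintro r (rfl | rfl | rfl | rfl) <;> omega) m
      omega
    have sw := A_swap p k hp (by omega)
    rw [← Int.natCast_modEq_iff] at sw
    have sw := sw.dvd
    intro h
    zify at v5 v1
    have h2 : (p : ℤ) ∣ 2 * A p 20 1 (2 * k) := by
      have := dvd_sub (dvd_add h v5) sw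
      have e : (2 : ℤ) * A p 20 1 (2 * k) = (A p 20 1 (2 * k) : ℤ) + A p 20 3 (2 * k)
        - A p 12 1 (2 * k) + A p 12 1 (2 * k) - (A p 20 3 (2 * k) - A p 20 1 (2 * k)) := by ring
      rw [e]; exact this
    rcases hpp.dvd_or_dvd h2 with h2 | h2
    · have := Int.le_of_dvd (by norm_num) h2
      omega
    · exact v1 h2

end Cheb

namespace Cheb

section TwoSum
variable {F : Type} [Field F] [Fintype F] {K : Type} [Field K] [Algebra F K]

lemma mem_range_of_pow (y : K) (hy : y ^ Fintype.card F = y) : ∃ x : F, algebraMap F K x = y := by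
  classical
  by_contra hcon
  push Not at hcon
  have hQ1 : 1 < Fintype.card F := Fintype.one_lt_card
  have hdeg : (X ^ Fintype.card F - X : K[X]).natDegree = Fintype.card F :=
    FiniteField.X_pow_card_sub_X_natDegree_eq K hQ1
  have hne : (X ^ Fintype.card F - X : K[X]) ≠ 0 := FiniteField.X_pow_card_sub_X_ne_zero K hQ1
  have hsub : (insert y (Finset.univ.image (algebraMap F K))).val ⊆
      (X ^ Fintype.card F - X : K[X]).roots := by
    intro z hz
    rw [Finset.mem_val, Finset.mem_insert, Finset.mem_image] at hz
    rw [mem_roots hne]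
    rcases hz with rfl | ⟨x, _, rfl⟩
    · simp [hy]
    · simp [← map_pow, FiniteField.pow_card]
  have := card_le_degree_of_subset_roots hsub
  rw [hdeg, Finset.card_insert_of_notMem (by simpa using hcon),
    Finset.card_image_of_injective _ (algebraMap F K).injective, Finset.card_univ] at this
  omega

lemma frob_add (a b : K) : (a + b) ^ Fintype.card F = a ^ Fintype.card F + b ^ Fintype.card F :=
  map_add (FiniteField.frobeniusAlgHom F K) a b

lemma fiber_sum [DecidableEq K] {R : Type} [CommRing R] (f : K → R) (s : Finset K)
    (hs : ∀ t ∈ s, (t + t⁻¹) ^ Fintype.card F = t + t⁻¹) :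
    ∑ t ∈ s, f (t + t⁻¹) =
      ∑ x : F, ((s.filter (fun t => t + t⁻¹ = algebraMap F K x)).card : R) * f (algebraMap F K x) := by
  have h1 : ∀ t ∈ s, f (t + t⁻¹) =
      ∑ x : F, if t + t⁻¹ = algebraMap F K x then f (algebraMap F K x) else 0 := by
    intro t ht
    obtain ⟨x, hx⟩ := mem_range_of_pow (F := F) _ (hs t ht)
    rw [Finset.sum_eq_single x]
    · simp [hx]
    · intro y _ hy
      rw [if_neg]
      rw [← hx]
      intro h
      exact hy ((algebraMap F K).injective h).symm
    · simp
  rw [Finset.sum_congr rfl h1, Finset.sum_comm]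
  refine Finset.sum_congr rfl fun x _ => ?_
  rw [← Finset.sum_filter, Finset.sum_const, nsmul_eq_mul]

lemma two_sum [IsAlgClosed K] [DecidableEq K] {R : Type} [CommRing R] (f : K → R) :
    ∑ t ∈ nthRootsFinset (Fintype.card F - 1) (1 : K), f (t + t⁻¹) +
      ∑ t ∈ nthRootsFinset (Fintype.card F + 1) (1 : K), f (t + t⁻¹) =
      2 * ∑ x : F, f (algebraMap F K x) := by
  have hQ1 : 1 < Fintype.card F := Fintype.one_lt_card
  have memA : ∀ t : K, t ∈ nthRootsFinset (Fintype.card F - 1) (1 : K) ↔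
      t ≠ 0 ∧ t ^ Fintype.card F = t := by
    intro t
    rw [mem_nthRootsFinset (by omega)]
    obtain ⟨m, hm⟩ : ∃ m, Fintype.card F = m + 1 := ⟨Fintype.card F - 1, by omega⟩
    have hm0 : m ≠ 0 := by omega
    rw [hm]
    simp only [Nat.add_sub_cancel]
    constructor
    · intro h
      refine ⟨?_, by rw [pow_succ, h, one_mul]⟩
      rintro rfl
      simp [hm0] at h
    · rintro ⟨h0, h⟩
      rw [pow_succ] at h
      exact mul_right_cancel₀ h0 (by rw [h, one_mul])
  have memU : ∀ t : K, t ∈ nthRootsFinset (Fintype.card F + 1) (1 : K) ↔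
      t ≠ 0 ∧ t ^ Fintype.card F = t⁻¹ := by
    intro t
    rw [mem_nthRootsFinset (by omega), pow_succ]
    constructor
    · intro h
      have h0 : t ≠ 0 := by
        rintro rfl
        simp at h
      exact ⟨h0, eq_inv_of_mul_eq_one_left h⟩
    · rintro ⟨h0, h⟩
      rw [h, inv_mul_cancel₀ h0]
  rw [fiber_sum (F := F), fiber_sum (F := F), ← Finset.sum_add_distrib, Finset.mul_sum]
  · refine Finset.sum_congr rfl fun x _ => ?_
    rw [← add_mul]
    congr 1
    -- find a root
    obtain ⟨t, ht⟩ : ∃ t : K, t * t - algebraMap F K x * t + 1 = 0 := by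
      obtain ⟨t, ht⟩ := IsAlgClosed.exists_root (X ^ 2 - C (algebraMap F K x) * X + C 1 : K[X])
        (by
          have : (X ^ 2 - C (algebraMap F K x) * X + C 1 : K[X]).degree = 2 := by compute_degree!
          rw [this]; norm_num)
      refine ⟨t, ?_⟩
      simpa [IsRoot, pow_two] using ht
    have ht0 : t ≠ 0 := by
      rintro rfl
      simp at ht
    have hx : t + t⁻¹ = algebraMap F K x := by
      field_simp
      linear_combination ht
    have hsol : ∀ s : K, s ≠ 0 → (s + s⁻¹ = algebraMap F K x ↔ s = t ∨ s = t⁻¹) := by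
      intro s hs
      rw [← hx]
      constructor
      · intro h
        have : (s - t) * (s - t⁻¹) = 0 := by
          field_simp at h ⊢
          linear_combination h
        rcases mul_eq_zero.1 this with h | h
        · left; exact sub_eq_zero.1 h
        · right; exact sub_eq_zero.1 h
      · rintro (rfl | rfl)
        · rfl
        · rw [inv_inv, add_comm]
    have hfr : t ^ Fintype.card F = t ∨ t ^ Fintype.card F = t⁻¹ := by
      rw [← hsol _ (pow_ne_zero _ ht0), ← inv_pow, ← frob_add, hx, ← map_pow, FiniteField.pow_card]
    have fA : (nthRootsFinset (Fintype.card F - 1) (1 : K)).filter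
        (fun t => t + t⁻¹ = algebraMap F K x) = ({t, t⁻¹} : Finset K).filter
        (fun t => t ^ Fintype.card F = t) := by
      ext s
      simp only [Finset.mem_filter, memA, Finset.mem_insert, Finset.mem_singleton]
      constructor
      · rintro ⟨⟨h0, h1⟩, h2⟩
        exact ⟨(hsol s h0).1 h2, h1⟩
      · rintro ⟨h1, h2⟩
        have h0 : s ≠ 0 := by
          rcases h1 with rfl | rfl
          · exact ht0
          · exact inv_ne_zero ht0
        exact ⟨⟨h0, h2⟩, (hsol s h0).2 h1⟩
    have fU : (nthRootsFinset (Fintype.card F + 1) (1 : K)).filter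
        (fun t => t + t⁻¹ = algebraMap F K x) = ({t, t⁻¹} : Finset K).filter
        (fun t => t ^ Fintype.card F = t⁻¹) := by
      ext s
      simp only [Finset.mem_filter, memU, Finset.mem_insert, Finset.mem_singleton]
      constructor
      · rintro ⟨⟨h0, h1⟩, h2⟩
        exact ⟨(hsol s h0).1 h2, h1⟩
      · rintro ⟨h1, h2⟩
        have h0 : s ≠ 0 := by
          rcases h1 with rfl | rfl
          · exact ht0
          · exact inv_ne_zero ht0
        exact ⟨⟨h0, h2⟩, (hsol s h0).2 h1⟩
    rw [fA, fU]
    by_cases htt : t = t⁻¹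
    · have h1 : t ^ Fintype.card F = t := by
        rcases hfr with h | h
        · exact h
        · rw [h, ← htt]
      have : ({t, t⁻¹} : Finset K) = {t} := by rw [← htt]; simp
      rw [this, Finset.filter_singleton, Finset.filter_singleton, if_pos h1, if_pos (h1.trans htt)]
      simp; norm_num
    · rcases hfr with h | h
      · rw [Finset.filter_true_of_mem, Finset.filter_false_of_mem]
        · rw [Finset.card_pair htt]; simp
        · intro s hs
          simp only [Finset.mem_insert, Finset.mem_singleton] at hs
          rcases hs with rfl | rfl
          · rw [h]; exact htt
          · rw [inv_pow, h, inv_inv]; exact fun h => htt h.symm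
        · intro s hs
          simp only [Finset.mem_insert, Finset.mem_singleton] at hs
          rcases hs with rfl | rfl
          · exact h
          · rw [inv_pow, h]
      · rw [Finset.filter_false_of_mem, Finset.filter_true_of_mem]
        · rw [Finset.card_pair htt]; simp
        · intro s hs
          simp only [Finset.mem_insert, Finset.mem_singleton] at hs
          rcases hs with rfl | rfl
          · exact h
          · rw [inv_pow, h]
        · intro s hs
          simp only [Finset.mem_insert, Finset.mem_singleton] at hs
          rcases hs with rfl | rfl
          · rw [h]; exact fun h => htt h.symm
          · rw [inv_pow, h, inv_inv]; exact htt
  · intro t ht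
    obtain ⟨h0, h⟩ := (memU t).1 ht
    rw [frob_add, inv_pow, h, inv_inv, add_comm]
  · intro t ht
    obtain ⟨h0, h⟩ := (memA t).1 ht
    rw [frob_add, inv_pow, h]

lemma root_sum [IsAlgClosed K] (N e : ℕ) (hN : (N : K) ≠ 0) :
    ∑ t ∈ nthRootsFinset N (1 : K), t ^ e = if N ∣ e then (N : K) else 0 := by
  have : NeZero (N : K) := ⟨hN⟩
  have hN0 : 0 < N := Nat.pos_of_ne_zero (by rintro rfl; simp at hN)
  obtain ⟨z, hz⟩ := HasEnoughRootsOfUnity.exists_primitiveRoot K N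
  split_ifs with h
  · obtain ⟨c, rfl⟩ := h
    have : ∀ t ∈ nthRootsFinset N (1 : K), t ^ (N * c) = 1 := by
      intro t ht
      rw [mem_nthRootsFinset hN0] at ht
      rw [pow_mul, ht, one_pow]
    rw [Finset.sum_congr rfl this, Finset.sum_const, hz.card_nthRootsFinset]
    simp
  · have hze : z ^ e ≠ 1 := fun h' => h ((hz.pow_eq_one_iff_dvd e).1 h')
    have hz0 : z ≠ 0 := hz.ne_zero hN0.ne'
    have : ∑ t ∈ nthRootsFinset N (1 : K), t ^ e = ∑ t ∈ nthRootsFinset N (1 : K), (z * t) ^ e := by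
      symm
      refine Finset.sum_bij' (fun t _ => z * t) (fun t _ => z⁻¹ * t) ?_ ?_ ?_ ?_ ?_
      · intro t ht
        rw [mem_nthRootsFinset hN0] at ht ⊢
        rw [mul_pow, ht, hz.pow_eq_one, one_mul]
      · intro t ht
        rw [mem_nthRootsFinset hN0] at ht ⊢
        rw [mul_pow, ht, inv_pow, hz.pow_eq_one, inv_one, one_mul]
      · intro t _; field_simp
      · intro t _; field_simp
      · intro t _; rfl
    simp_rw [mul_pow] at this
    rw [← Finset.mul_sum] at this
    have h2 : (z ^ e - 1) * ∑ t ∈ nthRootsFinset N (1 : K), t ^ e = 0 := by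
      rw [sub_mul, one_mul, ← this, sub_self]
    exact (mul_eq_zero.1 h2).resolve_left (sub_ne_zero.2 hze)

end TwoSum
end Cheb


namespace Cheb
section ModP

lemma expand_term {K : Type} [Field K] (t : K) (M E : ℕ) (ht : t ≠ 0) (h : t ^ E * t ^ (15 * M) = 1) :
    (t ^ 15 + t⁻¹ ^ 15) ^ M = ∑ i ∈ Finset.range (M + 1), t ^ (E + 30 * i) * (M.choose i : K) := by
  have h1 : (t ^ 15 + t⁻¹ ^ 15) = t⁻¹ ^ 15 * (t ^ 30 + 1) := by
    field_simp
  have h2 : (t⁻¹ ^ 15) ^ M = t ^ E := by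
    rw [← pow_mul, inv_pow]
    exact (eq_inv_of_mul_eq_one_left h).symm
  rw [h1, mul_pow, h2, add_pow, Finset.mul_sum]
  refine Finset.sum_congr rfl fun i _ => ?_
  rw [one_pow, mul_one, pow_add, pow_mul]
  ring

lemma root_total {K : Type} [Field K] [IsAlgClosed K] (N M E : ℕ) (hN : (N : K) ≠ 0)
    (hE : N ∣ E + 15 * M) :
    ∑ t ∈ nthRootsFinset N (1 : K), (t ^ 15 + t⁻¹ ^ 15) ^ M =
      (N : K) * ∑ i ∈ (Finset.range (M + 1)).filter (fun i => N ∣ E + 30 * i), (M.choose i : K) := by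
  have hN0 : 0 < N := Nat.pos_of_ne_zero (by rintro rfl; simp at hN)
  have h1 : ∀ t ∈ nthRootsFinset N (1 : K), (t ^ 15 + t⁻¹ ^ 15) ^ M =
      ∑ i ∈ Finset.range (M + 1), t ^ (E + 30 * i) * (M.choose i : K) := by
    intro t ht
    rw [mem_nthRootsFinset hN0] at ht
    apply expand_term
    · rintro rfl
      simp [hN0.ne'] at ht
    · obtain ⟨c, hc⟩ := hE
      rw [← pow_add, hc, pow_mul, ht, one_pow]
  rw [Finset.sum_congr rfl h1, Finset.sum_comm, Finset.sum_filter, Finset.mul_sum]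
  refine Finset.sum_congr rfl fun i _ => ?_
  rw [← Finset.sum_mul, root_sum N _ hN]
  split_ifs <;> simp

lemma filter_A (c : ℕ) (h5 : c % 5 ≠ 0) :
    (Finset.range (6 * c + 1)).filter (fun i => 12 * c ∣ 15 * (6 * c) + 30 * i) =
      {c, 3 * c, 5 * c} := by
  have hc : 0 < c := by omega
  ext i
  simp only [Finset.mem_filter, Finset.mem_range, Finset.mem_insert, Finset.mem_singleton]
  constructor
  · rintro ⟨hi, e, he⟩
    have e1 : 15 * c + 5 * i = 2 * (c * e) := by nlinarith
    have l1 : 15 ≤ 2 * e := by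
      by_contra h
      have : 2 * (c * e) < 15 * c := by nlinarith
      omega
    have l2 : 2 * e ≤ 45 := by
      by_contra h
      have : 45 * c < 2 * (c * e) := by nlinarith
      omega
    have h5e : 5 ∣ e := by
      have : 5 ∣ c * e := by omega
      rcases (Nat.Prime.dvd_mul (by norm_num)).1 this with h | h
      · omega
      · exact h
    obtain ⟨f, rfl⟩ := h5e
    have : f = 2 ∨ f = 3 ∨ f = 4 := by omega
    rcases this with rfl | rfl | rfl <;> omega
  · rintro (rfl | rfl | rfl)
    · exact ⟨by omega, 10, by ring⟩
    · exact ⟨by omega, 15, by ring⟩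
    · exact ⟨by omega, 20, by ring⟩

lemma filter_U (l : ℕ) (h3 : (2 * l + 1) % 3 ≠ 0) :
    (Finset.range (10 * l + 4 + 1)).filter
      (fun i => 20 * l + 10 ∣ 15 * (10 * l + 4 + 2) + 30 * i) =
      {l, 3 * l + 1, 5 * l + 2, 7 * l + 3, 9 * l + 4} := by
  ext i
  simp only [Finset.mem_filter, Finset.mem_range, Finset.mem_insert, Finset.mem_singleton]
  constructor
  · rintro ⟨hi, e, he⟩
    have e1 : 15 * (2 * l + 1) + 3 * (2 * i + 1) = 2 * ((2 * l + 1) * e) := by nlinarith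
    have h1 : (2 * l + 1) ∣ 3 * (2 * i + 1) := by
      have : (2 * l + 1) ∣ 15 * (2 * l + 1) + 3 * (2 * i + 1) := by
        rw [e1]; exact ⟨2 * e, by ring⟩
      exact (Nat.dvd_add_right (Dvd.intro_left _ rfl)).1 this
    have h2 : (2 * l + 1) ∣ (2 * i + 1) := by
      refine Nat.Coprime.dvd_of_dvd_mul_left ?_ h1
      rw [Nat.coprime_comm, Nat.Prime.coprime_iff_not_dvd (by norm_num)]
      omega
    obtain ⟨f, hf⟩ := h2
    have l2 : f < 10 := by
      by_contra h
      have : (2 * l + 1) * 10 ≤ (2 * l + 1) * f := Nat.mul_le_mul_left _ (by omega)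
      omega
    interval_cases f <;> omega
  · rintro (rfl | rfl | rfl | rfl | rfl)
    · exact ⟨by omega, 9, by ring⟩
    · exact ⟨by omega, 12, by ring⟩
    · exact ⟨by omega, 15, by ring⟩
    · exact ⟨by omega, 18, by ring⟩
    · exact ⟨by omega, 21, by ring⟩

lemma S_modp (F : Type) [Field F] [Fintype F] [DecidableEq F] (p n : ℕ) [CharP F p] (hF2 : ringChar F ≠ 2)
    (hQ : Fintype.card F = p ^ n) (h20 : p ^ n % 20 = 9) (h12 : p ^ n % 12 = 1) :
    (((∑ x : F, quadraticChar F ((dickson 1 (1 : F) 15).eval x)) : ℤ) : F) =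
      (((A p 20 1 n : ℤ) + A p 20 3 n - A p 12 1 n : ℤ) : F) := by
  classical
  let K := AlgebraicClosure F
  obtain ⟨l, hl⟩ : ∃ l, p ^ n = 20 * l + 9 := ⟨p ^ n / 20, by omega⟩
  obtain ⟨c, hc⟩ : ∃ c, p ^ n = 12 * c + 1 := ⟨p ^ n / 12, by omega⟩
  have hM1 : p ^ n / 2 = 6 * c := by omega
  have hM2 : p ^ n / 2 = 10 * l + 4 := by omega
  have a1 : A p 20 1 n = (10 * l + 4).choose l := by
    unfold A; congr 1 <;> omega
  have a3 : A p 20 3 n = (10 * l + 4).choose (3 * l + 1) := by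
    unfold A; congr 1 <;> omega
  have a5 : A p 12 1 n = (6 * c).choose c := by
    unfold A; congr 1 <;> omega
  have hQ0 : ((p ^ n : ℕ) : K) = 0 := by
    rw [← hQ, ← map_natCast (algebraMap F K)]
    simp
  have hm : ((p ^ n - 1 : ℕ) : K) = -1 := by
    rw [Nat.cast_sub (by omega), hQ0]; simp
  have hp : ((p ^ n + 1 : ℕ) : K) = 1 := by
    rw [Nat.cast_add, hQ0]; simp
  have key := two_sum (F := F) (K := K) (fun y => ((dickson 1 (1 : K) 15).eval y) ^ (p ^ n / 2))
  have ev : ∀ N : ℕ, 0 < N → ∑ t ∈ nthRootsFinset N (1 : K),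
      ((dickson 1 (1 : K) 15).eval (t + t⁻¹)) ^ (p ^ n / 2) =
      ∑ t ∈ nthRootsFinset N (1 : K), (t ^ 15 + t⁻¹ ^ 15) ^ (p ^ n / 2) := by
    intro N hN
    refine Finset.sum_congr rfl fun t ht => ?_
    rw [mem_nthRootsFinset hN] at ht
    rw [dickson_one_one_eval_add_inv t t⁻¹]
    apply mul_inv_cancel₀
    rintro rfl
    simp [hN.ne'] at ht
  rw [hQ, ev _ (by omega), ev _ (by omega)] at key
  rw [root_total (p ^ n - 1) (p ^ n / 2) (15 * (p ^ n / 2)) (by rw [hm]; simp)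
    ⟨15, by omega⟩, root_total (p ^ n + 1) (p ^ n / 2) (15 * (p ^ n / 2 + 2)) (by rw [hp]; simp)
    ⟨15, by omega⟩, hm, hp] at key
  have f1 := filter_A c (by omega)
  have f2 := filter_U l (by omega)
  have g1 : p ^ n - 1 = 12 * c := by omega
  have g2 : p ^ n + 1 = 20 * l + 10 := by omega
  rw [g1, g2] at key
  nth_rw 1 2 3 [hM1] at key
  rw [f1] at key
  rw [hM2, f2] at key
  have hS : (algebraMap F K) (((∑ x : F, quadraticChar F ((dickson 1 (1 : F) 15).eval x)) : ℤ) : F) =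
      ∑ x : F, ((dickson 1 (1 : K) 15).eval (algebraMap F K x)) ^ (10 * l + 4) := by
    rw [Int.cast_sum, map_sum]
    refine Finset.sum_congr rfl fun x _ => ?_
    rw [quadraticChar_eq_pow_of_char_ne_two' hF2, hQ, hM2, map_pow]
    congr 1
    rw [← map_one (algebraMap F K), ← map_dickson, eval_map_algebraMap, aeval_algebraMap_apply,
      coe_aeval_eq_eval]
  have h2 : (2 : K) ≠ 0 := by
    rw [← map_ofNat (algebraMap F K) 2, Ne, map_eq_zero]
    exact Ring.two_ne_zero hF2
  apply (algebraMap F K).injective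
  apply mul_left_cancel₀ h2
  rw [hS, ← key, a1, a3, a5]
  have hcl : 6 * c = 10 * l + 4 := by omega
  have s1 : (10 * l + 4).choose (5 * c) = (10 * l + 4).choose c :=
    Nat.choose_symm_of_eq_add (by omega)
  have s2 : (10 * l + 4).choose (7 * l + 3) = (10 * l + 4).choose (3 * l + 1) :=
    Nat.choose_symm_of_eq_add (by omega)
  have s3 : (10 * l + 4).choose (9 * l + 4) = (10 * l + 4).choose l :=
    Nat.choose_symm_of_eq_add (by omega)
  have s4 : 3 * c = 5 * l + 2 := by omega
  rw [Finset.sum_insert, Finset.sum_insert, Finset.sum_singleton, Finset.sum_insert,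
    Finset.sum_insert, Finset.sum_insert, Finset.sum_insert, Finset.sum_singleton]
  · rw [hcl, s1, s2, s3, s4]
    push_cast
    ring
  all_goals simp only [Finset.mem_insert, Finset.mem_singleton]; omega

end ModP
end Cheb


namespace Cheb
section CharSum
variable (F : Type) [Field F] [Fintype F] [DecidableEq F]

/-- the character sum attached to the curve -/
noncomputable def Ssum (d : ℕ) : ℤ := ∑ x : F, quadraticChar F ((dickson 1 (1 : F) d).eval x)

/-- the split torus sum -/
noncomputable def Tsum (d : ℕ) : ℤ := ∑ t : F, quadraticChar F t * quadraticChar F (1 + t ^ (2 * d))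

lemma count_eq (hF2 : ringChar F ≠ 2) (d : ℕ) :
    (chebAffineCount F d : ℤ) = Fintype.card F + Ssum F d := by
  classical
  unfold chebAffineCount Ssum
  rw [Nat.card_eq_fintype_card, Fintype.card_subtype]
  have : (Finset.univ.filter (fun xy : F × F => xy.2 ^ 2 = (dickson 1 (1 : F) d).eval xy.1)).card =
      ∑ x : F, (Finset.univ.filter (fun y : F => y ^ 2 = (dickson 1 (1 : F) d).eval x)).card := by
    simp_rw [Finset.card_filter]
    rw [Fintype.sum_prod_type]
  rw [this, Nat.cast_sum]
  have h2 : ∀ x : F, (((Finset.univ.filter (fun y : F => y ^ 2 = (dickson 1 (1 : F) d).eval x)).card : ℕ) : ℤ) =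
      quadraticChar F ((dickson 1 (1 : F) d).eval x) + 1 := by
    intro x
    rw [← quadraticChar_card_sqrts hF2]
    congr 2
    ext y; simp
  rw [Finset.sum_congr rfl fun x _ => h2 x, Finset.sum_add_distrib]
  simp [add_comm]

lemma Ssum_one (hF2 : ringChar F ≠ 2) : Ssum F 1 = 0 := by
  unfold Ssum
  simp only [dickson_one, eval_X]
  exact quadraticChar_sum_zero hF2

variable {F}

lemma chi_term (d : ℕ) (hd : Odd d) (x : F) (hx : x ≠ 0) :
    quadraticChar F (x ^ d + x⁻¹ ^ d) = quadraticChar F x * quadraticChar F (1 + x ^ (2 * d)) := by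
  obtain ⟨e, rfl⟩ := hd
  have : x ^ (2 * e + 1) + x⁻¹ ^ (2 * e + 1) = (x⁻¹ ^ (e + 1)) ^ 2 * (x * (1 + x ^ (2 * (2 * e + 1)))) := by
    have hi : x⁻¹ * x = 1 := inv_mul_cancel₀ hx
    have h1 : x⁻¹ ^ (2 * e) * x ^ (2 * e) = 1 := by rw [← mul_pow, hi, one_pow]
    have e1 : (x⁻¹ ^ (e + 1)) ^ 2 = x⁻¹ ^ (2 * e) * x⁻¹ * x⁻¹ := by ring
    have e2 : x⁻¹ ^ (2 * e + 1) = x⁻¹ ^ (2 * e) * x⁻¹ := by ring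
    have e3 : x ^ (2 * (2 * e + 1)) = x ^ (2 * e) * x ^ (2 * e) * x * x := by ring
    have e4 : x ^ (2 * e + 1) = x ^ (2 * e) * x := by ring
    rw [e1, e2, e3, e4]
    generalize x⁻¹ ^ (2 * e) = v at *
    generalize x ^ (2 * e) = u at *
    generalize x⁻¹ = w at *
    linear_combination (-(v * w) - u * x * (w * x + 1)) * hi - (u * x * w ^ 2 * x ^ 2) * h1
  rw [this, map_mul, quadraticChar_sq_one' (pow_ne_zero _ (inv_ne_zero hx)), one_mul, map_mul]

lemma S_eq_T (hF2 : ringChar F ≠ 2) (h60 : Fintype.card F % 60 = 1) :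
    2 * Ssum F 15 = Tsum F 15 - Tsum F 1 := by
  classical
  let K := AlgebraicClosure F
  let h : K → ℤ := Function.extend (algebraMap F K) (fun x => quadraticChar F x) 0
  have hh : ∀ x : F, h (algebraMap F K x) = quadraticChar F x := fun x =>
    (algebraMap F K).injective.extend_apply _ _ _
  have hQ1 : 1 < Fintype.card F := Fintype.one_lt_card
  have key : ∀ d : ℕ, Odd d → Tsum F d + ∑ t ∈ nthRootsFinset (Fintype.card F + 1) (1 : K),
      h (t ^ d + t⁻¹ ^ d) = 2 * Ssum F d := by
    intro d hd
    have key := two_sum (F := F) (K := K) (fun y => h ((dickson 1 (1 : K) d).eval y))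
    have ev : ∀ N : ℕ, 0 < N → ∑ t ∈ nthRootsFinset N (1 : K),
        h ((dickson 1 (1 : K) d).eval (t + t⁻¹)) =
        ∑ t ∈ nthRootsFinset N (1 : K), h (t ^ d + t⁻¹ ^ d) := by
      intro N hN
      refine Finset.sum_congr rfl fun t ht => ?_
      rw [mem_nthRootsFinset hN] at ht
      rw [dickson_one_one_eval_add_inv t t⁻¹]
      apply mul_inv_cancel₀
      rintro rfl
      simp [hN.ne'] at ht
    rw [ev _ (by omega), ev _ (by omega)] at key
    have e1 : ∑ x : F, h ((dickson 1 (1 : K) d).eval (algebraMap F K x)) = Ssum F d := by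
      unfold Ssum
      refine Finset.sum_congr rfl fun x _ => ?_
      rw [← hh]
      congr 1
      rw [← map_one (algebraMap F K), ← map_dickson, eval_map_algebraMap, aeval_algebraMap_apply,
        coe_aeval_eq_eval]
    have e2 : ∑ t ∈ nthRootsFinset (Fintype.card F - 1) (1 : K), h (t ^ d + t⁻¹ ^ d) = Tsum F d := by
      unfold Tsum
      rw [← Finset.sum_erase Finset.univ (a := (0 : F)) (by simp)]
      symm
      refine Finset.sum_bij (fun x _ => algebraMap F K x) ?_ ?_ ?_ ?_
      · intro x hx
        rw [mem_nthRootsFinset (by omega), ← map_pow,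
          FiniteField.pow_card_sub_one_eq_one _ (Finset.ne_of_mem_erase hx), map_one]
      · intro x _ y _ hxy
        exact (algebraMap F K).injective hxy
      · intro t ht
        rw [mem_nthRootsFinset (by omega)] at ht
        obtain ⟨x, hx⟩ := mem_range_of_pow (F := F) t (by
          have : Fintype.card F = Fintype.card F - 1 + 1 := by omega
          rw [this, pow_succ, ht, one_mul])
        refine ⟨x, ?_, hx⟩
        rw [Finset.mem_erase]
        refine ⟨?_, Finset.mem_univ _⟩
        rintro rfl
        rw [← hx, map_zero, zero_pow (by omega)] at ht
        exact zero_ne_one ht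
      · intro x hx
        rw [← chi_term d hd x (Finset.ne_of_mem_erase hx), ← hh]
        simp
    rw [e1, e2] at key
    exact key
  have k15 := key 15 (by decide)
  have k1 := key 1 (by decide)
  rw [Ssum_one F hF2] at k1
  obtain ⟨e, he⟩ : ∃ e, Fintype.card F + 1 = 60 * e + 2 := ⟨Fintype.card F / 60, by omega⟩
  have e3 : ∑ t ∈ nthRootsFinset (Fintype.card F + 1) (1 : K), h (t ^ 15 + t⁻¹ ^ 15) =
      ∑ t ∈ nthRootsFinset (Fintype.card F + 1) (1 : K), h (t ^ 1 + t⁻¹ ^ 1) := by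
    have hinv : ∀ t ∈ nthRootsFinset (Fintype.card F + 1) (1 : K), t ^ (15 * (28 * e + 1)) = t := by
      intro t ht
      rw [mem_nthRootsFinset (by omega)] at ht
      have : 15 * (28 * e + 1) = (Fintype.card F + 1) * 7 + 1 := by rw [he]; ring
      rw [this, pow_succ, pow_mul, ht, one_pow, one_mul]
    refine Finset.sum_bij' (fun t _ => t ^ 15) (fun t _ => t ^ (28 * e + 1)) ?_ ?_ ?_ ?_ ?_
    · intro t ht
      rw [mem_nthRootsFinset (by omega)] at ht ⊢
      rw [← pow_mul, mul_comm, pow_mul, ht, one_pow]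
    · intro t ht
      rw [mem_nthRootsFinset (by omega)] at ht ⊢
      rw [← pow_mul, mul_comm, pow_mul, ht, one_pow]
    · intro t ht
      rw [← pow_mul, hinv t ht]
    · intro t ht
      rw [← pow_mul, mul_comm, hinv t ht]
    · intro t ht
      simp
  rw [e3] at k15
  linarith

end CharSum
end Cheb


namespace Cheb
section JSum
variable {F : Type} [Field F] [Fintype F] [DecidableEq F]

/-- the complex quadratic character -/
noncomputable def chi (F : Type) [Field F] [Fintype F] [DecidableEq F] : MulChar F ℂ :=
  (quadraticChar F).ringHomComp (Int.castRingHom ℂ)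

/-- Jacobi-type sums -/
noncomputable def J (θ : MulChar F ℂ) : ℂ := ∑ t : F, θ t * chi F (1 + t)

lemma chi_apply (x : F) : chi F x = ((quadraticChar F x : ℤ) : ℂ) := by
  simp [chi, MulChar.ringHomComp_apply]

lemma chi_odd_pow (l : ℕ) (hl : Odd l) (x : F) : (chi F x) ^ l = chi F x := by
  rw [chi_apply]
  by_cases hx : x = 0
  · subst hx
    simp [hl.pos.ne']
  · rcases quadraticChar_dichotomy hx with h | h <;> simp [h, hl.neg_one_pow]

lemma chi_mul_self : chi F * chi F = 1 := by
  ext x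
  rw [MulChar.mul_apply, chi_apply]
  rcases quadraticChar_dichotomy (a := (x : F)) x.ne_zero with h | h <;> simp [h]

lemma chi_inv : (chi F)⁻¹ = chi F := inv_eq_of_mul_eq_one_left chi_mul_self

lemma chi_ne_one (hF2 : ringChar F ≠ 2) : chi F ≠ 1 := by
  obtain ⟨a, ha⟩ := quadraticChar_exists_neg_one' hF2
  intro h
  have := chi_apply (F := F) (a : F)
  rw [h, ha] at this
  simp at this
  norm_num at this

lemma isIntegral_char (θ : MulChar F ℂ) (t : F) : IsIntegral ℤ (θ t) := by
  by_cases ht : t = 0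
  · subst ht; rw [MulChar.map_nonunit _ (by simp)]; exact isIntegral_zero
  · have h : 0 < Fintype.card F - 1 := by have := Fintype.one_lt_card (α := F); omega
    refine IsIntegral.of_pow h ?_
    rw [← map_pow, FiniteField.pow_card_sub_one_eq_one t ht, map_one]
    exact isIntegral_one

lemma J_frob (p : ℕ) [Fact p.Prime] [CharP F p] (hp2 : Odd p) (θ : MulChar F ℂ) :
    J (θ ^ p) = J θ := by
  unfold J
  refine Fintype.sum_bijective (fun x => x ^ p) (bijective_frobenius F p) _ _ ?_
  intro t
  rw [MulChar.pow_apply' _ hp2.pos.ne', ← map_pow, ← chi_odd_pow p hp2 (1 + t), ← map_pow,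
    add_pow_char, one_pow]

lemma J_inv (θ : MulChar F ℂ) : J (chi F * θ⁻¹) = J θ := by
  unfold J
  refine Fintype.sum_bijective (fun x => x⁻¹) inv_involutive.bijective _ _ ?_
  intro t
  by_cases ht : t = 0
  · subst ht; simp [MulChar.map_nonunit]
  · have : (1 + t⁻¹) = t⁻¹ * (1 + t) := by field_simp; ring
    rw [this, map_mul, MulChar.mul_apply, MulChar.inv_apply']
    have h : chi F t⁻¹ = chi F t := by rw [← MulChar.inv_apply', chi_inv]
    rw [h]; ring

lemma J_conj (θ : MulChar F ℂ) : star (J θ) = J θ⁻¹ := by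
  unfold J
  rw [star_sum]
  refine Finset.sum_congr rfl fun t _ => ?_
  rw [star_mul', MulChar.star_apply', MulChar.star_apply', chi_inv]

lemma J_eq_jacobi (θ : MulChar F ℂ) (hθ : θ (-1) = 1) : J θ = jacobiSum θ (chi F) := by
  unfold J jacobiSum
  refine Fintype.sum_bijective (fun x => -x) neg_involutive.bijective _ _ ?_
  intro t
  have : -t = (-1) * t := by ring
  rw [sub_neg_eq_add, this, map_mul, hθ, one_mul]

lemma J_norm (hF2 : ringChar F ≠ 2) (θ : MulChar F ℂ) (h1 : θ ≠ 1) (h2 : θ * chi F ≠ 1)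
    (hθ : θ (-1) = 1) : J θ * J θ⁻¹ = Fintype.card F := by
  rw [J_eq_jacobi θ hθ, J_eq_jacobi θ⁻¹ (by rw [MulChar.inv_apply', inv_neg_one, hθ])]
  have h0 : ringChar ℂ ≠ ringChar F := by
    have : ringChar ℂ = 0 := ringChar.eq_zero
    rw [this]
    exact (CharP.ringChar_ne_zero_of_finite F).symm
  have := jacobiSum_mul_jacobiSum_inv h0 h1 (chi_ne_one hF2) h2
  rwa [chi_inv] at this

lemma sum_pow_prime (l : ℕ) (hl : l.Prime) {ι : Type} (s : Finset ι) (f : ι → ℂ)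
    (hf : ∀ i, IsIntegral ℤ (f i)) :
    ∃ r : ℂ, IsIntegral ℤ r ∧ (∑ i ∈ s, f i) ^ l = ∑ i ∈ s, f i ^ l + l * r := by
  classical
  choose! g hg using fun i => (⟨⟨f i, hf i⟩, rfl⟩ : ∃ g : integralClosure ℤ ℂ, (g : ℂ) = f i)
  have : ∃ r : integralClosure ℤ ℂ, (∑ i ∈ s, g i) ^ l = ∑ i ∈ s, g i ^ l + l * r := by
    induction s using Finset.induction_on with
    | empty => exact ⟨0, by simp [hl.ne_zero]⟩
    | insert a s ha ih =>
      obtain ⟨r, hr⟩ := ih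
      obtain ⟨r', hr'⟩ := exists_add_pow_prime_eq hl (g a) (∑ i ∈ s, g i)
      refine ⟨r + g a * (∑ i ∈ s, g i) * r', ?_⟩
      rw [Finset.sum_insert ha, Finset.sum_insert ha, hr', hr]
      ring
  obtain ⟨r, hr⟩ := this
  refine ⟨r, r.2, ?_⟩
  have := congrArg (fun x : integralClosure ℤ ℂ => (x : ℂ)) hr
  push_cast at this
  simpa [hg] using this

lemma J_prime (l : ℕ) (hl : l.Prime) (hl2 : Odd l) (θ : MulChar F ℂ) :
    ∃ r : ℂ, IsIntegral ℤ r ∧ (J θ) ^ l = J (θ ^ l) + l * r := by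
  obtain ⟨r, hr, h⟩ := sum_pow_prime l hl Finset.univ (fun t : F => θ t * chi F (1 + t))
    (fun t => (isIntegral_char _ _).mul (isIntegral_char _ _))
  refine ⟨r, hr, ?_⟩
  unfold J
  rw [h]
  congr 1
  refine Finset.sum_congr rfl fun t _ => ?_
  rw [mul_pow, chi_odd_pow l hl2, MulChar.pow_apply' _ hl.ne_zero]

lemma int_dvd_of_integral (m n : ℤ) (hn : n ≠ 0) (r : ℂ) (hr : IsIntegral ℤ r) (h : (m : ℂ) = n * r) :
    n ∣ m := by
  have hn' : (n : ℂ) ≠ 0 := by exact_mod_cast hn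
  have hr2 : r = algebraMap ℚ ℂ (m / n) := by
    simp only [eq_ratCast]; push_cast
    field_simp; rw [h]; ring
  rw [hr2] at hr
  have hr3 : IsIntegral ℤ ((m : ℚ) / n) := (isIntegral_algebraMap_iff (algebraMap ℚ ℂ).injective).1 hr
  obtain ⟨z, hz⟩ := IsIntegrallyClosed.isIntegral_iff.1 hr3
  refine ⟨z, ?_⟩
  have hnq : (n : ℚ) ≠ 0 := by exact_mod_cast hn
  have : (m : ℚ) = n * z := by
    have : (z : ℚ) = m / n := by simpa using hz
    rw [this]; field_simp
  exact_mod_cast this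

lemma J_four (hF2 : ringChar F ≠ 2) (ψ : MulChar F ℂ) (h4 : ψ ^ 4 = 1) (h1 : ψ ≠ 1) 
    (m : ℤ) (hm : J ψ = m) (hpsi : ψ (-1) = 1) : (4 : ℤ) ∣ m + Fintype.card F := by
  -- termwise: ψ(t)χ(1+t) = (ψ-1)(χ-1) + ψ + χ - 1 + corrections at t = 0, -1
  have key : ∀ t : F, ∃ z : ℂ, IsIntegral ℤ z ∧ 
      ψ t * chi F (1 + t) = 2 * (Complex.I - 1) * z + ψ t + chi F (1 + t) - 1 := by
    intro t
    by_cases ht : t = 0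
    · subst ht
      exact ⟨0, isIntegral_zero, by simp [MulChar.map_nonunit]⟩
    · by_cases ht' : t = -1
      · subst ht'
        exact ⟨0, isIntegral_zero, by simp [MulChar.map_nonunit, hpsi]⟩
      · have hI : IsIntegral ℤ Complex.I :=
          IsIntegral.of_pow (n := 4) (by norm_num) (by rw [Complex.I_pow_four]; exact isIntegral_one)
        obtain ⟨k, _, hk⟩ := MulChar.exists_apply_eq_pow h4 Complex.isPrimitiveRoot_I ht
        obtain ⟨z, hzI, hz'⟩ : ∃ z : ℂ, IsIntegral ℤ z ∧ ψ t - 1 = z * (Complex.I - 1) := by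
          refine hk ▸ ⟨(Finset.range k).sum (Complex.I ^ ·), ?_, (geom_sum_mul _ k).symm⟩
          exact IsIntegral.sum _ fun m _ => hI.pow m
        have ht2 : 1 + t ≠ 0 := fun h => ht' (by linear_combination h)
        have : ψ t = z * (Complex.I - 1) + 1 := by rw [← hz']; ring
        rcases quadraticChar_dichotomy ht2 with h | h
        · refine ⟨0, isIntegral_zero, ?_⟩
          rw [chi_apply, h]; simp
        · refine ⟨-z, hzI.neg, ?_⟩
          rw [chi_apply, h, this]; push_cast; ring
  choose z hz hzt using key
  have hsum : J ψ + Fintype.card F = 2 * (Complex.I - 1) * ∑ t, z t := by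
    unfold J
    have h2 : ∑ t : F, chi F (1 + t) = 0 := by
      rw [← MulChar.sum_eq_zero_of_ne_one (chi_ne_one hF2)]
      exact Fintype.sum_bijective (fun x => 1 + x) (AddGroup.addLeft_bijective 1) _ _ (fun _ => rfl)
    rw [Finset.sum_congr rfl fun t _ => hzt t]
    rw [Finset.sum_sub_distrib, Finset.sum_add_distrib, Finset.sum_add_distrib, h2,
      MulChar.sum_eq_zero_of_ne_one h1, ← Finset.mul_sum]
    simp
  have hZ : IsIntegral ℤ (∑ t, z t) := IsIntegral.sum _ fun t _ => hz t
  have hI : IsIntegral ℤ Complex.I := 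
    IsIntegral.of_pow (n := 4) (by norm_num) (by rw [Complex.I_pow_four]; exact isIntegral_one)
  have hsq : (((m + Fintype.card F) ^ 2 : ℤ) : ℂ) = (8 : ℤ) * (-(Complex.I * (∑ t, z t) ^ 2)) := by
    push_cast
    rw [← hm, hsum]
    have : Complex.I ^ 2 = -1 := Complex.I_sq
    linear_combination (4 * (∑ t, z t) ^ 2) * this
  have h8 := int_dvd_of_integral _ 8 (by norm_num) _ ((hI.mul (hZ.pow 2)).neg) hsq
  obtain ⟨c, hc⟩ := h8
  generalize m + (Fintype.card F : ℤ) = w at *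
  obtain ⟨v, hv⟩ : ∃ v, v = w / 4 := ⟨_, rfl⟩
  rcases (by omega : w % 4 = 0 ∨ w % 4 = 1 ∨ w % 4 = 2 ∨ w % 4 = 3) with h | h | h | h
  · omega
  · obtain rfl : w = 4 * v + 1 := by omega
    ring_nf at hc; omega
  · obtain rfl : w = 4 * v + 2 := by omega
    ring_nf at hc; omega
  · obtain rfl : w = 4 * v + 3 := by omega
    ring_nf at hc; omega
end JSum
end Cheb


namespace Cheb
section Eta
set_option linter.unusedSectionVars false
variable {F : Type} [Field F] [Fintype F] [DecidableEq F]

lemma exists_eta (h60 : Fintype.card F % 60 = 1) (g : Fˣ) (hg : ∀ x, x ∈ Subgroup.zpowers g) :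
    ∃ η : MulChar F ℂ, IsPrimitiveRoot (η g) 60 := by
  have hz := Complex.isPrimitiveRoot_exp 60 (by norm_num)
  have hc : Fintype.card Fˣ = Fintype.card F - 1 := Fintype.card_units F
  obtain ⟨ζ, hζ⟩ := hz.isUnit (by norm_num)
  rw [← hζ] at hz
  have hmem : ζ ∈ rootsOfUnity (Fintype.card Fˣ) ℂ := by
    rw [mem_rootsOfUnity, hc]
    obtain ⟨c, hc⟩ : 60 ∣ Fintype.card F - 1 := by omega
    rw [hc, pow_mul]
    have : ζ ^ 60 = 1 := by ext; push_cast; exact hz.pow_eq_one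
    rw [this, one_pow]
  exact ⟨MulChar.ofRootOfUnity hmem hg, by rw [MulChar.ofRootOfUnity_spec]; exact hz⟩

lemma neg_of_sq {K : Type} [Field K] {x : K} (h1 : x ≠ 1) (h2 : x ^ 2 = 1) : x = -1 :=
  (sq_eq_one_iff.1 h2).resolve_left h1

lemma gen_prim (g : Fˣ) (hg : ∀ x, x ∈ Subgroup.zpowers g) :
    IsPrimitiveRoot (g : F) (Fintype.card F - 1) := by
  have h := IsPrimitiveRoot.orderOf g
  rw [orderOf_eq_card_of_forall_mem_zpowers hg, Nat.card_eq_fintype_card, Fintype.card_units] at h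
  exact (IsPrimitiveRoot.coe_units_iff).2 h

variable {g : Fˣ} {η : MulChar F ℂ}

lemma gpow_log (hg : ∀ x, x ∈ Subgroup.zpowers g) (s : F) (hs : s ≠ 0) : ∃ m : ℕ, s = (g : F) ^ m := by
  have := hg (Units.mk0 s hs)
  rw [← mem_powers_iff_mem_zpowers] at this
  obtain ⟨m, hm⟩ := this
  refine ⟨m, ?_⟩
  have := congrArg Units.val hm
  simpa using this.symm

lemma eta_pow_one_iff (hg : ∀ x, x ∈ Subgroup.zpowers g) (hη : IsPrimitiveRoot (η g) 60) (m : ℕ) :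
    η ^ m = 1 ↔ 60 ∣ m := by
  rw [MulChar.eq_iff hg, MulChar.pow_apply_coe, MulChar.one_apply_coe, hη.pow_eq_one_iff_dvd]

lemma eta_pow_eq (hg : ∀ x, x ∈ Subgroup.zpowers g) (hη : IsPrimitiveRoot (η g) 60) {m n : ℕ}
    (h : m % 60 = n % 60) : η ^ m = η ^ n := by
  have h1 : η ^ 60 = 1 := (eta_pow_one_iff hg hη 60).2 dvd_rfl
  rw [← Nat.div_add_mod m 60, ← Nat.div_add_mod n 60, pow_add, pow_add, pow_mul, pow_mul, h1, h,
    one_pow, one_pow]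

lemma eta_chi (hF2 : ringChar F ≠ 2) (hg : ∀ x, x ∈ Subgroup.zpowers g)
    (hη : IsPrimitiveRoot (η g) 60) : η ^ 30 = chi F := by
  rw [MulChar.eq_iff hg, MulChar.pow_apply_coe]
  have h1 : chi F g ≠ 1 := by
    intro h
    exact chi_ne_one hF2 ((MulChar.eq_iff hg _ _).2 (by rw [h, MulChar.one_apply_coe]))
  have h2 : (η g) ^ 30 ≠ 1 := by
    intro h; rw [hη.pow_eq_one_iff_dvd] at h; omega
  have h3 : ((η g) ^ 30) ^ 2 = 1 := by rw [← pow_mul]; exact hη.pow_eq_one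
  have h4 : (chi F g) ^ 2 = 1 := by
    rw [sq, ← MulChar.mul_apply, chi_mul_self, MulChar.one_apply_coe]
  rw [(neg_of_sq h2 h3), (neg_of_sq h1 h4)]

lemma eta_neg_one (h120 : Fintype.card F % 120 = 1) (hg : ∀ x, x ∈ Subgroup.zpowers g)
    (hη : IsPrimitiveRoot (η g) 60) (hF2 : ringChar F ≠ 2) : η (-1) = 1 := by
  have hp := gen_prim g hg
  have hQ := Fintype.one_lt_card (α := F)
  obtain ⟨c, hc⟩ : 120 ∣ Fintype.card F - 1 := by omega
  set x : F := (g : F) ^ c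
  have h1 : x ^ 60 ≠ 1 := by
    rw [← pow_mul]; intro h; rw [hp.pow_eq_one_iff_dvd, hc] at h
    have := Nat.le_of_dvd (by omega) h
    omega
  have h2 : (x ^ 60) ^ 2 = 1 := by
    rw [← pow_mul, ← pow_mul, hp.pow_eq_one_iff_dvd, hc]; exact ⟨1, by ring⟩
  have h3 : x ^ 60 = -1 := neg_of_sq h1 h2
  have hx : x ≠ 0 := pow_ne_zero _ g.ne_zero
  rw [← h3, map_pow, ← MulChar.pow_apply' _ (by norm_num), (eta_pow_one_iff hg hη 60).2 dvd_rfl,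
    MulChar.one_apply hx.isUnit]

lemma card_fiber (n : ℕ) (hn : 0 < n) (hnd : n ∣ Fintype.card F - 1)
    (hg : ∀ x, x ∈ Subgroup.zpowers g) (t₀ : F) (h0 : t₀ ≠ 0) :
    (Finset.univ.filter (fun t : F => t ^ n = t₀ ^ n)).card = n := by
  have hQ := Fintype.one_lt_card (α := F)
  obtain ⟨c, hc⟩ := hnd
  have hz : IsPrimitiveRoot ((g : F) ^ c) n := 
    (gen_prim g hg).pow (by omega) (by rw [hc]; ring)
  refine Eq.trans (Eq.symm ?_) hz.card_nthRootsFinset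
  refine Finset.card_bij (fun u _ => t₀ * u) ?_ ?_ ?_
  · intro u hu
    rw [Polynomial.mem_nthRootsFinset hn] at hu
    simp [mul_pow, hu]
  · intro a _ b _ h
    exact mul_left_cancel₀ h0 h
  · intro t ht
    simp only [Finset.mem_filter, Finset.mem_univ, true_and] at ht
    refine ⟨t / t₀, ?_, by field_simp⟩
    rw [Polynomial.mem_nthRootsFinset hn, div_pow, ht, div_self (pow_ne_zero _ h0)]

lemma orth (n : ℕ) (hn : 0 < n) (hnd : n ∣ Fintype.card F - 1)
    (hg : ∀ x, x ∈ Subgroup.zpowers g) (θ : MulChar F ℂ) (hθ : IsPrimitiveRoot (θ g) (2 * n))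
    (hθn : θ ^ n = chi F) :
    ∑ i ∈ Finset.range n, J (θ ^ (2 * i + 1)) = ∑ t : F, chi F t * chi F (1 + t ^ n) := by
  have hpt : ∀ s : F, ∑ t ∈ Finset.univ.filter (fun t : F => t ^ n = s), chi F t =
      θ s * ∑ i ∈ Finset.range n, (θ s ^ 2) ^ i := by
    intro s
    by_cases hs : s = 0
    · subst hs
      have : θ 0 = 0 := MulChar.map_nonunit _ (by simp)
      rw [this, zero_mul]
      refine Finset.sum_eq_zero fun t ht => ?_
      simp only [Finset.mem_filter, Finset.mem_univ, true_and] at ht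
      rw [eq_zero_of_pow_eq_zero ht]
      exact MulChar.map_nonunit _ (by simp)
    · have hroot : ∀ t : F, t ^ n = s → chi F t = θ s := by
        intro t ht
        rw [← ht, map_pow, ← hθn, MulChar.pow_apply' _ hn.ne']
      by_cases hex : ∃ t₀ : F, t₀ ^ n = s
      · obtain ⟨t₀, ht0⟩ := hex
        have h0 : t₀ ≠ 0 := by rintro rfl; rw [zero_pow hn.ne'] at ht0; exact hs ht0.symm
        have hsq : θ s ^ 2 = 1 := by
          rw [← hroot t₀ ht0, sq, ← MulChar.mul_apply, chi_mul_self, MulChar.one_apply h0.isUnit]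
        rw [Finset.sum_congr rfl fun t ht => hroot t (by simpa using ht), hsq]
        have := card_fiber n hn hnd hg t₀ h0
        rw [ht0] at this
        simp [this, mul_comm]
      · have hne : θ s ^ 2 ≠ 1 := by
          intro h
          obtain ⟨m, hm⟩ := gpow_log hg s hs
          rw [hm, map_pow, ← pow_mul, hθ.pow_eq_one_iff_dvd] at h
          have : n ∣ m := by
            rw [mul_comm m 2] at h
            exact Nat.dvd_of_mul_dvd_mul_left (by norm_num) h
          obtain ⟨c, hc⟩ := this
          exact hex ⟨(g : F) ^ c, by rw [hm, hc, ← pow_mul, mul_comm c n]⟩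
        have hnp : (θ s ^ 2) ^ n = 1 := by
          rw [← pow_mul, mul_comm, pow_mul, ← MulChar.pow_apply' _ hn.ne', hθn, sq,
            ← MulChar.mul_apply, chi_mul_self, MulChar.one_apply (Ne.isUnit hs)]
        rw [geom_sum_eq hne, hnp, sub_self, zero_div, mul_zero]
        refine Finset.sum_eq_zero fun t ht => ?_
        exact absurd ⟨t, by simpa using ht⟩ hex
  have hR : ∑ t : F, chi F t * chi F (1 + t ^ n) = 
      ∑ s : F, (∑ t ∈ Finset.univ.filter (fun t : F => t ^ n = s), chi F t) * chi F (1 + s) := by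
    rw [← Finset.sum_fiberwise Finset.univ (fun t : F => t ^ n)]
    refine Finset.sum_congr rfl fun s _ => ?_
    rw [Finset.sum_mul]
    refine Finset.sum_congr rfl fun t ht => ?_
    simp only [Finset.mem_filter, Finset.mem_univ, true_and] at ht
    rw [ht]
  rw [hR]
  simp only [hpt]
  unfold J
  rw [Finset.sum_comm]
  refine Finset.sum_congr rfl fun s _ => ?_
  rw [← Finset.sum_mul, Finset.mul_sum]
  congr 1
  refine Finset.sum_congr rfl fun i _ => ?_
  rw [MulChar.pow_apply' _ (by omega)]
  ring

lemma T_cast (d : ℕ) : ((Tsum F d : ℤ) : ℂ) = ∑ t : F, chi F t * chi F (1 + t ^ (2 * d)) := by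
  unfold Tsum
  push_cast
  simp [chi_apply]

/-- index set of the 28 characters -/
def I28 : Finset ℕ := (Finset.range 30).filter (fun i => i ≠ 7 ∧ i ≠ 22)

lemma sum28 (hF2 : ringChar F ≠ 2) (h60 : Fintype.card F % 60 = 1)
    (hg : ∀ x, x ∈ Subgroup.zpowers g) (hη : IsPrimitiveRoot (η g) 60) :
    2 * ((Ssum F 15 : ℤ) : ℂ) = ∑ i ∈ I28, J (η ^ (2 * i + 1)) := by
  have h := congrArg (fun z : ℤ => (z : ℂ)) (S_eq_T hF2 h60)
  push_cast at h
  rw [h, T_cast, T_cast]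
  have h30 := eta_chi hF2 hg hη
  rw [show 2 * 15 = 30 from rfl, show 2 * 1 = 2 from rfl]
  rw [← orth 30 (by norm_num) (by omega) hg η hη h30]
  rw [← orth 2 (by norm_num) (by omega) hg (η ^ 15)
    (by rw [MulChar.pow_apply_coe]; exact hη.pow (by norm_num) (by norm_num)) (by rw [← pow_mul]; exact h30)]
  simp only [← pow_mul]
  have : I28 = (Finset.range 30) \ {7, 22} := by decide
  rw [this, Finset.sum_sdiff_eq_sub (by decide)]
  congr 1
end Eta
end Cheb


namespace Cheb
section Good
set_option linter.unusedSectionVars false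
variable {F : Type} [Field F] [Fintype F] [DecidableEq F]
variable {g : Fˣ} {η : MulChar F ℂ}

lemma eta_odd_norm (hF2 : ringChar F ≠ 2) (h120 : Fintype.card F % 120 = 1)
    (hg : ∀ x, x ∈ Subgroup.zpowers g) (hη : IsPrimitiveRoot (η g) 60) (j : ℕ) (hj : Odd j) :
    J (η ^ j) * J (η ^ j)⁻¹ = Fintype.card F := by
  obtain ⟨i, rfl⟩ := hj
  refine J_norm hF2 _ ?_ ?_ ?_
  · rw [Ne, eta_pow_one_iff hg hη]; omega
  · rw [← eta_chi hF2 hg hη, ← pow_add, Ne, eta_pow_one_iff hg hη]; omega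
  · rw [MulChar.pow_apply' _ (by omega), eta_neg_one h120 hg hη hF2, one_pow]

lemma J_real (p : ℕ) [Fact p.Prime] [CharP F p] (hF2 : ringChar F ≠ 2)
    (hp60 : p % 60 = 31 ∨ p % 60 = 59)
    (hg : ∀ x, x ∈ Subgroup.zpowers g) (hη : IsPrimitiveRoot (η g) 60) (j : ℕ) (hj : Odd j) :
    J (η ^ j)⁻¹ = J (η ^ j) := by
  have hodd : Odd p := Nat.odd_iff.2 (by omega)
  rcases hp60 with h | h
  · rw [← J_inv, inv_inv, ← J_frob p hodd (η ^ j), ← eta_chi hF2 hg hη, ← pow_add, ← pow_mul]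
    congr 1
    apply eta_pow_eq hg hη
    obtain ⟨i, rfl⟩ := hj
    rw [Nat.mul_mod, h]
    omega
  · rw [← J_frob p hodd (η ^ j)]
    congr 1
    rw [inv_eq_iff_mul_eq_one, ← pow_mul, ← pow_add, eta_pow_one_iff hg hη]
    obtain ⟨c, hc⟩ : 60 ∣ p + 1 := by omega
    exact ⟨j * c, by rw [show j + j * p = j * (p + 1) by ring, hc]; ring⟩

lemma J_pm (p q : ℕ) [Fact p.Prime] [CharP F p] (hF2 : ringChar F ≠ 2)
    (hp60 : p % 60 = 31 ∨ p % 60 = 59) (hQ : Fintype.card F = q ^ 2)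
    (h120 : Fintype.card F % 120 = 1)
    (hg : ∀ x, x ∈ Subgroup.zpowers g) (hη : IsPrimitiveRoot (η g) 60) (j : ℕ) (hj : Odd j) :
    ∃ a : ℤ, (a = q ∨ a = -q) ∧ J (η ^ j) = a := by
  have h := eta_odd_norm hF2 h120 hg hη j hj
  rw [J_real p hF2 hp60 hg hη j hj, hQ] at h
  push_cast at h
  have h2 : (J (η ^ j) - q) * (J (η ^ j) + q) = 0 := by linear_combination h
  rcases mul_eq_zero.1 h2 with h3 | h3
  · exact ⟨q, Or.inl rfl, by push_cast; linear_combination h3⟩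
  · exact ⟨-q, Or.inr rfl, by push_cast; linear_combination h3⟩

lemma J_prime_eq (q : ℕ) (l : ℕ) (hl : l.Prime) (hl2 : Odd l) (hlq : ¬ l ∣ q) (θ : MulChar F ℂ)
    (a b : ℤ) (ha : a = q ∨ a = -q) (hb : b = q ∨ b = -q) (hJa : J θ = a) (hJb : J (θ ^ l) = b) :
    a = b := by
  obtain ⟨r, hr, h⟩ := J_prime l hl hl2 θ
  rw [hJa, hJb] at h
  have h1 : (l : ℤ) ∣ a ^ l - b := by
    refine int_dvd_of_integral _ _ (by exact_mod_cast hl.ne_zero) r hr ?_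
    push_cast; linear_combination h
  have := Fact.mk hl
  have h2 : (l : ℤ) ∣ a ^ l - a := by
    rw [← ZMod.intCast_zmod_eq_zero_iff_dvd]
    push_cast
    rw [ZMod.pow_card, sub_self]
  have h3 : (l : ℤ) ∣ a - b := by
    have := dvd_sub h1 h2
    rwa [show a ^ l - b - (a ^ l - a) = a - b by ring] at this
  have h4 : ¬ (l : ℤ) ∣ 2 * q := by
    intro h5
    have h6 : l ∣ 2 * q := by exact_mod_cast h5
    rcases (Nat.Prime.dvd_mul hl).1 h6 with h7 | h7
    · have := (Nat.prime_dvd_prime_iff_eq hl Nat.prime_two).1 h7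
      subst this
      revert hl2; decide
    · exact hlq h7
  rcases ha with rfl | rfl <;> rcases hb with rfl | rfl
  · rfl
  · exact absurd (by convert h3 using 1; ring) h4
  · refine absurd ?_ h4
    have h8 := (dvd_neg (α := ℤ)).2 h3
    rwa [show -(-(q : ℤ) - q) = 2 * q by ring] at h8
  · rfl

lemma S_good (p k : ℕ) [Fact p.Prime] [CharP F p] (hF2 : ringChar F ≠ 2)
    (hp60 : p % 60 = 31 ∨ p % 60 = 59) (hQ : Fintype.card F = (p ^ k) ^ 2)
    (h120 : Fintype.card F % 120 = 1) :
    Ssum F 15 = if Odd k then 14 * (p : ℤ) ^ k else - 14 * (p : ℤ) ^ k := by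
  obtain ⟨g, hg⟩ := IsCyclic.exists_generator (α := Fˣ)
  obtain ⟨η, hη⟩ := exists_eta (by omega) g hg
  have hpm := J_pm p (p ^ k) hF2 hp60 hQ h120 hg hη
  have hpp : p.Prime := Fact.out
  have h3 : ¬ 3 ∣ p ^ k := fun h => by
    have := Nat.prime_three.dvd_of_dvd_pow h; omega
  have h5 : ¬ 5 ∣ p ^ k := fun h => by
    have := Nat.prime_five.dvd_of_dvd_pow h; omega
  obtain ⟨b, hb, hJb⟩ := hpm 15 (by decide)
  have hall : ∀ j, Odd j → J (η ^ j) = b := by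
    intro j hj
    obtain ⟨a, ha, hJa⟩ := hpm j hj
    obtain ⟨a3, ha3, hJa3⟩ := hpm (j * 3) (hj.mul (by decide))
    obtain ⟨a15, ha15, hJa15⟩ := hpm (j * 3 * 5) ((hj.mul (by decide)).mul (by decide))
    have e1 := J_prime_eq (p ^ k) 3 Nat.prime_three (by decide) h3 _ a a3 ha ha3 hJa
      (by rw [← pow_mul, hJa3])
    have e2 := J_prime_eq (p ^ k) 5 Nat.prime_five (by decide) h5 _ a3 a15 ha3 ha15 hJa3
      (by rw [← pow_mul, hJa15])
    rw [hJa, e1, e2, ← hJa15, ← hJb]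
    obtain ⟨i, rfl⟩ := hj
    rcases Nat.even_or_odd' i with ⟨m, rfl | rfl⟩
    · congr 1
      exact eta_pow_eq hg hη (by omega)
    · rw [← J_real p hF2 hp60 hg hη 15 (by decide)]
      congr 1
      rw [eq_comm, inv_eq_iff_mul_eq_one, ← pow_add, eta_pow_one_iff hg hη]
      omega
  have hS := sum28 hF2 (by omega) hg hη
  rw [Finset.sum_congr rfl fun i _ => hall (2 * i + 1) ⟨i, rfl⟩, Finset.sum_const,
    show I28.card = 28 by decide] at hS
  have hS' : 2 * Ssum F 15 = 28 * b := by
    have : ((2 * Ssum F 15 : ℤ) : ℂ) = ((28 * b : ℤ) : ℂ) := by push_cast; rw [hS]; simp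
    exact_mod_cast this
  have h4 := J_four hF2 (η ^ 15) (by rw [← pow_mul]; exact (eta_pow_one_iff hg hη _).2 (by norm_num))
    (by rw [Ne, eta_pow_one_iff hg hη]; omega) b hJb
    (by rw [MulChar.pow_apply' _ (by omega), eta_neg_one h120 hg hη hF2, one_pow])
  have hp4 : p % 4 = 3 := by omega
  push_cast at hb
  have hqk : ((p : ℤ) ^ k) % 4 = if Odd k then 3 else 1 := by
    rcases Nat.even_or_odd' k with ⟨m, rfl | rfl⟩
    · rw [if_neg (by simp), pow_mul]
      have : ((p : ℤ) ^ 2) ≡ 1 [ZMOD 4] := by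
        have : (p : ℤ) ≡ 3 [ZMOD 4] := by unfold Int.ModEq; omega
        exact (this.pow 2).trans (by decide)
      exact (this.pow m).trans (by rw [one_pow])
    · rw [if_pos (by simp), pow_succ, pow_mul]
      have h' : (p : ℤ) ≡ 3 [ZMOD 4] := by unfold Int.ModEq; omega
      have : ((p : ℤ) ^ 2) ≡ 1 [ZMOD 4] := (h'.pow 2).trans (by decide)
      exact ((this.pow m).mul h').trans (by rw [one_pow])
  generalize (p : ℤ) ^ k = z at *
  split_ifs at * <;> omega
end Good
end Cheb


namespace Cheb
section Bad
set_option linter.unusedSectionVars false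
variable {F : Type} [Field F] [Fintype F] [DecidableEq F]
variable {g : Fˣ} {η : MulChar F ℂ}

lemma all_eq (q : ℕ) (hF2 : ringChar F ≠ 2) (h120 : Fintype.card F % 120 = 1)
    (hQ : Fintype.card F = q ^ 2)
    (hg : ∀ x, x ∈ Subgroup.zpowers g) (hη : IsPrimitiveRoot (η g) 60)
    (hS : Ssum F 15 = 14 * q) : ∀ i ∈ I28, J (η ^ (2 * i + 1)) = q := by
  have hn : ∀ i, (J (η ^ (2 * i + 1))).re ^ 2 + (J (η ^ (2 * i + 1))).im ^ 2 = (q : ℝ) ^ 2 := by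
    intro i
    have h := eta_odd_norm hF2 h120 hg hη (2 * i + 1) ⟨i, rfl⟩
    rw [← J_conj, hQ, Complex.star_def, Complex.mul_conj, Complex.normSq_apply] at h
    have h2 : (J (η ^ (2 * i + 1))).re * (J (η ^ (2 * i + 1))).re +
      (J (η ^ (2 * i + 1))).im * (J (η ^ (2 * i + 1))).im = (q : ℝ) ^ 2 := by exact_mod_cast h
    linarith
  have hle : ∀ i ∈ I28, (J (η ^ (2 * i + 1))).re ≤ (q : ℝ) := by
    intro i _
    refine abs_le_of_sq_le_sq' ?_ (Nat.cast_nonneg q) |>.2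
    nlinarith [hn i, sq_nonneg (J (η ^ (2 * i + 1))).im]
  have hs := congrArg Complex.re (sum28 hF2 (by omega) hg hη)
  rw [hS, Complex.re_sum] at hs
  have hs2 : ∑ i ∈ I28, (J (η ^ (2 * i + 1))).re = ∑ i ∈ I28, (q : ℝ) := by
    rw [← hs, Finset.sum_const, show I28.card = 28 by decide]
    simp; ring
  have hre := (Finset.sum_eq_sum_iff_of_le hle).1 hs2
  intro i hi
  apply Complex.ext
  · simpa using hre i hi
  · have := hn i
    rw [hre i hi] at this
    have h0 : (J (η ^ (2 * i + 1))).im ^ 2 = 0 := by linarith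
    simpa using h0

lemma reduce (z : ℤ) (hF2 : ringChar F ≠ 2) (c : ℕ) (hc : Fintype.card F - 1 = 60 * c)
    (hg : ∀ x, x ∈ Subgroup.zpowers g) (hη : IsPrimitiveRoot (η g) 60) (j : ℕ) (hj : 0 < j)
    (hJ : J (η ^ j) = z) :
    ∑ t : F, (1 + t) ^ (Fintype.card F / 2) * t ^ (j * c) = (z : F) := by
  have hQ := Fintype.one_lt_card (α := F)
  have hlog : ∀ t : F, ∃ m : ℕ, t ≠ 0 → t = (g : F) ^ m := by
    intro t
    by_cases ht : t = 0
    · exact ⟨0, fun h => absurd ht h⟩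
    · obtain ⟨m, hm⟩ := gpow_log hg t ht
      exact ⟨m, fun _ => hm⟩
  choose L hL using hlog
  let P : ℤ[X] := ∑ t : F, if t = 0 then 0 else C (quadraticChar F (1 + t)) * X ^ (j * L t)
  have hP : aeval (η g) P = J (η ^ j) := by
    simp only [P, map_sum]
    unfold J
    refine Finset.sum_congr rfl fun t _ => ?_
    by_cases ht : t = 0
    · simp [ht, MulChar.map_nonunit]
    · rw [if_neg ht]
      have hpow : (η ^ j) t = (η g) ^ (j * L t) := by
        conv_lhs => rw [hL t ht]
        rw [MulChar.pow_apply' _ hj.ne', map_pow, ← pow_mul, mul_comm]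
      rw [hpow, chi_apply]
      simp [mul_comm]
  have hdvd : cyclotomic 60 ℤ ∣ P - C z := by
    rw [cyclotomic_eq_minpoly hη (by norm_num)]
    refine minpoly.isIntegrallyClosed_dvd (hη.isIntegral (by norm_num)) ?_
    rw [map_sub, hP, hJ]; simp
  have hγ : IsPrimitiveRoot ((g : F) ^ c) 60 := 
    (gen_prim g hg).pow (by omega) (by rw [hc]; ring)
  have h0 : aeval ((g : F) ^ c) (cyclotomic 60 ℤ) = 0 := by
    have := hγ.isRoot_cyclotomic (by norm_num)
    rw [IsRoot.def, ← map_cyclotomic_int, eval_map] at this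
    rw [aeval_def]; exact this
  obtain ⟨R, hR⟩ := hdvd
  have h1 := congrArg (aeval ((g : F) ^ c)) hR
  rw [map_mul, h0, zero_mul, map_sub, sub_eq_zero] at h1
  have h2 : aeval ((g : F) ^ c) (C z) = (z : F) := by simp
  rw [h2] at h1
  rw [← h1]
  simp only [P, map_sum]
  refine Finset.sum_congr rfl fun t _ => ?_
  by_cases ht : t = 0
  · have : j * c ≠ 0 := Nat.mul_ne_zero hj.ne' (by omega)
    simp [ht, this]
  · rw [if_neg ht, ← quadraticChar_eq_pow_of_char_ne_two' hF2]
    have : t ^ (j * c) = ((g : F) ^ c) ^ (j * L t) := by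
      conv_lhs => rw [hL t ht]
      rw [← pow_mul, ← pow_mul]; congr 1; ring
    rw [this]; simp

lemma power_sum (i : ℕ) (hi : 0 < i) :
    ∑ t : F, t ^ i = if Fintype.card F - 1 ∣ i then -1 else 0 := by
  rw [← FiniteField.sum_pow_units F i]
  symm
  refine Fintype.sum_of_injective Units.val Units.val_injective _ _ ?_ (fun _ => rfl)
  intro t ht
  have : t = 0 := by
    by_contra h; exact ht ⟨Units.mk0 t h, rfl⟩
  rw [this, zero_pow hi.ne']

lemma bin_sum (M N e : ℕ) (hN : Fintype.card F - 1 = N) (i₀ : ℕ) (he : 0 < e) (h : i₀ + e = N) (hM : i₀ ≤ M)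
    (hMe : M < N) : ∑ t : F, (1 + t) ^ M * t ^ e = -(M.choose i₀ : F) := by
  have h1 : ∀ t : F, (1 + t) ^ M * t ^ e = ∑ i ∈ Finset.range (M + 1), (M.choose i : F) * t ^ (i + e) := by
    intro t
    rw [add_comm, add_pow, Finset.sum_mul]
    refine Finset.sum_congr rfl fun i _ => ?_
    rw [one_pow, pow_add]; ring
  simp only [h1]
  rw [Finset.sum_comm]
  rw [Finset.sum_eq_single i₀]
  · rw [← Finset.mul_sum, power_sum _ (by omega), hN, h, if_pos dvd_rfl]; ring
  · intro i hi hne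
    rw [← Finset.mul_sum, power_sum _ (by omega), hN, if_neg, mul_zero]
    rw [Finset.mem_range] at hi
    rintro ⟨c, hc⟩
    have : c < 2 := by
      by_contra hcon
      have : N * 2 ≤ N * c := Nat.mul_le_mul_left _ (by omega)
      omega
    interval_cases c <;> omega
  · intro h; simp at h; omega

lemma S_bad (p k : ℕ) [Fact p.Prime] [CharP F p] (hcop : Nat.gcd p 30 = 1) (hF2 : ringChar F ≠ 2) (hk : 1 ≤ k)
    (h31 : p % 60 ≠ 31) (h59 : p % 60 ≠ 59) (hQ : Fintype.card F = (p ^ k) ^ 2)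
    (h120 : Fintype.card F % 120 = 1) : Ssum F 15 ≠ 14 * (p : ℤ) ^ k := by
  intro hS
  obtain ⟨g, hg⟩ := IsCyclic.exists_generator (α := Fˣ)
  obtain ⟨η, hη⟩ := exists_eta (by omega) g hg
  have hQ1 := Fintype.one_lt_card (α := F)
  have hall := all_eq (p ^ k) hF2 h120 hQ hg hη (by rw [hS]; push_cast; rfl)
  obtain ⟨a, ha, ha2, ha15, hA⟩ := exists_bad p (2 * k) Fact.out hcop h31 h59
  obtain ⟨c, hc⟩ : 60 ∣ Fintype.card F - 1 := by omega
  have hJ := hall (29 - a / 2) (by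
    simp only [I28, Finset.mem_filter, Finset.mem_range]; omega)
  rw [show 2 * (29 - a / 2) + 1 = 60 - a by omega] at hJ
  have hJ' : J (η ^ (60 - a)) = ((p ^ k : ℕ) : ℤ) := by rw [hJ]; push_cast; rfl
  have h := reduce _ hF2 c hc hg hη (60 - a) (by omega) hJ'
  rw [bin_sum (Fintype.card F / 2) (60 * c) _ hc (a * c) (Nat.mul_pos (by omega) (by omega))
    (by rw [← add_mul]; congr 1; omega) ?_ (by omega)] at h
  · push_cast at h
    rw [CharP.cast_eq_zero F p, zero_pow (by omega), neg_eq_zero, CharP.cast_eq_zero_iff F p] at h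
    apply hA
    unfold A
    have e1 : p ^ (2 * k) = 60 * c + 1 := by
      rw [mul_comm, pow_mul, ← hQ]; omega
    rw [e1]
    convert h using 2
    · omega
    · rw [show a * (60 * c + 1) = a + 60 * (a * c) by ring, Nat.add_mul_div_left _ _ (by norm_num)]
      omega
  · have : a * c ≤ 30 * c := Nat.mul_le_mul_right _ (by omega)
    omega
end Bad
end Cheb


namespace Cheb

lemma sq_mod_120 (q : ℕ) (h2 : q % 2 ≠ 0) (h3 : q % 3 ≠ 0) (h5 : q % 5 ≠ 0) :
    q ^ 2 % 120 = 1 ∨ q ^ 2 % 120 = 49 := by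
  have key : ∀ r < 120, r % 2 ≠ 0 → r % 3 ≠ 0 → r % 5 ≠ 0 → r ^ 2 % 120 = 1 ∨ r ^ 2 % 120 = 49 := by
    decide
  rw [Nat.pow_mod]
  exact key (q % 120) (Nat.mod_lt _ (by norm_num)) (by omega) (by omega) (by omega)

lemma core (p k : ℕ) (hp : p.Prime) (hcop : Nat.gcd p 30 = 1) (hk : 1 ≤ k)
    (F : Type) [Field F] [Fintype F] (hQ : Fintype.card F = (p ^ k) ^ 2) :
    chebAffineCount F 15 = (p ^ k) ^ 2 + 14 * p ^ k ↔ (Odd k ∧ (p % 60 = 59 ∨ p % 60 = 31)) := by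
  classical
  have := Fact.mk hp
  have hQ' : Fintype.card F = p ^ (2 * k) := by rw [hQ, ← pow_mul, mul_comm]
  have hch : CharP F p := by
    obtain ⟨n, hr, hn⟩ := FiniteField.card F (ringChar F)
    have hd : ringChar F ∣ p ^ (2 * k) := by
      rw [← hQ', hn]; exact dvd_pow_self _ n.pos.ne'
    have := (Nat.prime_dvd_prime_iff_eq hr hp).1 (hr.dvd_of_dvd_pow hd)
    exact ringChar.of_eq this
  have hnd : ∀ l, l.Prime → l ∣ 30 → ¬ l ∣ p := fun l hl h30 h => by
    have := Nat.dvd_gcd h h30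
    rw [hcop] at this
    exact hl.one_lt.ne' (Nat.dvd_one.1 this)
  have n2 := hnd 2 Nat.prime_two (by norm_num)
  have n3 := hnd 3 Nat.prime_three (by norm_num)
  have n5 := hnd 5 Nat.prime_five (by norm_num)
  have hF2 : ringChar F ≠ 2 := by
    rw [ringChar.eq F p]; rintro rfl; exact n2 dvd_rfl
  have hcount := count_eq F hF2 15
  have hiff : chebAffineCount F 15 = (p ^ k) ^ 2 + 14 * p ^ k ↔ Ssum F 15 = 14 * (p : ℤ) ^ k := by
    rw [hQ] at hcount
    push_cast at hcount
    constructor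
    · intro h
      rw [h] at hcount
      push_cast at hcount
      linarith
    · intro h
      rw [h] at hcount
      exact_mod_cast hcount
  rw [hiff]
  have hq0 : (0 : ℤ) < (p : ℤ) ^ k := by have := hp.pos; positivity
  have m2 : p ^ k % 2 ≠ 0 := fun h => n2 (Nat.prime_two.dvd_of_dvd_pow (Nat.dvd_of_mod_eq_zero h))
  have m3 : p ^ k % 3 ≠ 0 := fun h => n3 (Nat.prime_three.dvd_of_dvd_pow (Nat.dvd_of_mod_eq_zero h))
  have m5 : p ^ k % 5 ≠ 0 := fun h => n5 (Nat.prime_five.dvd_of_dvd_pow (Nat.dvd_of_mod_eq_zero h))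
  rcases sq_mod_120 (p ^ k) m2 m3 m5 with h | h
  · have h120 : Fintype.card F % 120 = 1 := by rw [hQ, h]
    by_cases hg : p % 60 = 31 ∨ p % 60 = 59
    · have hS := S_good p k hF2 hg hQ h120
      constructor
      · intro h1
        refine ⟨?_, hg.symm⟩
        by_contra hodd
        rw [if_neg hodd, h1] at hS
        linarith
      · rintro ⟨h1, _⟩
        rw [hS, if_pos h1]
    · constructor
      · intro h1
        exact absurd h1 (S_bad p k hcop hF2 hk (fun h => hg (Or.inl h)) (fun h => hg (Or.inr h)) hQ h120)
      · rintro ⟨_, h1⟩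
        exact absurd h1.symm hg
  · have h5 : p % 5 = 2 ∨ p % 5 = 3 := by
      by_contra hcon
      have hp2 : p ^ 2 % 5 = 1 := by
        rw [Nat.pow_mod]
        rcases (by omega : p % 5 = 1 ∨ p % 5 = 4) with h' | h' <;> rw [h']
      have : (p ^ k) ^ 2 % 5 = 1 := by
        rw [← pow_mul, mul_comm, pow_mul, Nat.pow_mod, hp2, one_pow, Nat.one_mod]
      omega
    constructor
    · intro h1
      exfalso
      have e : p ^ (2 * k) = (p ^ k) ^ 2 := by rw [← pow_mul, mul_comm]
      have hS := S_modp F p (2 * k) hF2 hQ' (by rw [e]; omega) (by rw [e]; omega)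
      have h1' : ∑ x : F, quadraticChar F ((dickson 1 (1 : F) 15).eval x) = 14 * (p : ℤ) ^ k := h1
      rw [h1'] at hS
      have hz : ((14 * (p : ℤ) ^ k : ℤ) : F) = 0 := by
        push_cast
        rw [CharP.cast_eq_zero F p, zero_pow (by omega), mul_zero]
      rw [hz, eq_comm, CharP.intCast_eq_zero_iff F p] at hS
      exact comb_ne p k hp hcop hk h5 hS
    · rintro ⟨_, h1⟩
      exfalso; omega

lemma maximal_iff (p k : ℕ) (hp : p.Prime) (hcop : Nat.gcd p 30 = 1) (hk : 1 ≤ k) :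
    chebMaximal 15 (p ^ k) ↔ (Odd k ∧ (p % 60 = 59 ∨ p % 60 = 31)) := by
  constructor
  · intro h
    have := Fact.mk hp
    let F := GaloisField p (2 * k)
    letI : Fintype F := Fintype.ofFinite F
    have hQ : Fintype.card F = (p ^ k) ^ 2 := by
      rw [← Nat.card_eq_fintype_card, GaloisField.card p (2 * k) (by omega), ← pow_mul, mul_comm]
    exact (core p k hp hcop hk F hQ).1 (h F hQ)
  · intro h F _ _ hQ
    exact (core p k hp hcop hk F hQ).2 h

end Cheb

theorem statement16 (p : ℕ) (hp : p.Prime) (hcop : Nat.gcd p 30 = 1) :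
    (∀ k, 1 ≤ k →
      (chebMaximal 15 (p ^ k) ↔ (Odd k ∧ (p % 60 = 59 ∨ p % 60 = 31)))) ∧
    ((∃ n, 0 < n ∧ chebMaximal 15 (p ^ n)) ↔ (p % 60 = 59 ∨ p % 60 = 31)) := by
  refine ⟨fun k hk => Cheb.maximal_iff p k hp hcop hk, ?_, ?_⟩
  · rintro ⟨n, hn, h⟩
    exact ((Cheb.maximal_iff p n hp hcop hn).1 h).2
  · intro h
    exact ⟨1, one_pos, (Cheb.maximal_iff p 1 hp hcop le_rfl).2 ⟨odd_one, h⟩⟩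
end
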